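/- arXiv:2111.06507 — 3 statements merged into one kernel-verified Lean document; each statement's English description precedes it below -/
import Mathlib

section
/- Let p be a prime and let C_p ⊆ S_p be the cyclic group of order p generated by a p-cycle. Then N_p(C_p,H) = O(H^2), i.e., there is a constant C (depending on p) such that for all H ≥ 2 the number of monic integer polynomials of degree p with coefficients bounded by H in absolute value, with p distinct complex roots and Galois group permutation-isomorphic to C_p, is at most C · H^2. -/
open scoped Classical
open Polynomial

/-- The monic integer polynomial `f(x) = x^n + a_1 x^{n-1} + ... + a_n`, viewed over `ℚ`
(here `a i` is the coefficient `a_{i+1}`, multiplying `x^{n-1-i}`). -/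
noncomputable def polyOf (n : ℕ) (a : Fin n → ℤ) : Polynomial ℚ :=
  X ^ n + ∑ i : Fin n, C ((a i : ℚ)) * X ^ (n - 1 - (i : ℕ))

/-- A bijection `α ≃ β` induces a group homomorphism `Perm α →* Perm β` by conjugation. -/
def permCongrHom {α β : Type*} (e : α ≃ β) : Equiv.Perm α →* Equiv.Perm β where
  toFun := e.permCongr
  map_one' := by ext x; simp
  map_mul' f g := by ext x; simp [Equiv.Perm.mul_apply]

/-- The Galois group of `f` over `ℚ`, realized as a group of permutations of the set of
complex roots of `f` (the image of the Galois action on the roots). -/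
noncomputable def galPermGroup (f : Polynomial ℚ) :
    Subgroup (Equiv.Perm (f.rootSet ℂ)) :=
  haveI : Fact ((f.map (algebraMap ℚ ℂ)).Splits) := ⟨IsAlgClosed.splits _⟩
  (Polynomial.Gal.galActionHom f ℂ).range

/-- `G_f ≅ G` as permutation groups: some bijection between the complex roots of `f`
and `Ω` conjugates the image of the Galois group acting on the roots onto `G`.
(In particular `f` has `card Ω` distinct complex roots.) -/
noncomputable def HasGaloisGroup {Ω : Type*} (G : Subgroup (Equiv.Perm Ω))
    (f : Polynomial ℚ) : Prop :=
  ∃ e : f.rootSet ℂ ≃ Ω, Subgroup.map (permCongrHom e) (galPermGroup f) = G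

/-- `N_n(G,H)`: the number of monic integer polynomials of degree `n = card Ω` with all
coefficients of absolute value at most `H`, having `n` distinct complex roots and
Galois group permutation-isomorphic to `G ≤ Perm Ω`. -/
noncomputable def Ncount {Ω : Type*} [Fintype Ω] (G : Subgroup (Equiv.Perm Ω))
    (H : ℝ) : ℕ :=
  Set.ncard {a : Fin (Fintype.card Ω) → ℤ |
    (∀ i, |(a i : ℝ)| ≤ H) ∧ HasGaloisGroup G (polyOf (Fintype.card Ω) a)}

section Boxes

variable {I : Type*} [Fintype I]

/-- The product of a function over all ordered pairs of distinct indices. -/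
noncomputable def pairProd (w : I → I → ℝ) : ℝ :=
  ∏ i, ∏ j ∈ Finset.univ.erase i, w i j

lemma pairProd_mono {w v : I → I → ℝ} (h0 : ∀ i j, 0 ≤ w i j) (h : ∀ i j, i ≠ j → w i j ≤ v i j) :
    pairProd w ≤ pairProd v := by
  refine Finset.prod_le_prod (fun i _ => Finset.prod_nonneg fun j _ => h0 i j) fun i _ => ?_
  exact Finset.prod_le_prod (fun j _ => h0 i j) fun j hj => h i j (Finset.ne_of_mem_erase hj).symm

lemma pairProd_mul (w v : I → I → ℝ) :
    pairProd (fun i j => w i j * v i j) = pairProd w * pairProd v := by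
  simp [pairProd, Finset.prod_mul_distrib]

lemma pairProd_div (w v : I → I → ℝ) :
    pairProd (fun i j => w i j / v i j) = pairProd w / pairProd v := by
  simp [pairProd, Finset.prod_div_distrib]

lemma pairProd_swap (w : I → I → ℝ) : pairProd (fun i j => w j i) = pairProd w := by
  unfold pairProd
  refine Finset.prod_comm' fun x y => ?_
  simp [eq_comm]

lemma pairProd_left (s : I → ℝ) :
    pairProd (fun i _ => s i) = (∏ i, s i) ^ (Fintype.card I - 1) := by
  simp [pairProd, Finset.prod_pow, Finset.card_erase_of_mem]

lemma pairProd_right (s : I → ℝ) :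
    pairProd (fun _ j => s j) = (∏ i, s i) ^ (Fintype.card I - 1) := by
  rw [← pairProd_left, ← pairProd_swap]

lemma pairProd_const (t : ℝ) :
    pairProd (fun _ _ : I => t) = t ^ (Fintype.card I * (Fintype.card I - 1)) := by
  rw [pairProd_left (fun _ => t)]
  simp [pow_mul]

lemma pairProd_single_left (i₀ : I) (s : I → ℝ) (hs : s i₀ = 1) :
    pairProd (fun i j => if i = i₀ then s j else 1) = ∏ i, s i := by
  unfold pairProd
  rw [Finset.prod_eq_single i₀]
  · rw [← Finset.mul_prod_erase Finset.univ s (Finset.mem_univ i₀), hs]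
    simp
  · intro i _ hi
    simp [hi]
  · simp

lemma pow_prod_erase_le_pairProd_max (r : I → ℝ) (hr : ∀ i, 1 ≤ r i) (i₀ : I) :
    (∏ i ∈ Finset.univ.erase i₀, r i) ^ Fintype.card I ≤ pairProd fun i j => max (r i) (r j) := by
  set s : I → ℝ := Function.update r i₀ 1 with hs
  have hs1 : ∀ i, 1 ≤ s i := by
    intro i
    by_cases h : i = i₀
    · subst h; simp [hs]
    · simpa [hs, h] using hr i
  have hsr : ∀ i, s i ≤ r i := by
    intro i
    by_cases h : i = i₀
    · subst h; simpa [hs] using hr i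
    · simp [hs, h]
  have hs0 : s i₀ = 1 := by simp [hs]
  have hprod : ∏ i ∈ Finset.univ.erase i₀, r i = ∏ i, s i := by
    rw [← Finset.mul_prod_erase Finset.univ s (Finset.mem_univ i₀), hs0, one_mul]
    refine Finset.prod_congr rfl fun i hi => ?_
    simp [hs, Finset.ne_of_mem_erase hi]
  have hcard : 0 < Fintype.card I := Fintype.card_pos_iff.mpr ⟨i₀⟩
  have hP : 0 ≤ ∏ i, s i := Finset.prod_nonneg fun i _ => zero_le_one.trans (hs1 i)
  have key : ((∏ i, s i) ^ Fintype.card I) ^ 2 ≤ (pairProd fun i j => max (r i) (r j)) ^ 2 := by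
    have e : ((∏ i, s i) ^ Fintype.card I) ^ 2
        = pairProd (fun i j => (s i * s j) *
          ((if i = i₀ then s j else 1) * (if j = i₀ then s i else 1))) := by
      rw [pairProd_mul, pairProd_mul, pairProd_mul, pairProd_left, pairProd_right,
        pairProd_single_left i₀ s hs0,
        pairProd_swap (fun i j => if i = i₀ then s j else 1), pairProd_single_left i₀ s hs0]
      obtain ⟨m, hm⟩ : ∃ m, Fintype.card I = m + 1 := ⟨_, (Nat.sub_add_cancel hcard).symm⟩
      rw [hm]
      simp only [Nat.add_sub_cancel]
      ring
    rw [e, sq, ← pairProd_mul]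
    refine pairProd_mono (fun i j => ?_) fun i j hij => ?_
    · have := hs1 i
      have := hs1 j
      split_ifs <;> positivity
    · have hi := hs1 i
      have hj := hs1 j
      have hi' := (hsr i).trans (le_max_left _ (r j))
      have hj' := (hsr j).trans (le_max_right (r i) _)
      by_cases h1 : i = i₀ <;> by_cases h2 : j = i₀
      · exact absurd (h1.trans h2.symm) hij
      · have : s i = 1 := h1 ▸ hs0
        simp only [h1, h2, if_true, if_false]
        rw [h1] at this
        rw [this]
        rw [h1] at hj'
        nlinarith
      · have : s j = 1 := h2 ▸ hs0
        simp only [h1, h2, if_true, if_false]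
        rw [h2] at this
        rw [this]
        rw [h2] at hi'
        nlinarith
      · simp only [h1, h2, if_false]
        nlinarith
  rw [hprod]
  refine le_of_sq_le_sq key ?_
  exact Finset.prod_nonneg fun i _ => Finset.prod_nonneg fun j _ =>
    (zero_le_one.trans (hr i)).trans (le_max_left _ _)

lemma exists_truncation (A : I → ℝ) (hA : ∀ i, 1 ≤ A i) (b : ℝ) (hb : 1 ≤ b)
    (hbA : b ≤ pairProd fun i j => max (A i) (A j)) :
    ∃ T : ℝ, 1 ≤ T ∧ pairProd (fun i j => min T (max (A i) (A j))) = b := by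
  have hmax : ∀ i j, 1 ≤ max (A i) (A j) := fun i j => (hA i).trans (le_max_left _ _)
  set M : ℝ := 1 + ∑ i, A i with hM
  have hAM : ∀ i, A i ≤ M := fun i => by
    have := Finset.single_le_sum (f := A) (fun i _ => zero_le_one.trans (hA i)) (Finset.mem_univ i)
    linarith
  have h1M : 1 ≤ M := by
    have : 0 ≤ ∑ i, A i := Finset.sum_nonneg fun i _ => zero_le_one.trans (hA i)
    linarith
  have hcont : ContinuousOn (fun T => pairProd fun i j => min T (max (A i) (A j)))
      (Set.Icc 1 M) := by
    unfold pairProd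
    fun_prop
  have h1 : pairProd (fun i j => min 1 (max (A i) (A j))) = 1 := by
    have : (fun i j => min 1 (max (A i) (A j))) = fun _ _ => 1 := by
      ext i j
      exact min_eq_left (hmax i j)
    rw [this, pairProd_const, one_pow]
  have h2 : pairProd (fun i j => min M (max (A i) (A j))) = pairProd fun i j => max (A i) (A j) := by
    congr 1
    ext i j
    exact min_eq_right (max_le (hAM i) (hAM j))
  obtain ⟨T, hT, hTb⟩ := intermediate_value_Icc h1M hcont
    (show b ∈ Set.Icc _ _ from ⟨by simpa only [h1] using hb, by simpa only [h2] using hbA⟩)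
  exact ⟨T, hT.1, hTb⟩

/-- A subgroup of `I → ℝ` whose nonconstant elements have discriminant at least `b` has few
points in a box. -/
lemma card_box_le (hI : 2 ≤ Fintype.card I) (V : AddSubgroup (I → ℝ)) (b : ℝ) (hb : 1 ≤ b)
    (hV : ∀ x ∈ V, (∃ i j, x i ≠ x j) → b ≤ pairProd fun i j => |x i - x j|)
    (hV' : ∀ x ∈ V, (∀ i j, x i = x j) → x ≠ 0 → ∀ i, 1 ≤ |x i|)
    (A : I → ℝ) (hA : ∀ i, 1 ≤ A i) (hbA : b ≤ pairProd fun i j => max (A i) (A j)) (i₀ : I)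
    (S : Finset (I → ℝ)) (hS : ∀ x ∈ S, x ∈ V ∧ ∀ i, |x i| ≤ A i / 2) :
    (S.card : ℝ) ≤ 4 ^ Fintype.card I * A i₀ *
      ((pairProd fun i j => max (A i) (A j)) / b) ^ ((Fintype.card I : ℝ)⁻¹) := by
  obtain ⟨T, hT1, hTb⟩ := exists_truncation A hA b hb hbA
  have hT0 : 0 < T := zero_lt_one.trans_le hT1
  have hA0 : ∀ i, 0 < A i := fun i => zero_lt_one.trans_le (hA i)
  set B : I → ℝ := fun i => min T (A i) with hB
  have hB1 : ∀ i, 1 ≤ B i := fun i => le_min hT1 (hA i)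
  have hB0 : ∀ i, 0 < B i := fun i => zero_lt_one.trans_le (hB1 i)
  set r : I → ℝ := fun i => A i / B i with hr
  have hr1 : ∀ i, 1 ≤ r i := fun i => (one_le_div (hB0 i)).mpr (min_le_right _ _)
  set s : I → ℝ := fun i => if i = i₀ then 1 / 2 else B i / 2 with hs
  have hs0 : ∀ i, 0 < s i := fun i => by
    simp only [hs]
    split_ifs
    · norm_num
    · exact half_pos (hB0 i)
  have hsB : ∀ i, s i ≤ B i / 2 := fun i => by
    simp only [hs]
    split_ifs
    · linarith [hB1 i]
    · exact le_rfl
  set R : I → ℝ := fun i => if i = i₀ then A i₀ else r i with hR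
  have hR1 : ∀ i, 1 ≤ R i := fun i => by
    simp only [hR]
    split_ifs
    · exact hA _
    · exact hr1 i
  have hRs : ∀ i, A i / 2 / s i = R i := fun i => by
    simp only [hR, hs, hr]
    split_ifs with h
    · subst h; field_simp
    · have := (hB0 i).ne'
      field_simp
  let cell : (I → ℝ) → (I → ℤ) := fun x i => ⌊x i / s i⌋
  have hinj : Set.InjOn cell S := by
    intro x hx y hy hxy
    have hz : x - y ∈ V := V.sub_mem (hS x hx).1 (hS y hy).1
    have hclose : ∀ i, |(x - y) i| < s i := fun i => by
      have := Int.abs_sub_lt_one_of_floor_eq_floor (congrFun hxy i)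
      rw [← sub_div, abs_div, abs_of_pos (hs0 i), div_lt_one (hs0 i)] at this
      simpa using this
    by_contra hne
    have hne' : x - y ≠ 0 := sub_ne_zero.mpr hne
    by_cases hconst : ∀ i j, (x - y) i = (x - y) j
    · have h1 := hV' _ hz hconst hne' i₀
      have h2 := hclose i₀
      simp only [hs, if_true] at h2
      linarith
    · push Not at hconst
      have h1 := hV _ hz hconst
      have hpos : 0 < pairProd fun i j => |(x - y) i - (x - y) j| := by linarith
      have hfac : ∀ i j, i ≠ j → 0 < |(x - y) i - (x - y) j| := by
        intro i j hij
        refine lt_of_le_of_ne (abs_nonneg _) fun h0 => hpos.ne' ?_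
        exact Finset.prod_eq_zero (Finset.mem_univ i)
          (Finset.prod_eq_zero (Finset.mem_erase.mpr ⟨hij.symm, Finset.mem_univ j⟩) h0.symm)
      have hlt : pairProd (fun i j => |(x - y) i - (x - y) j|)
          < pairProd fun i j => min T (max (A i) (A j)) := by
        have hone : ∀ i j, |(x - y) i - (x - y) j| < min T (max (A i) (A j)) := by
          intro i j
          have h3 := abs_sub ((x - y) i) ((x - y) j)
          have h4 := hclose i
          have h5 := hclose j
          have h6 := hsB i
          have h7 := hsB j
          have h8 : B i ≤ min T (max (A i) (A j)) :=
            min_le_min le_rfl (le_max_left _ _)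
          have h9 : B j ≤ min T (max (A i) (A j)) :=
            min_le_min le_rfl (le_max_right _ _)
          linarith
        have hne2 : ∀ i : I, (Finset.univ.erase i).Nonempty := fun i => by
          rw [← Finset.card_pos, Finset.card_erase_of_mem (Finset.mem_univ i), Finset.card_univ]
          omega
        refine Finset.prod_lt_prod_of_nonempty (fun i _ => ?_) (fun i _ => ?_) ⟨i₀, Finset.mem_univ _⟩
        · exact Finset.prod_pos fun j hj => hfac i j (Finset.ne_of_mem_erase hj).symm
        · exact Finset.prod_lt_prod_of_nonempty
            (fun j hj => hfac i j (Finset.ne_of_mem_erase hj).symm) (fun j _ => hone i j) (hne2 i)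
      linarith
  have hmaps : ∀ x ∈ S, cell x ∈ Fintype.piFinset fun i => Finset.Icc ⌊-R i⌋ ⌊R i⌋ := by
    intro x hx
    rw [Fintype.mem_piFinset]
    intro i
    have h1 : |x i / s i| ≤ R i := by
      rw [abs_div, abs_of_pos (hs0 i), ← hRs i]
      exact div_le_div_of_nonneg_right ((hS x hx).2 i) (hs0 i).le
    rw [Finset.mem_Icc]
    exact ⟨Int.floor_mono (abs_le.mp h1).1, Int.floor_mono (abs_le.mp h1).2⟩
  have hcard : (S.card : ℝ) ≤ ∏ i, (4 * R i) := by
    have h1 := Finset.card_le_card_of_injOn cell hmaps hinj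
    rw [Fintype.card_piFinset] at h1
    calc (S.card : ℝ) ≤ ((∏ i, (Finset.Icc ⌊-R i⌋ ⌊R i⌋).card : ℕ) : ℝ) := by exact_mod_cast h1
      _ = ∏ i, ((Finset.Icc ⌊-R i⌋ ⌊R i⌋).card : ℝ) := by push_cast; rfl
      _ ≤ _ := by
        refine Finset.prod_le_prod (fun i _ => by positivity) fun i _ => ?_
        rw [Int.card_Icc]
        have h2 : (0 : ℤ) ≤ ⌊R i⌋ + 1 - ⌊-R i⌋ := by
          have : ⌊-R i⌋ ≤ ⌊R i⌋ := Int.floor_mono (by linarith [hR1 i])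
          omega
        have h3 : (((⌊R i⌋ + 1 - ⌊-R i⌋).toNat : ℕ) : ℝ) = ((⌊R i⌋ + 1 - ⌊-R i⌋ : ℤ) : ℝ) := by
          exact_mod_cast Int.toNat_of_nonneg h2
        rw [h3]
        push_cast
        linarith [Int.floor_le (R i), Int.lt_floor_add_one (-R i), hR1 i]
  have hprodR : ∏ i, R i = A i₀ * ∏ i ∈ Finset.univ.erase i₀, r i := by
    rw [← Finset.mul_prod_erase Finset.univ R (Finset.mem_univ i₀)]
    congr 1
    · simp [hR]
    · exact Finset.prod_congr rfl fun i hi => by simp [hR, Finset.ne_of_mem_erase hi]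
  have hmaxr : (pairProd fun i j => max (r i) (r j))
      = (pairProd fun i j => max (A i) (A j)) / b := by
    rw [← hTb, ← pairProd_div]
    congr 1
    ext i j
    have hrT : ∀ i, r i = max 1 (A i / T) := by
      intro i
      simp only [hr, hB]
      rcases le_total T (A i) with h | h
      · rw [min_eq_left h, max_eq_right ((one_le_div hT0).mpr h)]
      · rw [min_eq_right h, max_eq_left ((div_le_one hT0).mpr h), div_self (hA0 i).ne']
    rw [hrT, hrT]
    rcases le_total (A i) (A j) with h | h
    · have h' : A i / T ≤ A j / T := div_le_div_of_nonneg_right h hT0.le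
      rw [max_eq_right h, max_eq_right (max_le_max le_rfl h'), ← hrT]
    · have h' : A j / T ≤ A i / T := div_le_div_of_nonneg_right h hT0.le
      rw [max_eq_left h, max_eq_left (max_le_max le_rfl h'), ← hrT]
  have hroot : ∏ i ∈ Finset.univ.erase i₀, r i ≤
      ((pairProd fun i j => max (A i) (A j)) / b) ^ ((Fintype.card I : ℝ)⁻¹) := by
    rw [← hmaxr]
    have hP : 0 ≤ ∏ i ∈ Finset.univ.erase i₀, r i :=
      Finset.prod_nonneg fun i _ => zero_le_one.trans (hr1 i)
    have h1 := pow_prod_erase_le_pairProd_max r hr1 i₀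
    calc ∏ i ∈ Finset.univ.erase i₀, r i
        = ((∏ i ∈ Finset.univ.erase i₀, r i) ^ Fintype.card I) ^ ((Fintype.card I : ℝ)⁻¹) :=
          (Real.pow_rpow_inv_natCast hP (by omega)).symm
      _ ≤ _ := Real.rpow_le_rpow (by positivity) h1 (by positivity)
  calc (S.card : ℝ) ≤ ∏ i, (4 * R i) := hcard
    _ = 4 ^ Fintype.card I * A i₀ * ∏ i ∈ Finset.univ.erase i₀, r i := by
      rw [Finset.prod_mul_distrib, hprodR, Finset.prod_const, Finset.card_univ]
      ring
    _ ≤ _ := by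
      have := hA0 i₀
      gcongr

end Boxes

lemma sum_pow_finset_le {q : ℝ} (hq0 : 0 ≤ q) (hq1 : q < 1) (S : Finset ℕ) :
    ∑ j ∈ S, q ^ j ≤ (1 - q)⁻¹ :=
  sum_le_hasSum S (fun _ _ => pow_nonneg hq0 _) (hasSum_geometric_of_lt_one hq0 hq1)

/-- Partial summation for a family whose counting function is at most linear. -/
lemma sum_rpow_le_of_card_le {ι : Type*} (c : ι → ℝ) (hc : ∀ χ, 1 ≤ c χ) (C₁ : ℝ) (hC₁ : 0 ≤ C₁)
    (hcount : ∀ Y : ℝ, 1 ≤ Y → ∀ S : Finset ι, (∀ χ ∈ S, c χ ≤ Y) → (S.card : ℝ) ≤ C₁ * Y)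
    (s : ℝ) (hs0 : 0 ≤ s) (hs1 : s < 1) (X : ℝ) (hX : 0 ≤ X) (S : Finset ι) (hS : ∀ χ ∈ S, c χ ≤ X) :
    ∑ χ ∈ S, (X / c χ) ^ s ≤ C₁ * 2 ^ s * (1 - 2 ^ s / 2)⁻¹ * X := by
  have hq1 : (2 : ℝ) ^ s / 2 < 1 := by
    rw [div_lt_one two_pos]
    calc (2 : ℝ) ^ s < 2 ^ (1 : ℝ) := Real.rpow_lt_rpow_of_exponent_lt one_lt_two hs1
      _ = 2 := Real.rpow_one 2
  have hc0 : ∀ χ, 0 < c χ := fun χ => zero_lt_one.trans_le (hc χ)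
  rcases S.eq_empty_or_nonempty with rfl | ⟨χ₀, hχ₀⟩
  · have : 0 < 1 - (2 : ℝ) ^ s / 2 := by linarith
    rw [Finset.sum_empty]
    positivity
  have hX1 : 1 ≤ X := (hc χ₀).trans (hS χ₀ hχ₀)
  have hX0 : 0 < X := zero_lt_one.trans_le hX1
  have hex : ∀ χ, ∃ j : ℕ, c χ ≤ X → 2 ^ j ≤ X / c χ ∧ X / c χ < 2 ^ (j + 1) := by
    intro χ
    by_cases h : c χ ≤ X
    · obtain ⟨j, h1, h2⟩ := exists_nat_pow_near ((one_le_div (hc0 χ)).mpr h) one_lt_two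
      exact ⟨j, fun _ => ⟨h1, h2⟩⟩
    · exact ⟨0, fun h' => absurd h' h⟩
  choose j hj using hex
  rw [← Finset.sum_fiberwise_of_maps_to (fun χ hχ => Finset.mem_image_of_mem j hχ)]
  calc ∑ k ∈ S.image j, ∑ χ ∈ S with j χ = k, (X / c χ) ^ s
      ≤ ∑ k ∈ S.image j, C₁ * 2 ^ s * X * (2 ^ s / 2) ^ k := by
        refine Finset.sum_le_sum fun k hk => ?_
        obtain ⟨χ₁, hχ₁, rfl⟩ := Finset.mem_image.mp hk
        have hterm : ∀ χ ∈ S.filter (fun χ => j χ = j χ₁), (X / c χ) ^ s ≤ (2 ^ s) ^ (j χ₁ + 1) := by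
          intro χ hχ
          rw [Finset.mem_filter] at hχ
          rw [← Real.rpow_natCast, ← Real.rpow_mul zero_le_two, mul_comm s, Real.rpow_mul zero_le_two,
            Real.rpow_natCast, ← hχ.2]
          have := hc0 χ
          exact Real.rpow_le_rpow (by positivity) (hj χ (hS χ hχ.1)).2.le hs0
        have hcard : ((S.filter (fun χ => j χ = j χ₁)).card : ℝ) ≤ C₁ * (X / 2 ^ j χ₁) := by
          have hle : ∀ χ ∈ S.filter (fun χ => j χ = j χ₁), c χ ≤ X / 2 ^ j χ₁ := by
            intro χ hχ
            rw [Finset.mem_filter] at hχ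
            have h1 := (hj χ (hS χ hχ.1)).1
            rw [hχ.2, le_div_iff₀ (hc0 χ)] at h1
            rw [le_div_iff₀ (by positivity)]
            linarith
          refine hcount _ ((hc χ₁).trans (hle χ₁ (by simp [hχ₁]))) _ hle
        calc ∑ χ ∈ S with j χ = j χ₁, (X / c χ) ^ s
            ≤ ((S.filter (fun χ => j χ = j χ₁)).card : ℝ) * (2 ^ s) ^ (j χ₁ + 1) := by
              rw [← nsmul_eq_mul]
              exact Finset.sum_le_card_nsmul _ _ _ hterm
          _ ≤ C₁ * (X / 2 ^ j χ₁) * (2 ^ s) ^ (j χ₁ + 1) := by gcongr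
          _ = _ := by
            rw [div_pow, pow_succ]
            ring
    _ = C₁ * 2 ^ s * X * ∑ k ∈ S.image j, (2 ^ s / 2) ^ k := by rw [Finset.mul_sum]
    _ ≤ C₁ * 2 ^ s * X * (1 - 2 ^ s / 2)⁻¹ := by
        gcongr
        exact sum_pow_finset_le (by positivity) hq1 _
    _ = _ := by ring

section Boxes

variable {I : Type*} [Fintype I]

lemma exists_box (x : I → ℝ) (H : ℝ) [Nonempty I]
    (hx : ∏ i, max 1 |x i| ≤ H) :
    ∃ (m : I) (k : I → ℕ), k m = 0 ∧
      (∀ i, 4 * 2 ^ k i ≤ 4 * H / ∏ i, (2 : ℝ) ^ k i) ∧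
      |x m| ≤ 4 * H / (∏ i, (2 : ℝ) ^ k i) / 2 ∧ ∀ i, i ≠ m → |x i| ≤ 4 * (2 : ℝ) ^ k i / 2 := by
  obtain ⟨m, hm⟩ := Finite.exists_max fun i => max 1 |x i|
  have hex : ∀ i, ∃ k : ℕ, 2 ^ k ≤ max 1 |x i| ∧ max 1 |x i| < 2 ^ (k + 1) := fun i =>
    exists_nat_pow_near (le_max_left _ _) one_lt_two
  choose k hk using hex
  have hprod : ∏ i, (2 : ℝ) ^ Function.update k m 0 i ≤ ∏ i ∈ Finset.univ.erase m, max 1 |x i| := by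
    rw [← Finset.mul_prod_erase Finset.univ _ (Finset.mem_univ m)]
    simp only [Function.update_self, pow_zero, one_mul]
    refine Finset.prod_le_prod (fun i _ => by positivity) fun i hi => ?_
    rw [Function.update_of_ne (Finset.ne_of_mem_erase hi)]
    exact (hk i).1
  have hpos : 0 < ∏ i, (2 : ℝ) ^ Function.update k m 0 i := Finset.prod_pos fun i _ => by positivity
  have hmain : max 1 |x m| ≤ H / ∏ i, (2 : ℝ) ^ Function.update k m 0 i := by
    rw [le_div_iff₀ hpos]
    refine le_trans ?_ hx
    rw [← Finset.mul_prod_erase Finset.univ (fun i => max 1 |x i|) (Finset.mem_univ m)]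
    exact mul_le_mul_of_nonneg_left hprod (zero_le_one.trans (le_max_left _ _))
  refine ⟨m, Function.update k m 0, by simp, fun i => ?_, ?_, fun i hi => ?_⟩
  · rw [mul_div_assoc]
    refine mul_le_mul_of_nonneg_left (le_trans ?_ hmain) (by norm_num)
    by_cases h : i = m
    · subst h; simp
    · rw [Function.update_of_ne h]
      exact (hk i).1.trans (hm i)
  · have := le_max_right 1 |x m|
    have := le_max_left 1 |x m|
    rw [mul_div_assoc]
    linarith
  · rw [Function.update_of_ne hi]
    have := le_max_right 1 |x i|
    have := (hk i).2
    rw [pow_succ] at this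
    linarith

lemma pairProd_max_le (A : I → ℝ) (hA : ∀ i, 1 ≤ A i) (m : I) (hm : ∀ i, A i ≤ A m) :
    (pairProd fun i j => max (A i) (A j)) * (∏ i ∈ Finset.univ.erase m, A i) ^ 2
      ≤ ((∏ i, A i) ^ 2) ^ (Fintype.card I - 1) := by
  set s : I → ℝ := Function.update A m 1 with hs
  have hA0 : ∀ i, 0 < A i := fun i => zero_lt_one.trans_le (hA i)
  have hs0 : s m = 1 := by simp [hs]
  have hprod : ∏ i ∈ Finset.univ.erase m, A i = ∏ i, s i := by
    rw [← Finset.mul_prod_erase Finset.univ s (Finset.mem_univ m), hs0, one_mul]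
    refine Finset.prod_congr rfl fun i hi => ?_
    simp [hs, Finset.ne_of_mem_erase hi]
  have e : ((∏ i, A i) ^ 2) ^ (Fintype.card I - 1) = pairProd fun i j => A i * A j := by
    rw [pairProd_mul, pairProd_left, pairProd_right]
    ring
  rw [hprod, e, sq, ← pairProd_single_left m s hs0]
  nth_rewrite 2 [← pairProd_swap]
  rw [← pairProd_mul, ← pairProd_mul]
  refine pairProd_mono (fun i j => ?_) fun i j hij => ?_
  · have h1 := hA0 i
    have h2 : ∀ i, 0 ≤ s i := fun i => by
      by_cases h : i = m
      · subst h; simp [hs]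
      · simpa [hs, h] using (hA0 i).le
    have h3 := h2 i
    have h4 := h2 j
    split_ifs <;> positivity
  · by_cases h1 : i = m <;> by_cases h2 : j = m
    · exact absurd (h1.trans h2.symm) hij
    · have : s j = A j := by simp [hs, h2]
      simp only [h1, h2, if_true, if_false, this, one_mul]
      rw [max_eq_left (hm j)]
    · have : s i = A i := by simp [hs, h1]
      simp only [h1, h2, if_true, if_false, this, mul_one]
      rw [max_eq_right (hm i), mul_comm]
    · simp only [h1, h2, if_false, mul_one]
      have := hA i
      have := hA j
      exact max_le (by nlinarith) (by nlinarith)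

/-- Number of pairs (index, point of the corresponding subgroup) in a fixed box. -/
lemma card_box_family_le (hI : 2 ≤ Fintype.card I) {ι : Type*} (c : ι → ℝ) (hc : ∀ χ, 1 ≤ c χ)
    (C₁ : ℝ) (hC₁ : 0 ≤ C₁)
    (hcount : ∀ Y : ℝ, 1 ≤ Y → ∀ S : Finset ι, (∀ χ ∈ S, c χ ≤ Y) → (S.card : ℝ) ≤ C₁ * Y)
    (V : ι → AddSubgroup (I → ℝ))
    (hV : ∀ χ, ∀ x ∈ V χ, (∃ i j, x i ≠ x j) →
      c χ ^ (Fintype.card I - 1) ≤ pairProd fun i j => |x i - x j|)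
    (hV' : ∀ χ, ∀ x ∈ V χ, (∀ i j, x i = x j) → x ≠ 0 → ∀ i, 1 ≤ |x i|) :
    ∃ C₂ : ℝ, 0 ≤ C₂ ∧ ∀ A : I → ℝ, (∀ i, 1 ≤ A i) → ∀ i₀ : I, ∀ S : Finset (ι × (I → ℝ)),
      (∀ y ∈ S, y.2 ∈ V y.1 ∧ (∃ i j, y.2 i ≠ y.2 j) ∧ ∀ i, |y.2 i| ≤ A i / 2) →
      ∀ X : ℝ, 0 ≤ X → X ^ (Fintype.card I - 1) = pairProd (fun i j => max (A i) (A j)) →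
      (S.card : ℝ) ≤ C₂ * (A i₀ * X) := by
  set n := Fintype.card I with hn
  set s : ℝ := ((n - 1 : ℕ) : ℝ) * (n : ℝ)⁻¹ with hs
  have hn0 : (0 : ℝ) < n := by
    have : 0 < n := by omega
    exact_mod_cast this
  have hs0 : 0 ≤ s := by positivity
  have hs1 : s < 1 := by
    rw [hs, ← div_eq_mul_inv, div_lt_one hn0]
    exact_mod_cast (by omega : n - 1 < n)
  have hq1 : (2 : ℝ) ^ s / 2 < 1 := by
    rw [div_lt_one two_pos]
    calc (2 : ℝ) ^ s < 2 ^ (1 : ℝ) := Real.rpow_lt_rpow_of_exponent_lt one_lt_two hs1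
      _ = 2 := Real.rpow_one 2
  have hq2 : 0 < 1 - (2 : ℝ) ^ s / 2 := by linarith
  refine ⟨4 ^ n * (C₁ * 2 ^ s * (1 - 2 ^ s / 2)⁻¹), by positivity, ?_⟩
  intro A hA i₀ S hS X hX0 hX
  have hA0 : ∀ i, 0 < A i := fun i => zero_lt_one.trans_le (hA i)
  have hc0 : ∀ χ, 0 < c χ := fun χ => zero_lt_one.trans_le (hc χ)
  have hcX : ∀ χ ∈ S.image Prod.fst, c χ ≤ X := by
    intro χ hχ
    obtain ⟨y, hy, rfl⟩ := Finset.mem_image.mp hχ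
    obtain ⟨h1, h2, h3⟩ := hS y hy
    refine le_of_pow_le_pow_left₀ (n := n - 1) (by omega) hX0 ?_
    rw [hX]
    refine (hV _ _ h1 h2).trans (pairProd_mono (fun i j => abs_nonneg _) fun i j _ => ?_)
    have := abs_sub (y.2 i) (y.2 j)
    have := h3 i
    have := h3 j
    have := le_max_left (A i) (A j)
    have := le_max_right (A i) (A j)
    linarith
  have hfib : ∀ χ ∈ S.image Prod.fst, ((S.filter fun y => y.1 = χ).card : ℝ)
      ≤ 4 ^ n * A i₀ * (X / c χ) ^ s := by
    intro χ hχ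
    have h1 : (S.filter fun y => y.1 = χ).card
        = ((S.filter fun y => y.1 = χ).image Prod.snd).card := by
      refine (Finset.card_image_of_injOn ?_).symm
      intro y hy z hz hyz
      simp only [Finset.coe_filter, Set.mem_ofPred_eq] at hy hz
      exact Prod.ext (hy.2.trans hz.2.symm) hyz
    have h2 : ∀ x ∈ (S.filter fun y => y.1 = χ).image Prod.snd,
        x ∈ V χ ∧ ∀ i, |x i| ≤ A i / 2 := by
      intro x hx
      obtain ⟨y, hy, rfl⟩ := Finset.mem_image.mp hx
      obtain ⟨hy1, rfl⟩ := Finset.mem_filter.mp hy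
      exact ⟨(hS y hy1).1, (hS y hy1).2.2⟩
    have h3 := card_box_le hI (V χ) (c χ ^ (n - 1)) (one_le_pow₀ (hc χ)) (hV χ) (hV' χ) A hA
      (by rw [← hX]; exact pow_le_pow_left₀ (hc0 χ).le (hcX χ hχ) _) i₀ _ h2
    rw [h1]
    refine h3.trans (le_of_eq ?_)
    have := hc0 χ
    rw [← hX, ← div_pow, ← Real.rpow_natCast (X / c χ), ← Real.rpow_mul (by positivity)]
  have hsum := sum_rpow_le_of_card_le c hc C₁ hC₁ hcount s hs0 hs1 X hX0 _ hcX
  calc (S.card : ℝ)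
      = ∑ χ ∈ S.image Prod.fst, ((S.filter fun y => y.1 = χ).card : ℝ) := by
        exact_mod_cast Finset.card_eq_sum_card_fiberwise
          fun y hy => Finset.mem_image_of_mem Prod.fst hy
    _ ≤ ∑ χ ∈ S.image Prod.fst, 4 ^ n * A i₀ * (X / c χ) ^ s := Finset.sum_le_sum hfib
    _ = 4 ^ n * A i₀ * ∑ χ ∈ S.image Prod.fst, (X / c χ) ^ s := by rw [Finset.mul_sum]
    _ ≤ 4 ^ n * A i₀ * (C₁ * 2 ^ s * (1 - 2 ^ s / 2)⁻¹ * X) := by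
        have := hA0 i₀
        gcongr
    _ = _ := by ring

/-- The sides of the box attached to a dyadic exponent vector `k` and a dominant index `m`. -/
noncomputable def boxSide (H : ℝ) (m : I) (k : I → ℕ) : I → ℝ :=
  fun i => if i = m then 4 * H / ∏ i, (2 : ℝ) ^ k i else 4 * 2 ^ k i

lemma prod_boxSide (H : ℝ) (m : I) (k : I → ℕ) (hk : k m = 0) :
    ∏ i, boxSide H m k i = 4 ^ Fintype.card I * H := by
  have hpos : 0 < ∏ i ∈ Finset.univ.erase m, (2 : ℝ) ^ k i :=
    Finset.prod_pos fun i _ => by positivity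
  have h1 : ∏ i ∈ Finset.univ.erase m, boxSide H m k i
      = 4 ^ (Fintype.card I - 1) * ∏ i ∈ Finset.univ.erase m, (2 : ℝ) ^ k i := by
    rw [← Finset.card_univ, ← Finset.card_erase_of_mem (Finset.mem_univ m), ← Finset.prod_const,
      ← Finset.prod_mul_distrib]
    exact Finset.prod_congr rfl fun i hi => by simp [boxSide, Finset.ne_of_mem_erase hi]
  rw [← Finset.mul_prod_erase Finset.univ _ (Finset.mem_univ m), h1]
  simp only [boxSide, if_true]
  rw [← Finset.mul_prod_erase Finset.univ (fun i => (2 : ℝ) ^ k i) (Finset.mem_univ m), hk]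
  have hcard : Fintype.card I = Fintype.card I - 1 + 1 :=
    (Nat.sub_add_cancel (Fintype.card_pos_iff.mpr ⟨m⟩)).symm
  rw [hcard, pow_succ]
  field_simp
  simp

lemma boxSide_mul_le (hI : 2 ≤ Fintype.card I) (H : ℝ) (hH : 1 ≤ H) (m : I) (k : I → ℕ)
    (hk : k m = 0) (hA : ∀ i, 1 ≤ boxSide H m k i) (hm : ∀ i, boxSide H m k i ≤ boxSide H m k m)
    (i₀ : I) (hi₀ : ∀ i, boxSide H m k i₀ ≤ boxSide H m k i) (X q : ℝ) (hX : 0 ≤ X) (hq : 0 ≤ q)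
    (hXA : X ^ (Fintype.card I - 1) =
      pairProd fun i j => max (boxSide H m k i) (boxSide H m k j))
    (hq2 : q ^ (Fintype.card I - 1) = 1 / 2) :
    boxSide H m k i₀ * X ≤ (4 ^ Fintype.card I * H) ^ 2 * ∏ i, q ^ k i := by
  set A := boxSide H m k with hAdef
  set n := Fintype.card I with hn
  have hA0 : ∀ i, 0 < A i := fun i => zero_lt_one.trans_le (hA i)
  set E := ∏ i ∈ Finset.univ.erase m, A i with hE
  have hEpos : 0 < E := Finset.prod_pos fun i _ => hA0 i
  have hEk : ∏ i, (2 : ℝ) ^ k i ≤ E := by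
    rw [← Finset.mul_prod_erase Finset.univ _ (Finset.mem_univ m), hk, pow_zero, one_mul]
    refine Finset.prod_le_prod (fun i _ => by positivity) fun i hi => ?_
    have : A i = 4 * 2 ^ k i := by simp [hAdef, boxSide, Finset.ne_of_mem_erase hi]
    rw [this]
    linarith [pow_pos (two_pos (α := ℝ)) (k i)]
  have hkpos : 0 < ∏ i, (2 : ℝ) ^ k i := Finset.prod_pos fun i _ => by positivity
  have hmin : A i₀ ^ (n - 1) ≤ E := by
    rw [hn, ← Finset.card_univ, ← Finset.card_erase_of_mem (Finset.mem_univ m), ← Finset.prod_const]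
    exact Finset.prod_le_prod (fun i _ => (hA0 _).le) fun i _ => hi₀ i
  have hmax := pairProd_max_le A hA m hm
  rw [← hXA, prod_boxSide H m k hk] at hmax
  refine le_of_pow_le_pow_left₀ (n := n - 1) (by omega) (by positivity) ?_
  have hqk : (∏ i, q ^ k i) ^ (n - 1) = (∏ i, (2 : ℝ) ^ k i)⁻¹ := by
    rw [← Finset.prod_pow, ← Finset.prod_inv_distrib]
    refine Finset.prod_congr rfl fun i _ => ?_
    rw [← pow_mul, mul_comm, pow_mul, hq2]
    simp
  rw [mul_pow, mul_pow _ (∏ i, q ^ k i), hqk]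
  have hX' : 0 ≤ X ^ (n - 1) := by positivity
  calc A i₀ ^ (n - 1) * X ^ (n - 1) ≤ E * X ^ (n - 1) := by gcongr
    _ = X ^ (n - 1) * E ^ 2 * E⁻¹ := by field_simp
    _ ≤ ((4 ^ n * H) ^ 2) ^ (n - 1) * E⁻¹ := by gcongr
    _ ≤ _ := by gcongr

/-- Abstract counting theorem: a family of subgroups of `I → ℝ`, with linear counting function and
discriminants bounded below, has `O(H ^ 2)` nonconstant points of height at most `H`. -/
theorem card_height_le (hI : 2 ≤ Fintype.card I) {ι : Type*} (c : ι → ℝ) (hc : ∀ χ, 1 ≤ c χ)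
    (C₁ : ℝ) (hC₁ : 0 ≤ C₁)
    (hcount : ∀ Y : ℝ, 1 ≤ Y → ∀ S : Finset ι, (∀ χ ∈ S, c χ ≤ Y) → (S.card : ℝ) ≤ C₁ * Y)
    (V : ι → AddSubgroup (I → ℝ))
    (hV : ∀ χ, ∀ x ∈ V χ, (∃ i j, x i ≠ x j) →
      c χ ^ (Fintype.card I - 1) ≤ pairProd fun i j => |x i - x j|)
    (hV' : ∀ χ, ∀ x ∈ V χ, (∀ i j, x i = x j) → x ≠ 0 → ∀ i, 1 ≤ |x i|) :
    ∃ C : ℝ, 0 ≤ C ∧ ∀ H : ℝ, 1 ≤ H → ∀ S : Finset (ι × (I → ℝ)),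
      (∀ y ∈ S, y.2 ∈ V y.1 ∧ (∃ i j, y.2 i ≠ y.2 j) ∧ ∏ i, max 1 |y.2 i| ≤ H) →
      (S.card : ℝ) ≤ C * H ^ 2 := by
  obtain ⟨C₂, hC₂, hfam⟩ := card_box_family_le hI c hc C₁ hC₁ hcount V hV hV'
  set n := Fintype.card I with hn
  have hn1 : n - 1 ≠ 0 := by omega
  have : Nonempty I := Fintype.card_pos_iff.mp (by omega)
  set q : ℝ := (1 / 2) ^ (((n - 1 : ℕ) : ℝ)⁻¹) with hq
  have hq0 : 0 ≤ q := by positivity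
  have hq2 : q ^ (n - 1) = 1 / 2 := Real.rpow_inv_natCast_pow (by norm_num) hn1
  have hq1 : q < 1 := by
    by_contra h
    have := one_le_pow₀ (not_lt.mp h) (n := n - 1)
    rw [hq2] at this
    norm_num at this
  have hq3 : 0 < 1 - q := by linarith
  refine ⟨C₂ * (4 ^ n) ^ 2 * n * ((1 - q)⁻¹) ^ n, by positivity, ?_⟩
  intro H hH S hS
  have hex : ∀ y : ι × (I → ℝ), ∃ b : I × (I → ℕ), y ∈ S → b.2 b.1 = 0 ∧
      (∀ i, 4 * 2 ^ b.2 i ≤ 4 * H / ∏ i, (2 : ℝ) ^ b.2 i) ∧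
      ∀ i, |y.2 i| ≤ boxSide H b.1 b.2 i / 2 := by
    intro y
    by_cases hy : y ∈ S
    · obtain ⟨m, k, h1, h2, h3, h4⟩ := exists_box y.2 H (hS y hy).2.2
      refine ⟨(m, k), fun _ => ⟨h1, h2, fun i => ?_⟩⟩
      by_cases him : i = m
      · subst him; simpa [boxSide] using h3
      · simpa [boxSide, him] using h4 i him
    · exact ⟨(Classical.arbitrary I, 0), fun h => absurd h hy⟩
  choose b hb using hex
  have hfib : ∀ β ∈ S.image b, ((S.filter fun y => b y = β).card : ℝ)
      ≤ C₂ * ((4 ^ n * H) ^ 2 * ∏ i, q ^ β.2 i) := by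
    intro β hβ
    obtain ⟨y₀, hy₀, rfl⟩ := Finset.mem_image.mp hβ
    obtain ⟨h1, h2, h3⟩ := hb y₀ hy₀
    set A := boxSide H (b y₀).1 (b y₀).2 with hAdef
    have h4 : ∀ i, (1 : ℝ) ≤ 4 * 2 ^ (b y₀).2 i := fun i => by
      have : (1 : ℝ) ≤ 2 ^ (b y₀).2 i := one_le_pow₀ one_le_two
      linarith
    have hm : ∀ i, A i ≤ A (b y₀).1 := by
      intro i
      by_cases him : i = (b y₀).1
      · rw [him]
      · simpa [hAdef, boxSide, him] using h2 i
    have hA : ∀ i, 1 ≤ A i := by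
      intro i
      by_cases him : i = (b y₀).1
      · rw [him]
        simpa [hAdef, boxSide] using (h4 _).trans (h2 i)
      · simpa [hAdef, boxSide, him] using h4 i
    obtain ⟨i₀, hi₀⟩ := Finite.exists_min A
    have hD : 0 ≤ pairProd fun i j => max (A i) (A j) :=
      Finset.prod_nonneg fun i _ => Finset.prod_nonneg fun j _ =>
        (zero_le_one.trans (hA i)).trans (le_max_left _ _)
    set X : ℝ := (pairProd fun i j => max (A i) (A j)) ^ (((n - 1 : ℕ) : ℝ)⁻¹) with hX
    have hX0 : 0 ≤ X := by positivity
    have hXp : X ^ (n - 1) = pairProd fun i j => max (A i) (A j) :=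
      Real.rpow_inv_natCast_pow hD hn1
    refine (hfam A hA i₀ _ (fun y hy => ?_) X hX0 hXp).trans ?_
    · rw [Finset.mem_filter] at hy
      refine ⟨(hS y hy.1).1, (hS y hy.1).2.1, ?_⟩
      have := (hb y hy.1).2.2
      rwa [hy.2] at this
    · exact mul_le_mul_of_nonneg_left
        (boxSide_mul_le hI H hH _ _ h1 hA hm i₀ hi₀ X q hX0 hq0 hXp hq2) hC₂
  set K := (S.image b).image Prod.snd with hK
  set M : Finset ℕ := K.biUnion fun k => Finset.univ.image k with hM
  have hsub : S.image b ⊆ (Finset.univ : Finset I) ×ˢ (Fintype.piFinset fun _ : I => M) := by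
    intro β hβ
    rw [Finset.mem_product, Fintype.mem_piFinset]
    refine ⟨Finset.mem_univ _, fun i => ?_⟩
    rw [hM, Finset.mem_biUnion]
    exact ⟨β.2, Finset.mem_image_of_mem _ hβ, Finset.mem_image_of_mem _ (Finset.mem_univ i)⟩
  calc (S.card : ℝ)
      = ∑ β ∈ S.image b, ((S.filter fun y => b y = β).card : ℝ) := by
        exact_mod_cast Finset.card_eq_sum_card_fiberwise
          fun y hy => Finset.mem_image_of_mem b hy
    _ ≤ ∑ β ∈ S.image b, C₂ * ((4 ^ n * H) ^ 2 * ∏ i, q ^ β.2 i) := Finset.sum_le_sum hfib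
    _ ≤ ∑ β ∈ (Finset.univ : Finset I) ×ˢ (Fintype.piFinset fun _ : I => M),
          C₂ * ((4 ^ n * H) ^ 2 * ∏ i, q ^ β.2 i) :=
        Finset.sum_le_sum_of_subset_of_nonneg hsub fun β _ _ => by positivity
    _ = C₂ * (4 ^ n * H) ^ 2 * (n * ∑ k ∈ Fintype.piFinset fun _ : I => M, ∏ i, q ^ k i) := by
        rw [Finset.sum_product]
        simp only [Finset.sum_const, nsmul_eq_mul, ← Finset.mul_sum, Finset.card_univ, ← hn]
        ring
    _ = C₂ * (4 ^ n * H) ^ 2 * (n * (∑ j ∈ M, q ^ j) ^ n) := by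
        rw [← Finset.prod_univ_sum (fun _ : I => M) fun _ j => q ^ j, Finset.prod_const,
          Finset.card_univ]
    _ ≤ C₂ * (4 ^ n * H) ^ 2 * (n * ((1 - q)⁻¹) ^ n) := by
        have h1 := sum_pow_finset_le hq0 hq1 M
        have h0 : 0 ≤ ∑ j ∈ M, q ^ j := Finset.sum_nonneg fun j _ => pow_nonneg hq0 j
        gcongr
    _ = _ := by ring

end Boxes

section IdealValuations

universe u

open NumberField UniqueFactorizationMonoid

/-- The number of integral ideals of norm at most `Y` is `O(Y)`. -/
lemma exists_card_ideal_le (F : Type*) [Field F] [NumberField F] :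
    ∃ C : ℝ, 0 ≤ C ∧ ∀ Y : ℝ, 1 ≤ Y →
      Finite {J : Ideal (𝓞 F) // (Ideal.absNorm J : ℝ) ≤ Y} ∧
      (Nat.card {J : Ideal (𝓞 F) // (Ideal.absNorm J : ℝ) ≤ Y} : ℝ) ≤ C * Y := by
  have hfin : ∀ Y : ℝ, Finite {J : Ideal (𝓞 F) // (Ideal.absNorm J : ℝ) ≤ Y} := by
    intro Y
    have h := Ideal.finite_setOfPred_absNorm_le (S := 𝓞 F) ⌊Y⌋₊
    refine Set.Finite.subset h fun J hJ => ?_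
    exact Nat.le_floor hJ
  have hlim := Ideal.tendsto_norm_le_div_atTop F
  set L := (2 ^ InfinitePlace.nrRealPlaces F * (2 * Real.pi) ^ InfinitePlace.nrComplexPlaces F *
    Units.regulator F * classNumber F) / (Units.torsionOrder F * Real.sqrt |discr F|) with hL
  obtain ⟨s₀, hs₀⟩ := Filter.eventually_atTop.mp (hlim.eventually (gt_mem_nhds (lt_add_one L)))
  set s₁ := max s₀ 1
  set M : ℝ := (Nat.card {J : Ideal (𝓞 F) // (Ideal.absNorm J : ℝ) ≤ s₁} : ℝ)
  refine ⟨max M (L + 1), le_max_of_le_left (Nat.cast_nonneg _), fun Y hY => ⟨hfin Y, ?_⟩⟩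
  have hY0 : 0 < Y := by linarith
  rcases le_total s₀ Y with h | h
  · have h1 := hs₀ Y h
    rw [div_lt_iff₀ hY0] at h1
    refine h1.le.trans ?_
    gcongr
    exact le_max_right _ _
  · have h1 : (Nat.card {J : Ideal (𝓞 F) // (Ideal.absNorm J : ℝ) ≤ Y} : ℝ) ≤ M := by
      have := hfin s₁
      refine Nat.cast_le.mpr (Nat.card_le_card_of_injective
        (Subtype.map id fun J hJ => le_trans hJ (h.trans (le_max_left _ _))) ?_)
      exact Subtype.map_injective _ Function.injective_id
    calc _ ≤ M := h1
      _ ≤ max M (L + 1) * 1 := by rw [mul_one]; exact le_max_left _ _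
      _ ≤ _ := by
        gcongr

variable {F : Type*} [Field F] [NumberField F]

/-- The exponent of the ideal `Q` in the factorization of the principal ideal `(a)`. -/
noncomputable def idealOrd (Q : Ideal (𝓞 F)) (a : 𝓞 F) : ℕ :=
  (normalizedFactors (Ideal.span {a})).count Q

lemma span_singleton_ne_zero {F : Type*} [Field F] {a : 𝓞 F} (ha : a ≠ 0) : Ideal.span {a} ≠ 0 := by
  simpa [Ideal.zero_eq_bot, Ideal.span_singleton_eq_bot] using ha

lemma idealOrd_mul (Q : Ideal (𝓞 F)) {a b : 𝓞 F} (ha : a ≠ 0) (hb : b ≠ 0) :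
    idealOrd Q (a * b) = idealOrd Q a + idealOrd Q b := by
  unfold idealOrd
  rw [← Ideal.span_singleton_mul_span_singleton,
    normalizedFactors_mul (span_singleton_ne_zero ha) (span_singleton_ne_zero hb),
    Multiset.count_add]

lemma idealOrd_pow (Q : Ideal (𝓞 F)) (a : 𝓞 F) (k : ℕ) :
    idealOrd Q (a ^ k) = k * idealOrd Q a := by
  unfold idealOrd
  rw [← Ideal.span_singleton_pow, normalizedFactors_pow, Multiset.count_nsmul]

lemma prime_of_idealOrd_ne_zero {Q : Ideal (𝓞 F)} {a : 𝓞 F} (h : idealOrd Q a ≠ 0) : Prime Q :=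
  prime_of_normalized_factor Q (Multiset.count_ne_zero.mp h)

lemma mem_of_idealOrd_ne_zero {Q : Ideal (𝓞 F)} {a : 𝓞 F} (h : idealOrd Q a ≠ 0) : a ∈ Q := by
  have := dvd_of_mem_normalizedFactors (Multiset.count_ne_zero.mp h)
  rwa [Ideal.dvd_span_singleton] at this

lemma idealOrd_map (σ : 𝓞 F ≃+* 𝓞 F) (Q : Ideal (𝓞 F)) (a : 𝓞 F) :
    idealOrd (Q.map σ) (σ a) = idealOrd Q a := by
  unfold idealOrd
  let φ : Ideal (𝓞 F) ≃* Ideal (𝓞 F) :=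
    { toFun := Ideal.map σ
      invFun := Ideal.map σ.symm
      left_inv := fun I => Ideal.map_of_equiv σ
      right_inv := fun I => Ideal.map_of_equiv σ.symm
      map_mul' := Ideal.map_mul σ }
  have hφ : Ideal.span {σ a} = φ (Ideal.span {a}) := by
    change _ = Ideal.map σ _
    rw [Ideal.map_span, Set.image_singleton]
  change Multiset.count (φ Q) _ = _
  rcases eq_or_ne a 0 with rfl | ha
  · have h : normalizedFactors (⊥ : Ideal (𝓞 F)) = 0 := normalizedFactors_zero
    simp [h]
  have h1 : normalizedFactors (φ (Ideal.span {a})) = (normalizedFactors (Ideal.span {a})).map φ := by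
    have hprime : ∀ q ∈ (normalizedFactors (Ideal.span {a})).map φ, Prime q := by
      intro q hq
      obtain ⟨r, hr, rfl⟩ := Multiset.mem_map.mp hq
      exact (MulEquiv.prime_iff φ).mpr (prime_of_normalized_factor r hr)
    rw [← normalizedFactors_prod_of_prime hprime, Multiset.prod_hom,
      associated_iff_eq.mp (prod_normalizedFactors (span_singleton_ne_zero ha))]
  rw [hφ, h1]
  exact Multiset.count_map_eq_count' φ _ φ.injective Q

lemma absNorm_map_ringEquiv (σ : 𝓞 F ≃+* 𝓞 F) (Q : Ideal (𝓞 F)) :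
    Ideal.absNorm (Q.map σ) = Ideal.absNorm Q := by
  rw [Ideal.absNorm_apply, Ideal.absNorm_apply, Submodule.cardQuot_apply, Submodule.cardQuot_apply]
  exact (Nat.card_congr (Ideal.quotientEquiv Q (Q.map σ) σ rfl).toEquiv).symm

lemma exists_span_eq_pow {p : ℕ} {a : 𝓞 F} (ha : a ≠ 0) (h : ∀ Q, p ∣ idealOrd Q a) :
    ∃ J : nonZeroDivisors (Ideal (𝓞 F)), Ideal.span {a} = (J : Ideal (𝓞 F)) ^ p := by
  obtain ⟨u, hu⟩ := Multiset.exists_smul_of_dvd_count (normalizedFactors (Ideal.span {a}))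
    fun Q _ => h Q
  have hprod : Ideal.span {a} = u.prod ^ p := by
    rw [← Multiset.prod_nsmul, ← hu]
    exact (associated_iff_eq.mp (prod_normalizedFactors (span_singleton_ne_zero ha))).symm
  by_cases hu0 : u.prod = 0
  · rcases Nat.eq_zero_or_pos p with rfl | hp
    · exact ⟨1, by simpa using hprod⟩
    · rw [hu0, zero_pow hp.ne'] at hprod
      exact absurd hprod (span_singleton_ne_zero ha)
  · exact ⟨⟨u.prod, mem_nonZeroDivisors_of_ne_zero hu0⟩, hprod⟩

lemma finite_units_mod_pow (F : Type*) [Field F] [NumberField F] {p : ℕ} (hp : 0 < p) :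
    Finite ((𝓞 F)ˣ ⧸ (powMonoidHom p : (𝓞 F)ˣ →* (𝓞 F)ˣ).range) := by
  have hfg : Group.FG ((𝓞 F)ˣ ⧸ (powMonoidHom p : (𝓞 F)ˣ →* (𝓞 F)ˣ).range) := by
    have : Group.FG (𝓞 F)ˣ := Group.fg_iff_monoid_fg.mpr inferInstance
    infer_instance
  refine CommGroup.finite_of_fg_isMulTorsion _ fun x => ?_
  induction x using QuotientGroup.induction_on with
  | H u =>
    refine isOfFinOrder_iff_pow_eq_one.mpr ⟨p, hp, ?_⟩
    rw [← QuotientGroup.mk_pow, QuotientGroup.eq_one_iff]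
    exact ⟨u, rfl⟩

/-- Elements generating the `p`-th power of an ideal fall into finitely many classes modulo
`p`-th powers. -/
lemma exists_finite_selmer (F : Type u) [Field F] [NumberField F] {p : ℕ} (hp : 0 < p) :
    ∃ (κ : Type u) (_ : Finite κ) (Φ : 𝓞 F → κ), ∀ a b : 𝓞 F, a ≠ 0 → b ≠ 0 →
      (∀ Q, p ∣ idealOrd Q a) → (∀ Q, p ∣ idealOrd Q b) → Φ a = Φ b →
      ∃ x y : 𝓞 F, x ≠ 0 ∧ y ≠ 0 ∧ x ^ p * a = y ^ p * b := by
  have := finite_units_mod_pow F hp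
  let P := {a : 𝓞 F // a ≠ 0 ∧ ∀ Q, p ∣ idealOrd Q a}
  have hJ : ∀ a : P, ∃ J : nonZeroDivisors (Ideal (𝓞 F)), Ideal.span {a.1} = (J : Ideal (𝓞 F)) ^ p :=
    fun a => exists_span_eq_pow a.2.1 a.2.2
  choose J hJ using hJ
  let cl : P → ClassGroup (𝓞 F) := fun a => ClassGroup.mk0 (J a)
  have hrel : ∀ a b : P, cl a = cl b → ∃ (x y : 𝓞 F) (u : (𝓞 F)ˣ), x ≠ 0 ∧ y ≠ 0 ∧
      x ^ p * a.1 = u * (y ^ p * b.1) := by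
    intro a b hab
    obtain ⟨x, y, hx, hy, hxy⟩ := ClassGroup.mk0_eq_mk0_iff.mp hab
    have h1 : Ideal.span {x ^ p * a.1} = Ideal.span {y ^ p * b.1} := by
      rw [← Ideal.span_singleton_mul_span_singleton, ← Ideal.span_singleton_mul_span_singleton,
        ← Ideal.span_singleton_pow, ← Ideal.span_singleton_pow, hJ, hJ, ← mul_pow, ← mul_pow, hxy]
    obtain ⟨u, hu⟩ := (Ideal.span_singleton_eq_span_singleton.mp h1).symm
    exact ⟨x, y, u, hx, hy, by rw [← hu]; ring⟩
  have : Nonempty P := ⟨⟨1, one_ne_zero, fun Q => by simp [idealOrd, ← Ideal.one_eq_top]⟩⟩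
  let rep : P → P := fun a => Function.invFun cl (cl a)
  have hrep : ∀ a : P, cl a = cl (rep a) := fun a =>
    (Function.invFun_eq (f := cl) ⟨a, rfl⟩).symm
  choose x y u hx hy hxy using fun a => hrel a (rep a) (hrep a)
  refine ⟨ClassGroup (𝓞 F) × ((𝓞 F)ˣ ⧸ (powMonoidHom p : (𝓞 F)ˣ →* (𝓞 F)ˣ).range), inferInstance,
    fun a => if h : a ≠ 0 ∧ ∀ Q, p ∣ idealOrd Q a then (cl ⟨a, h⟩, QuotientGroup.mk (u ⟨a, h⟩))
      else 1, ?_⟩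
  intro a b ha hb hap hbp hab
  beta_reduce at hab
  rw [dif_pos ⟨ha, hap⟩, dif_pos ⟨hb, hbp⟩, Prod.mk.injEq] at hab
  set α : P := ⟨a, ha, hap⟩
  set β : P := ⟨b, hb, hbp⟩
  have hαβ : rep α = rep β := by simp only [rep, hab.1]
  obtain ⟨w, hw⟩ := QuotientGroup.eq.mp hab.2
  have h1 := hxy α
  have h2 := hxy β
  rw [hαβ] at h1
  have h3 : u β = u α * w ^ p := by
    rw [powMonoidHom_apply] at hw
    rw [hw]; group
  refine ⟨x α * y β * w, y α * x β, mul_ne_zero (mul_ne_zero (hx α) (hy β)) w.ne_zero,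
    mul_ne_zero (hy α) (hx β), ?_⟩
  have h3' : (u β : 𝓞 F) = u α * (w : 𝓞 F) ^ p := by rw [h3]; push_cast; rfl
  change x α ^ p * a = _ at h1
  change x β ^ p * b = _ at h2
  calc (x α * y β * w) ^ p * a = (x α ^ p * a) * y β ^ p * w ^ p := by ring
    _ = y α ^ p * ((u α * w ^ p) * (y β ^ p * (rep β).1)) := by rw [h1]; ring
    _ = y α ^ p * (x β ^ p * b) := by rw [← h3', ← h2]
    _ = _ := by ring

end IdealValuations

section Resolvents

variable {p : ℕ} [Fact p.Prime] {R : Type*} [CommRing R]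

/-- The Lagrange resolvents of a tuple indexed by `ZMod p`. -/
def lagrangeResolvent (ψ : AddChar (ZMod p) R) (γ : ZMod p → R) (k : ZMod p) : R :=
  ∑ i, ψ (k * i) * γ i

lemma sum_lagrangeResolvent [IsDomain R] {ψ : AddChar (ZMod p) R} (hψ : ψ.IsPrimitive)
    (γ : ZMod p → R) (j : ZMod p) :
    ∑ k, ψ (-(k * j)) * lagrangeResolvent ψ γ k = p * γ j := by
  have h1 : ∀ i, ∑ k, ψ (-(k * j)) * (ψ (k * i) * γ i) = if i = j then p * γ i else 0 := by
    intro i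
    have h2 : ∀ k, ψ (-(k * j)) * (ψ (k * i) * γ i) = ψ (k * (i - j)) * γ i := by
      intro k
      rw [← mul_assoc, ← AddChar.map_add_eq_mul]
      congr 2; ring
    rw [Finset.sum_congr rfl fun k _ => h2 k, ← Finset.sum_mul, AddChar.sum_mulShift _ hψ,
      ZMod.card]
    simp only [sub_eq_zero]
    split_ifs <;> simp
  simp only [lagrangeResolvent, Finset.mul_sum]
  rw [Finset.sum_comm, Finset.sum_congr rfl fun i _ => h1 i]
  simp

lemma map_lagrangeResolvent {ψ : AddChar (ZMod p) R} (g : R →+* R) {w c : ZMod p}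
    (hg : ∀ i, g (ψ i) = ψ (w * i)) {γ : ZMod p → R} (hγ : ∀ i, g (γ i) = γ (i + c))
    (k : ZMod p) : g (lagrangeResolvent ψ γ k) = ψ (-(w * k * c)) * lagrangeResolvent ψ γ (w * k) := by
  simp only [lagrangeResolvent, map_sum, map_mul, hg, hγ, Finset.mul_sum]
  refine Fintype.sum_equiv (Equiv.addRight c) _ _ fun i => ?_
  rw [Equiv.coe_addRight, ← mul_assoc (ψ (-(w * k * c))), ← AddChar.map_add_eq_mul]
  congr 2; ring

lemma mul_sub_eq_sum_lagrangeResolvent [IsDomain R] {ψ : AddChar (ZMod p) R} (hψ : ψ.IsPrimitive)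
    (γ : ZMod p → R) (i j : ZMod p) :
    p * (γ i - γ j) = ∑ k ∈ Finset.univ.erase 0,
      (ψ (-(k * i)) - ψ (-(k * j))) * lagrangeResolvent ψ γ k := by
  rw [mul_sub, ← sum_lagrangeResolvent hψ γ i, ← sum_lagrangeResolvent hψ γ j, ← Finset.sum_sub_distrib,
    ← Finset.add_sum_erase _ _ (Finset.mem_univ (0 : ZMod p))]
  simp [sub_mul]

end Resolvents

section CyclicTuples

open NumberField

variable {p : ℕ} [Fact p.Prime] {F Ω : Type*} [Field F] [NumberField F]
  [IsCyclotomicExtension {p} ℚ F] [Field Ω] [Algebra F Ω]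

variable (p F) in
/-- The standard additive character of `ZMod p` with values in the `p`-th cyclotomic field. -/
noncomputable def cycloChar : AddChar (ZMod p) F :=
  AddChar.zmodChar p (IsCyclotomicExtension.zeta_spec p ℚ F).pow_eq_one

variable (p F Ω) in
/-- The standard additive character of `ZMod p`, with values in an extension of the cyclotomic
field. -/
noncomputable def bigChar : AddChar (ZMod p) Ω :=
  (algebraMap F Ω).toMonoidHom.compAddChar (cycloChar p F)

lemma bigChar_apply (i : ZMod p) : bigChar p F Ω i = algebraMap F Ω (cycloChar p F i) := rfl

lemma cycloChar_isPrimitive : (cycloChar p F).IsPrimitive :=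
  AddChar.zmodChar_primitive_of_primitive_root p (IsCyclotomicExtension.zeta_spec p ℚ F)

lemma bigChar_isPrimitive : (bigChar p F Ω).IsPrimitive :=
  cycloChar_isPrimitive.compMulHom_of_isPrimitive (algebraMap F Ω).injective

lemma cycloChar_pow (i : ZMod p) : cycloChar p F i ^ p = 1 := by
  rw [← AddChar.map_nsmul_eq_pow]; simp

lemma bigChar_pow (i : ZMod p) : bigChar p F Ω i ^ p = 1 := by
  rw [bigChar_apply, ← map_pow, cycloChar_pow, map_one]

lemma bigChar_ne_zero (i : ZMod p) : bigChar p F Ω i ≠ 0 := fun h => by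
  have := bigChar_pow (F := F) (Ω := Ω) i
  rw [h, zero_pow (Fact.out : p.Prime).ne_zero] at this
  exact zero_ne_one this

lemma isIntegral_bigChar (i : ZMod p) : IsIntegral ℤ (bigChar p F Ω i) := by
  refine IsIntegral.of_pow (Fact.out : p.Prime).pos ?_
  rw [bigChar_pow]
  exact isIntegral_one

variable (p F) in
lemma exists_aut_of_weight {w : ZMod p} (hw : w ≠ 0) : ∃ τ : F ≃ₐ[ℚ] F,
    ∀ i, τ (cycloChar p F i) = cycloChar p F (w * i) := by
  have hirr : Irreducible (cyclotomic p ℚ) :=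
    cyclotomic.irreducible_rat (Fact.out : p.Prime).pos
  have hζ := IsCyclotomicExtension.zeta_spec p ℚ F
  obtain ⟨τ, hτ⟩ := (IsCyclotomicExtension.autEquivPow F hirr).surjective (Units.mk0 w hw)
  refine ⟨τ, fun i => ?_⟩
  have h1 := hζ.autToPow_spec ℚ τ
  have h2 : hζ.autToPow ℚ τ = Units.mk0 w hw := hτ
  rw [h2, Units.val_mk0] at h1
  simp only [cycloChar, AddChar.zmodChar_apply, map_pow]
  rw [← h1, ← pow_mul, ZMod.val_mul]
  exact pow_eq_pow_mod _ hζ.pow_eq_one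

variable [CharZero Ω] [IsScalarTower ℚ F Ω] [IsGalois ℚ Ω]

lemma exists_lift (τ : F ≃ₐ[ℚ] F) : ∃ g : Ω ≃ₐ[ℚ] Ω, ∀ x,
    g (algebraMap F Ω x) = algebraMap F Ω (τ x) :=
  ⟨τ.liftNormal Ω, τ.liftNormal_commutes Ω⟩

lemma mem_range_of_fixed {x : Ω} (h : ∀ g : Ω ≃ₐ[ℚ] Ω,
    (∀ y, g (algebraMap F Ω y) = algebraMap F Ω y) → g x = x) :
    ∃ y, algebraMap F Ω y = x := by
  have : IsGalois F Ω := IsGalois.tower_top_of_isGalois ℚ F Ω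
  exact (InfiniteGalois.mem_range_algebraMap_iff_fixed x).mpr fun f =>
    h (f.restrictScalars ℚ) f.commutes

lemma exists_int_of_fixed {Ω : Type*} [Field Ω] [CharZero Ω] [IsGalois ℚ Ω] {x : Ω}
    (hx : IsIntegral ℤ x) (h : ∀ g : Ω ≃ₐ[ℚ] Ω, g x = x) : ∃ n : ℤ, (n : Ω) = x := by
  obtain ⟨q, rfl⟩ := (InfiniteGalois.mem_range_algebraMap_iff_fixed (k := ℚ) x).mpr h
  have hq : IsIntegral ℤ q := (isIntegral_algebraMap_iff (algebraMap ℚ Ω).injective).mp hx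
  obtain ⟨n, rfl⟩ := IsIntegrallyClosed.isIntegral_iff.mp hq
  exact ⟨n, by simp⟩

end CyclicTuples

section TwistedIdeals

open NumberField UniqueFactorizationMonoid

variable {p : ℕ} [Fact p.Prime] {F : Type*} [Field F] [NumberField F]

variable (p) in
/-- The primes whose exponent in `(a)` is congruent to `k` modulo `p`, among those dividing `a`. -/
noncomputable def ordClass (a : 𝓞 F) (k : ZMod p) : Finset (Ideal (𝓞 F)) :=
  (normalizedFactors (Ideal.span {a})).toFinset.filter fun Q => (idealOrd Q a : ZMod p) = k

lemma mem_ordClass {a : 𝓞 F} {k : ZMod p} (hk : k ≠ 0) {Q : Ideal (𝓞 F)} :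
    Q ∈ ordClass p a k ↔ (idealOrd Q a : ZMod p) = k := by
  rw [ordClass, Finset.mem_filter, and_iff_right_iff_imp]
  intro h
  rw [Multiset.mem_toFinset, ← Multiset.count_ne_zero]
  rintro h0
  exact hk (by rw [← h, idealOrd, h0, Nat.cast_zero])

lemma prime_of_mem_ordClass {a : 𝓞 F} {k : ZMod p} {Q : Ideal (𝓞 F)} (h : Q ∈ ordClass p a k) :
    Prime Q :=
  prime_of_normalized_factor Q (Multiset.mem_toFinset.mp (Finset.mem_filter.mp h).1)

variable (p) in
/-- The product of the primes whose exponent in `(a)` is congruent to `1` modulo `p`. -/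
noncomputable def unitOrdIdeal (a : 𝓞 F) : Ideal (𝓞 F) := ∏ Q ∈ ordClass p a 1, Q

lemma dvd_unitOrdIdeal_iff {a : 𝓞 F} {Q : Ideal (𝓞 F)} (hQ : Prime Q) :
    Q ∣ unitOrdIdeal p a ↔ Q ∈ ordClass p a 1 := by
  refine ⟨fun h => ?_, fun h => Finset.dvd_prod_of_mem _ h⟩
  obtain ⟨Q', hQ', hdvd⟩ := (hQ.dvd_finsetProd_iff _).mp h
  have : Q = Q' := associated_iff_eq.mp (hQ.associated_of_dvd (prime_of_mem_ordClass hQ') hdvd)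
  rwa [this]

lemma ordClass_eq_of_unitOrdIdeal_eq {a b : 𝓞 F} (h : unitOrdIdeal p a = unitOrdIdeal p b) :
    ordClass p a 1 = ordClass p b 1 := by
  ext Q
  constructor <;> intro hQ
  · exact (dvd_unitOrdIdeal_iff (prime_of_mem_ordClass hQ)).mp
      (h ▸ (dvd_unitOrdIdeal_iff (prime_of_mem_ordClass hQ)).mpr hQ)
  · exact (dvd_unitOrdIdeal_iff (prime_of_mem_ordClass hQ)).mp
      (h ▸ (dvd_unitOrdIdeal_iff (prime_of_mem_ordClass hQ)).mpr hQ)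

/-- The exponents of `(a)` modulo `p` transform inversely under a family of automorphisms. -/
def IsTwisted (σ : ZMod p → 𝓞 F ≃+* 𝓞 F) (a : 𝓞 F) : Prop :=
  ∀ w, w ≠ 0 → ∀ Q : Ideal (𝓞 F),
    w * (idealOrd (Q.map (σ w)) a : ZMod p) = idealOrd Q a

variable {σ : ZMod p → 𝓞 F ≃+* 𝓞 F}

lemma IsTwisted.idealOrd_eq_of_ne {a b : 𝓞 F} (ha : IsTwisted σ a) (hb : IsTwisted σ b)
    (h : unitOrdIdeal p a = unitOrdIdeal p b) (Q : Ideal (𝓞 F))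
    (hQ : (idealOrd Q a : ZMod p) ≠ 0) :
    (idealOrd Q a : ZMod p) = idealOrd Q b := by
  have h1 := ha _ hQ Q
  have h2 := hb _ hQ Q
  have h3 : (idealOrd (Q.map (σ (idealOrd Q a : ZMod p))) a : ZMod p) = 1 :=
    mul_left_cancel₀ hQ (by rw [h1, mul_one])
  have h4 : (idealOrd (Q.map (σ (idealOrd Q a : ZMod p))) b : ZMod p) = 1 := by
    rw [← mem_ordClass one_ne_zero] at h3 ⊢
    rwa [← ordClass_eq_of_unitOrdIdeal_eq h]
  rw [← h2, h4, mul_one]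

lemma IsTwisted.idealOrd_eq {a b : 𝓞 F} (ha : IsTwisted σ a) (hb : IsTwisted σ b)
    (h : unitOrdIdeal p a = unitOrdIdeal p b) (Q : Ideal (𝓞 F)) :
    (idealOrd Q a : ZMod p) = idealOrd Q b := by
  by_cases hQ : (idealOrd Q a : ZMod p) = 0
  · by_cases hQ' : (idealOrd Q b : ZMod p) = 0
    · rw [hQ, hQ']
    · exact (hb.idealOrd_eq_of_ne ha h.symm Q hQ').symm
  · exact ha.idealOrd_eq_of_ne hb h Q hQ

lemma IsTwisted.prod_absNorm {a : 𝓞 F} (ha : IsTwisted σ a) {k : ZMod p} (hk : k ≠ 0) :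
    ∏ Q ∈ ordClass p a k, Ideal.absNorm Q = Ideal.absNorm (unitOrdIdeal p a) := by
  rw [unitOrdIdeal, map_prod]
  have hinv : ∀ Q : Ideal (𝓞 F), (Q.map (σ k).symm).map (σ k) = Q := fun Q =>
    Ideal.map_of_equiv (σ k).symm
  refine Finset.prod_nbij' (fun Q => Q.map (σ k)) (fun Q => Q.map (σ k).symm) ?_ ?_ ?_ ?_ ?_
  · intro Q hQ
    rw [mem_ordClass one_ne_zero]
    rw [mem_ordClass hk] at hQ
    exact mul_left_cancel₀ hk (by rw [ha k hk Q, hQ, mul_one])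
  · intro Q hQ
    rw [mem_ordClass one_ne_zero] at hQ
    rw [mem_ordClass hk, ← ha k hk, hinv, hQ, mul_one]
  · exact fun Q _ => Ideal.map_of_equiv (σ k)
  · exact fun Q _ => hinv Q
  · exact fun Q _ => (absNorm_map_ringEquiv (σ k) Q).symm

lemma IsTwisted.absNorm_le [IsCyclotomicExtension {p} ℚ F] {a : 𝓞 F} (ha : IsTwisted σ a) {n : ℤ}
    (hn : n ≠ 0) (h : ∀ Q : Ideal (𝓞 F), (idealOrd Q a : ZMod p) ≠ 0 → (n : 𝓞 F) ∈ Q) :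
    Ideal.absNorm (unitOrdIdeal p a) ≤ n.natAbs := by
  have hp : p.Prime := Fact.out
  set W := (Finset.univ.erase (0 : ZMod p)).biUnion (ordClass p a) with hW
  have hdisj : (↑(Finset.univ.erase (0 : ZMod p)) : Set (ZMod p)).PairwiseDisjoint
      (ordClass p a) := by
    intro i hi j hj hij
    rw [Function.onFun, Finset.disjoint_left]
    intro Q h1 h2
    exact hij ((Finset.mem_filter.mp h1).2.symm.trans (Finset.mem_filter.mp h2).2)
  have hprod : ∏ Q ∈ W, Ideal.absNorm Q = Ideal.absNorm (unitOrdIdeal p a) ^ (p - 1) := by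
    rw [hW, Finset.prod_biUnion hdisj,
      Finset.prod_congr rfl fun k hk => ha.prod_absNorm (Finset.ne_of_mem_erase hk),
      Finset.prod_const, Finset.card_erase_of_mem (Finset.mem_univ _), Finset.card_univ, ZMod.card]
  have hdvd : ∏ Q ∈ W, Q ∣ Ideal.span {(n : 𝓞 F)} := by
    refine Finset.prod_primes_dvd _ ?_ ?_
    · intro Q hQ
      obtain ⟨k, -, hQ⟩ := Finset.mem_biUnion.mp hQ
      exact prime_of_mem_ordClass hQ
    · intro Q hQ
      obtain ⟨k, hk, hQ⟩ := Finset.mem_biUnion.mp hQ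
      rw [Ideal.dvd_span_singleton]
      have hk0 := Finset.ne_of_mem_erase hk
      exact h Q (by rwa [(mem_ordClass hk0).mp hQ])
  have hfin : Module.finrank ℤ (𝓞 F) = p - 1 := by
    rw [RingOfIntegers.rank,
      IsCyclotomicExtension.finrank F (cyclotomic.irreducible_rat hp.pos), Nat.totient_prime hp]
  have hnorm : Ideal.absNorm (Ideal.span {(n : 𝓞 F)}) = n.natAbs ^ (p - 1) := by
    rw [Ideal.absNorm_span_singleton, ← eq_intCast (algebraMap ℤ (𝓞 F)), Algebra.norm_algebraMap,
      Int.natAbs_pow, hfin]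
  have h1 := map_dvd Ideal.absNorm hdvd
  rw [map_prod, hprod, hnorm] at h1
  have h2 := Nat.le_of_dvd (pow_pos (Int.natAbs_pos.mpr hn) _) h1
  exact (Nat.pow_le_pow_iff_left (Nat.sub_ne_zero_of_lt hp.one_lt)).mp h2

end TwistedIdeals

section KummerGenerators

open NumberField

variable {p : ℕ} [Fact p.Prime] {F Ω : Type*} [Field F] [NumberField F]
  [IsCyclotomicExtension {p} ℚ F] [Field Ω] [CharZero Ω] [Algebra F Ω]

/-- A tuple of algebraic integers on which the Galois group acts through cyclic shifts by `χ`. -/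
structure IsCyclicTuple (χ : (Ω ≃ₐ[ℚ] Ω) → ZMod p) (γ : ZMod p → Ω) : Prop where
  integral : ∀ i, IsIntegral ℤ (γ i)
  apply_eq : ∀ g i, g (γ i) = γ (i + χ g)

/-- A cyclic tuple that is not constant. -/
structure IsProperCyclicTuple (χ : (Ω ≃ₐ[ℚ] Ω) → ZMod p) (γ : ZMod p → Ω) : Prop
    extends IsCyclicTuple χ γ where
  nonconst : ∃ i j, γ i ≠ γ j

variable (p F) in
/-- An automorphism of the cyclotomic field raising `p`-th roots of unity to the power `w`. -/
noncomputable def weightAut (w : ZMod p) : F ≃ₐ[ℚ] F :=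
  if h : w ≠ 0 then (exists_aut_of_weight p F h).choose else AlgEquiv.refl

lemma weightAut_apply {w : ZMod p} (hw : w ≠ 0) (i : ZMod p) :
    weightAut p F w (cycloChar p F i) = cycloChar p F (w * i) := by
  rw [weightAut, dif_pos hw]
  exact (exists_aut_of_weight p F hw).choose_spec i

variable {χ : (Ω ≃ₐ[ℚ] Ω) → ZMod p} {γ γ' : ZMod p → Ω}

lemma IsCyclicTuple.map_resolvent (h : IsCyclicTuple χ γ) {g : Ω ≃ₐ[ℚ] Ω} {τ : F ≃ₐ[ℚ] F}
    (hg : ∀ x, g (algebraMap F Ω x) = algebraMap F Ω (τ x)) {w : ZMod p}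
    (hw : ∀ i, τ (cycloChar p F i) = cycloChar p F (w * i)) (k : ZMod p) :
    g (lagrangeResolvent (bigChar p F Ω) γ k) =
      bigChar p F Ω (-(w * k * χ g)) * lagrangeResolvent (bigChar p F Ω) γ (w * k) :=
  _root_.map_lagrangeResolvent (g : Ω →+* Ω)
    (fun i => by simp only [bigChar_apply]; exact (hg _).trans (by rw [hw])) (h.apply_eq g) k

lemma IsCyclicTuple.map_resolvent_of_fix (h : IsCyclicTuple χ γ) {g : Ω ≃ₐ[ℚ] Ω}
    (hg : ∀ x, g (algebraMap F Ω x) = algebraMap F Ω x) (k : ZMod p) :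
    g (lagrangeResolvent (bigChar p F Ω) γ k) =
      bigChar p F Ω (-(k * χ g)) * lagrangeResolvent (bigChar p F Ω) γ k := by
  simpa using h.map_resolvent (τ := AlgEquiv.refl) (w := 1) (by simpa using hg) (by simp) k

lemma IsCyclicTuple.isIntegral_resolvent (h : IsCyclicTuple χ γ) (k : ZMod p) :
    IsIntegral ℤ (lagrangeResolvent (bigChar p F Ω) γ k) :=
  IsIntegral.sum _ fun i _ => (isIntegral_bigChar _).mul (h.integral i)

variable [IsScalarTower ℚ F Ω] [IsGalois ℚ Ω]

variable (F) in
/-- The `p`-th power of a Lagrange resolvent, as an algebraic integer of the cyclotomic field. -/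
noncomputable def kummerGen (γ : ZMod p → Ω) (k : ZMod p) : 𝓞 F :=
  Function.invFun (fun ρ : 𝓞 F => algebraMap F Ω ρ) (lagrangeResolvent (bigChar p F Ω) γ k ^ p)

lemma IsCyclicTuple.algebraMap_kummerGen (h : IsCyclicTuple χ γ) (k : ZMod p) :
    algebraMap F Ω (kummerGen F γ k) = lagrangeResolvent (bigChar p F Ω) γ k ^ p := by
  refine Function.invFun_eq (f := fun ρ : 𝓞 F => algebraMap F Ω ρ) ?_
  obtain ⟨y, hy⟩ := mem_range_of_fixed (F := F)
    (x := lagrangeResolvent (bigChar p F Ω) γ k ^ p) fun g hg => by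
      rw [map_pow, h.map_resolvent_of_fix hg, mul_pow, bigChar_pow, one_mul]
  have hintegral : IsIntegral ℤ y := by
    rw [← isIntegral_algebraMap_iff (algebraMap F Ω).injective, hy]
    exact (h.isIntegral_resolvent k).pow p
  exact ⟨⟨y, hintegral⟩, hy⟩

lemma IsCyclicTuple.map_kummerGen (h : IsCyclicTuple χ γ) {w : ZMod p} (hw : w ≠ 0)
    (k : ZMod p) : RingOfIntegers.mapRingEquiv (weightAut p F w : F ≃+* F) (kummerGen F γ k) =
      kummerGen F γ (w * k) := by
  obtain ⟨g, hg⟩ := exists_lift (Ω := Ω) (weightAut p F w)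
  refine RingOfIntegers.ext ((algebraMap F Ω).injective ?_)
  rw [h.algebraMap_kummerGen, RingOfIntegers.mapRingEquiv_apply]
  refine (hg _).symm.trans ?_
  rw [h.algebraMap_kummerGen, map_pow, h.map_resolvent hg (weightAut_apply hw), mul_pow,
    bigChar_pow, one_mul]

lemma IsProperCyclicTuple.resolvent_ne_zero (h : IsProperCyclicTuple χ γ) {k : ZMod p}
    (hk : k ≠ 0) : lagrangeResolvent (bigChar p F Ω) γ k ≠ 0 := by
  intro h0
  have hall : ∀ m : ZMod p, m ≠ 0 → lagrangeResolvent (bigChar p F Ω) γ m = 0 := by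
    intro m hm
    have hw : m / k ≠ 0 := div_ne_zero hm hk
    obtain ⟨g, hg⟩ := exists_lift (Ω := Ω) (weightAut p F (m / k))
    have h1 := h.map_resolvent hg (weightAut_apply hw) k
    rw [h0, map_zero, div_mul_cancel₀ m hk] at h1
    exact (mul_eq_zero.mp h1.symm).resolve_left (bigChar_ne_zero _)
  obtain ⟨i, j, hij⟩ := h.nonconst
  have h2 := mul_sub_eq_sum_lagrangeResolvent (bigChar_isPrimitive (F := F)) γ i j
  rw [Finset.sum_eq_zero fun m hm => by rw [hall m (Finset.ne_of_mem_erase hm), mul_zero]] at h2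
  have hp : (p : Ω) ≠ 0 := Nat.cast_ne_zero.mpr (Fact.out : p.Prime).ne_zero
  exact hij (sub_eq_zero.mp ((mul_eq_zero.mp h2).resolve_left hp))

lemma IsProperCyclicTuple.kummerGen_ne_zero (h : IsProperCyclicTuple χ γ) {k : ZMod p}
    (hk : k ≠ 0) : kummerGen F γ k ≠ 0 := by
  intro h0
  have h1 := h.algebraMap_kummerGen (F := F) k
  rw [h0] at h1
  simp only [map_zero] at h1
  exact pow_ne_zero p (h.resolvent_ne_zero hk) h1.symm

lemma exists_div_eq (x : F) : ∃ s t : 𝓞 F, t ≠ 0 ∧ x = s / t := by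
  obtain ⟨s, t, ht, hx⟩ := IsFractionRing.div_surjective (A := 𝓞 F) x
  exact ⟨s, t, nonZeroDivisors.ne_zero ht, hx.symm⟩

lemma IsProperCyclicTuple.idealOrd_kummerGen (h : IsProperCyclicTuple χ γ)
    (h' : IsProperCyclicTuple χ γ') {k : ZMod p} (hk : k ≠ 0) (Q : Ideal (𝓞 F)) :
    (idealOrd Q (kummerGen F γ k) : ZMod p) = k * idealOrd Q (kummerGen F γ' 1) := by
  set θ := lagrangeResolvent (bigChar p F Ω) γ k
  set θ' := lagrangeResolvent (bigChar p F Ω) γ' 1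
  have hθ : θ ≠ 0 := h.resolvent_ne_zero hk
  have hθ' : θ' ≠ 0 := h'.resolvent_ne_zero one_ne_zero
  obtain ⟨y, hy⟩ := mem_range_of_fixed (F := F) (x := θ / θ' ^ k.val) fun g hg => by
    rw [map_div₀, map_pow, h.map_resolvent_of_fix hg, h'.map_resolvent_of_fix hg, mul_pow,
      ← AddChar.map_nsmul_eq_pow, one_mul, nsmul_eq_mul, ZMod.natCast_zmod_val, mul_neg]
    exact mul_div_mul_left _ _ (bigChar_ne_zero _)
  obtain ⟨s, t, ht, rfl⟩ := exists_div_eq y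
  have htΩ : algebraMap F Ω t ≠ 0 := by simpa using ht
  have hs : s ≠ 0 := by
    rintro rfl
    simp only [map_zero, zero_div] at hy
    exact div_ne_zero hθ (pow_ne_zero _ hθ') hy.symm
  have hrel : kummerGen F γ k * t ^ p = kummerGen F γ' 1 ^ k.val * s ^ p := by
    refine RingOfIntegers.ext ((algebraMap F Ω).injective ?_)
    simp only [map_mul, map_pow]
    rw [h.algebraMap_kummerGen, h'.algebraMap_kummerGen, ← mul_pow, ← pow_mul, mul_comm p, pow_mul,
      ← mul_pow]
    congr 1
    rw [map_div₀, div_eq_div_iff htΩ (pow_ne_zero _ hθ')] at hy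
    rw [← hy, mul_comm]
  have h1 := congrArg (idealOrd Q) hrel
  rw [idealOrd_mul Q (h.kummerGen_ne_zero hk) (pow_ne_zero _ ht),
    idealOrd_mul Q (pow_ne_zero _ (h'.kummerGen_ne_zero one_ne_zero)) (pow_ne_zero _ hs),
    idealOrd_pow, idealOrd_pow, idealOrd_pow] at h1
  have h2 := congrArg (Nat.cast : ℕ → ZMod p) h1
  simpa using h2

lemma IsProperCyclicTuple.isTwisted (h : IsProperCyclicTuple χ γ) :
    IsTwisted (fun w => RingOfIntegers.mapRingEquiv (weightAut p F w : F ≃+* F))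
      (kummerGen F γ 1) := by
  intro w hw Q
  rw [← h.idealOrd_kummerGen h hw]
  have h1 := h.map_kummerGen (F := F) hw 1
  rw [mul_one] at h1
  rw [← h1, idealOrd_map]

end KummerGenerators

section CyclicCharacters

open NumberField

variable {p : ℕ} [Fact p.Prime] {F Ω : Type*} [Field F] [NumberField F]
  [IsCyclotomicExtension {p} ℚ F] [Field Ω] [Algebra F Ω]

lemma bigChar_injective : Function.Injective (bigChar p F Ω) := by
  intro i j hij
  have h1 : bigChar p F Ω (i - j) = 1 := by
    rw [AddChar.map_sub_eq_div, hij, div_self (bigChar_ne_zero _)]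
  exact sub_eq_zero.mp ((bigChar_isPrimitive.zmod_char_eq_one_iff p _).mp h1)

lemma exists_algebraMap_eq_of_pow_eq_one {x : Ω} (hx : x ^ p = 1) : ∃ y : F, algebraMap F Ω y = x := by
  have hζ := (IsCyclotomicExtension.zeta_spec p ℚ F).map_of_injective (algebraMap F Ω).injective
  obtain ⟨i, -, hi⟩ := hζ.eq_pow_of_pow_eq_one hx
  exact ⟨_, by rw [← hi, ← map_pow]⟩

variable [CharZero Ω]

lemma IsProperCyclicTuple.injective {χ : (Ω ≃ₐ[ℚ] Ω) → ZMod p} {γ : ZMod p → Ω}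
    (h : IsProperCyclicTuple χ γ) (hχ : Function.Surjective χ) : Function.Injective γ := by
  intro i j hij
  by_contra hne
  have hl : j - i ≠ 0 := sub_ne_zero.mpr (Ne.symm hne)
  have h1 : ∀ m, γ m = γ (m + (j - i)) := by
    intro m
    obtain ⟨g, hg⟩ := hχ (m - i)
    have h2 := congrArg g hij
    rw [h.apply_eq, h.apply_eq, hg] at h2
    convert h2 using 2 <;> ring
  have h2 : ∀ (n : ℕ) m, γ m = γ (m + n * (j - i)) := by
    intro n
    induction n with
    | zero => simp
    | succ n ih =>
      intro m
      rw [ih m, h1]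
      congr 1; push_cast; ring
  obtain ⟨a, b, hab⟩ := h.nonconst
  refine hab ?_
  rw [h2 ((b - a) / (j - i)).val a, ZMod.natCast_zmod_val, div_mul_cancel₀ _ hl, add_sub_cancel]

variable [IsScalarTower ℚ F Ω] [IsGalois ℚ Ω]

variable {χ χ' : (Ω ≃ₐ[ℚ] Ω) → ZMod p} {γ γ' : ZMod p → Ω}

lemma IsProperCyclicTuple.mem_of_idealOrd_ne_zero (h : IsProperCyclicTuple χ γ) {l : ZMod p}
    {n : ℤ} (hn : (n : Ω) = ∏ i, (γ i - γ (i + l))) {Q : Ideal (𝓞 F)}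
    (hQ : (idealOrd Q (kummerGen F γ 1) : ZMod p) ≠ 0) : ((p ^ p * n : ℤ) : 𝓞 F) ∈ Q := by
  have hcast : ∀ {m : ℕ}, (m : ZMod p) ≠ 0 → m ≠ 0 := by
    rintro m hm rfl
    simp at hm
  have hρ : ∀ k : ZMod p, k ≠ 0 → kummerGen F γ k ∈ Q := by
    intro k hk
    refine _root_.mem_of_idealOrd_ne_zero (hcast ?_)
    rw [h.idealOrd_kummerGen h hk]
    exact mul_ne_zero hk hQ
  have hprime : Q.IsPrime := Ideal.isPrime_of_prime (prime_of_idealOrd_ne_zero (hcast hQ))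
  obtain ⟨P, hP, hPQ⟩ := Ideal.exists_ideal_over_prime_of_isIntegral_of_isDomain (S := 𝓞 Ω) Q
    (by rw [RingOfIntegers.ker_algebraMap_eq_bot]; exact bot_le)
  let Γ : ZMod p → 𝓞 Ω := fun i => ⟨γ i, h.integral i⟩
  let ψ : ZMod p → 𝓞 Ω := fun i => ⟨bigChar p F Ω i, isIntegral_bigChar i⟩
  let Θ : ZMod p → 𝓞 Ω := fun k =>
    ⟨lagrangeResolvent (bigChar p F Ω) γ k, h.isIntegral_resolvent k⟩
  have hΓ' : ∀ i, algebraMap (𝓞 Ω) Ω (Γ i) = γ i := fun _ => rfl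
  have hψ' : ∀ i, algebraMap (𝓞 Ω) Ω (ψ i) = bigChar p F Ω i := fun _ => rfl
  have hΘ' : ∀ k, algebraMap (𝓞 Ω) Ω (Θ k) = lagrangeResolvent (bigChar p F Ω) γ k := fun _ => rfl
  have hΘ : ∀ k, k ≠ 0 → Θ k ∈ P := by
    intro k hk
    refine hP.mem_of_pow_mem p ?_
    have h1 : Θ k ^ p = algebraMap (𝓞 F) (𝓞 Ω) (kummerGen F γ k) :=
      RingOfIntegers.ext (h.algebraMap_kummerGen (F := F) k).symm
    rw [h1, ← Ideal.mem_comap, hPQ]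
    exact hρ k hk
  have hΓ : ∀ i j, (p : 𝓞 Ω) * (Γ i - Γ j) ∈ P := by
    intro i j
    have h1 : (p : 𝓞 Ω) * (Γ i - Γ j) =
        ∑ k ∈ Finset.univ.erase 0, (ψ (-(k * i)) - ψ (-(k * j))) * Θ k := by
      refine RingOfIntegers.ext ?_
      have := mul_sub_eq_sum_lagrangeResolvent (bigChar_isPrimitive (F := F) (Ω := Ω)) γ i j
      simpa only [map_mul, map_sub, map_sum, map_natCast, hΓ', hψ', hΘ'] using this
    rw [h1]
    exact Ideal.sum_mem _ fun k hk => P.mul_mem_left _ (hΘ k (Finset.ne_of_mem_erase hk))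
  have hfin : ((p ^ p * n : ℤ) : 𝓞 Ω) = ∏ i, ((p : 𝓞 Ω) * (Γ i - Γ (i + l))) := by
    refine RingOfIntegers.ext ?_
    rw [Finset.prod_mul_distrib, Finset.prod_const, Finset.card_univ, ZMod.card]
    simp only [map_mul, map_sub, map_prod, map_natCast, map_intCast, map_pow, hΓ', Int.cast_mul,
      Int.cast_pow, Int.cast_natCast, hn]
  rw [← hPQ, Ideal.mem_comap, map_intCast, hfin,
    ← Finset.mul_prod_erase _ _ (Finset.mem_univ (0 : ZMod p))]
  exact P.mul_mem_right _ (hΓ _ _)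

lemma IsProperCyclicTuple.exists_prod_sub_eq (h : IsProperCyclicTuple χ γ)
    (hχ : Function.Surjective χ) {l : ZMod p} (hl : l ≠ 0) :
    ∃ n : ℤ, n ≠ 0 ∧ (n : Ω) = ∏ i, (γ i - γ (i + l)) ∧
      Ideal.absNorm (unitOrdIdeal p (kummerGen F γ 1)) ≤ p ^ p * n.natAbs := by
  have hintegral : IsIntegral ℤ (∏ i, (γ i - γ (i + l))) :=
    IsIntegral.prod _ fun i _ => (h.integral _).sub (h.integral _)
  obtain ⟨n, hn⟩ := exists_int_of_fixed hintegral fun g => by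
    rw [map_prod]
    refine Fintype.prod_equiv (Equiv.addRight (χ g)) _ _ fun i => ?_
    rw [map_sub, h.apply_eq, h.apply_eq, Equiv.coe_addRight, add_right_comm]
  have hn0 : n ≠ 0 := by
    rintro rfl
    rw [Int.cast_zero, eq_comm, Finset.prod_eq_zero_iff] at hn
    obtain ⟨i, -, hi⟩ := hn
    exact hl (by simpa using h.injective hχ (sub_eq_zero.mp hi))
  have hp : (p : ℤ) ≠ 0 := Int.natCast_ne_zero.mpr (Fact.out : p.Prime).ne_zero
  refine ⟨n, hn0, hn, ?_⟩
  have h1 := h.isTwisted.absNorm_le (F := F) (mul_ne_zero (pow_ne_zero p hp) hn0)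
    fun Q hQ => h.mem_of_idealOrd_ne_zero hn hQ
  simpa [Int.natAbs_mul, Int.natAbs_pow] using h1

lemma unitOrdIdeal_kummerGen_eq (h : IsProperCyclicTuple χ γ) (h' : IsProperCyclicTuple χ γ') :
    unitOrdIdeal p (kummerGen F γ 1) = unitOrdIdeal p (kummerGen F γ' 1) := by
  have h1 : ordClass p (kummerGen F γ 1) 1 = ordClass p (kummerGen F γ' 1) 1 := by
    ext Q
    rw [mem_ordClass one_ne_zero, mem_ordClass one_ne_zero,
      h.idealOrd_kummerGen h' one_ne_zero, one_mul]
  rw [unitOrdIdeal, h1, unitOrdIdeal]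

lemma eq_of_kummerGen_eq [IsGalois ℚ F] (hadd : ∀ g g', χ (g * g') = χ g + χ g')
    (hadd' : ∀ g g', χ' (g * g') = χ' g + χ' g') (h : IsProperCyclicTuple χ γ)
    (h' : IsProperCyclicTuple χ' γ') {x y : 𝓞 F} (hx : x ≠ 0) (hy : y ≠ 0)
    (hxy : x ^ p * kummerGen F γ 1 = y ^ p * kummerGen F γ' 1) : χ = χ' := by
  set θ := lagrangeResolvent (bigChar p F Ω) γ 1
  set θ' := lagrangeResolvent (bigChar p F Ω) γ' 1
  have hθ : θ ≠ 0 := h.resolvent_ne_zero one_ne_zero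
  have hθ' : θ' ≠ 0 := h'.resolvent_ne_zero one_ne_zero
  have hxΩ : algebraMap F Ω x ≠ 0 := by simpa using hx
  have hyΩ : algebraMap F Ω y ≠ 0 := by simpa using hy
  have hpow : (algebraMap F Ω x * θ / (algebraMap F Ω y * θ')) ^ p = 1 := by
    have h1 := congrArg (fun z : 𝓞 F => algebraMap F Ω z) hxy
    simp only [map_mul, map_pow] at h1
    rw [h.algebraMap_kummerGen, h'.algebraMap_kummerGen] at h1
    rw [div_pow, mul_pow, mul_pow, h1, div_self]
    exact mul_ne_zero (pow_ne_zero _ hyΩ) (pow_ne_zero _ hθ')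
  obtain ⟨z, hz⟩ := exists_algebraMap_eq_of_pow_eq_one (F := F) hpow
  rw [eq_div_iff (mul_ne_zero hyΩ hθ')] at hz
  have hfix : ∀ g : Ω ≃ₐ[ℚ] Ω, (∀ x, g (algebraMap F Ω x) = algebraMap F Ω x) → χ g = χ' g := by
    intro g hg
    have h1 := congrArg g hz
    simp only [map_mul, hg] at h1
    rw [h.map_resolvent_of_fix hg, h'.map_resolvent_of_fix hg, one_mul, one_mul] at h1
    have h2 : bigChar p F Ω (-χ' g) * (algebraMap F Ω x * θ) =
        bigChar p F Ω (-χ g) * (algebraMap F Ω x * θ) := by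
      linear_combination h1 - bigChar p F Ω (-χ' g) * hz
    have h3 := bigChar_injective (mul_right_cancel₀ (mul_ne_zero hxΩ hθ) h2)
    exact (neg_injective h3).symm
  have hpow_add : ∀ {χ : (Ω ≃ₐ[ℚ] Ω) → ZMod p}, (∀ g g', χ (g * g') = χ g + χ g') →
      ∀ g (n : ℕ), χ (g ^ n) = n * χ g := by
    intro χ hχ g n
    induction n with
    | zero =>
      have := hχ 1 1
      simpa using this
    | succ n ih => rw [pow_succ, hχ, ih]; push_cast; ring
  funext g
  have hp : p.Prime := Fact.out
  have h1 := hfix (g ^ (p - 1)) fun x => by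
    have h2 : AlgEquiv.restrictNormalHom F (g ^ (p - 1)) = 1 := by
      rw [map_pow]
      have h3 : Nat.card (F ≃ₐ[ℚ] F) = p - 1 := by
        rw [IsGalois.card_aut_eq_finrank,
          IsCyclotomicExtension.finrank F (cyclotomic.irreducible_rat hp.pos),
          Nat.totient_prime hp]
      rw [← h3, pow_card_eq_one']
    have h3 := (g ^ (p - 1)).restrictNormal_commutes F x
    have h4 : (g ^ (p - 1)).restrictNormal F = 1 := h2
    rw [h4] at h3
    exact h3.symm
  rw [hpow_add hadd, hpow_add hadd'] at h1
  refine mul_left_cancel₀ (a := ((p - 1 : ℕ) : ZMod p)) ?_ h1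
  rw [Nat.cast_sub hp.one_le]
  simp

end CyclicCharacters

section CountingCharacters

open NumberField

variable {p : ℕ} [Fact p.Prime] {F Ω : Type*} [Field F] [NumberField F]
  [IsCyclotomicExtension {p} ℚ F] [Field Ω] [CharZero Ω] [Algebra F Ω]

variable (p Ω) in
/-- The surjective characters of the Galois group that occur for some nonconstant cyclic tuple. -/
def CyclicChar : Type _ :=
  {χ : (Ω ≃ₐ[ℚ] Ω) → ZMod p // (∀ g h, χ (g * h) = χ g + χ h) ∧ Function.Surjective χ ∧
    ∃ γ, IsProperCyclicTuple χ γ}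

/-- A nonconstant cyclic tuple for a given character. -/
noncomputable def CyclicChar.tuple (χ : CyclicChar p Ω) : ZMod p → Ω := χ.2.2.2.choose

lemma CyclicChar.isProper (χ : CyclicChar p Ω) : IsProperCyclicTuple χ.1 χ.tuple :=
  χ.2.2.2.choose_spec

variable (F) in
/-- The ideal measuring the tame ramification of a cyclic character. -/
noncomputable def CyclicChar.condIdeal (χ : CyclicChar p Ω) : Ideal (𝓞 F) :=
  unitOrdIdeal p (kummerGen F χ.tuple 1)

variable (F) in
/-- The size of the ramification of a cyclic character, up to a bounded factor. -/
noncomputable def CyclicChar.cond (χ : CyclicChar p Ω) : ℝ :=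
  max 1 ((Ideal.absNorm (χ.condIdeal F) : ℝ) / p ^ p)

variable [IsScalarTower ℚ F Ω] [IsGalois ℚ Ω]

variable (p F Ω) in
lemma CyclicChar.exists_card_le : ∃ C : ℝ, 0 ≤ C ∧ ∀ Y : ℝ, 1 ≤ Y →
    ∀ S : Finset (CyclicChar p Ω), (∀ χ ∈ S, χ.cond F ≤ Y) → (S.card : ℝ) ≤ C * Y := by
  have hp : p.Prime := Fact.out
  have : IsGalois ℚ F := IsCyclotomicExtension.isGalois {p} ℚ F
  obtain ⟨C, hC, hideal⟩ := exists_card_ideal_le F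
  obtain ⟨κ, hκ, Φ, hΦ⟩ := exists_finite_selmer F hp.pos
  refine ⟨C * p ^ p * Nat.card κ, by positivity, fun Y hY S hS => ?_⟩
  rcases S.eq_empty_or_nonempty with rfl | ⟨χ₀, hχ₀⟩
  · simp only [Finset.card_empty, Nat.cast_zero]
    positivity
  have : Nonempty (CyclicChar p Ω) := ⟨χ₀⟩
  have hpp : (1 : ℝ) ≤ (p : ℝ) ^ p := one_le_pow₀ (by exact_mod_cast hp.one_le)
  have hpp0 : (0 : ℝ) < (p : ℝ) ^ p := by linarith
  obtain ⟨hfin, hcard⟩ := hideal (p ^ p * Y) (by nlinarith)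
  have hle : ∀ χ ∈ S, (Ideal.absNorm (χ.condIdeal F) : ℝ) ≤ p ^ p * Y := by
    intro χ hχ
    have := (le_max_right _ _).trans (hS χ hχ)
    rwa [div_le_iff₀ hpp0, mul_comm] at this
  let ρ : CyclicChar p Ω → 𝓞 F := fun χ => kummerGen F χ.tuple 1
  have hρ : ∀ χ, ρ χ ≠ 0 := fun χ => χ.isProper.kummerGen_ne_zero one_ne_zero
  let rep : Ideal (𝓞 F) → CyclicChar p Ω := Function.invFun (CyclicChar.condIdeal F)
  have hrep : ∀ χ : CyclicChar p Ω, (rep (χ.condIdeal F)).condIdeal F = χ.condIdeal F := fun χ =>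
    Function.invFun_eq (f := CyclicChar.condIdeal F) ⟨χ, rfl⟩
  let f : S → {J : Ideal (𝓞 F) // (Ideal.absNorm J : ℝ) ≤ p ^ p * Y} × κ := fun χ =>
    (⟨χ.1.condIdeal F, hle χ.1 χ.2⟩, Φ (ρ χ.1 * ρ (rep (χ.1.condIdeal F)) ^ (p - 1)))
  have hord : ∀ χ : CyclicChar p Ω, ∀ Q,
      p ∣ idealOrd Q (ρ χ * ρ (rep (χ.condIdeal F)) ^ (p - 1)) := by
    intro χ Q
    rw [idealOrd_mul Q (hρ _) (pow_ne_zero _ (hρ _)), idealOrd_pow, ← ZMod.natCast_eq_zero_iff]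
    have h1 := IsTwisted.idealOrd_eq χ.isProper.isTwisted (rep (χ.condIdeal F)).isProper.isTwisted
      (hrep χ).symm Q
    push_cast
    rw [Nat.cast_sub hp.one_le]
    simp only [ρ]
    rw [h1]
    simp
  have hf : Function.Injective f := by
    intro χ χ' h
    have hJ : χ.1.condIdeal F = χ'.1.condIdeal F := congrArg Subtype.val (congrArg Prod.fst h)
    have hΦ' := congrArg Prod.snd h
    simp only [f] at hΦ'
    obtain ⟨x, y, hx, hy, hxy⟩ := hΦ _ _ (mul_ne_zero (hρ _) (pow_ne_zero _ (hρ _)))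
      (mul_ne_zero (hρ _) (pow_ne_zero _ (hρ _))) (hord _) (hord _) hΦ'
    rw [hJ, ← mul_assoc, ← mul_assoc] at hxy
    have h1 := mul_right_cancel₀ (pow_ne_zero _ (hρ _)) hxy
    exact Subtype.ext (Subtype.ext
      (eq_of_kummerGen_eq χ.1.2.1 χ'.1.2.1 χ.1.isProper χ'.1.isProper hx hy h1))
  have h1 := Nat.card_le_card_of_injective f hf
  rw [Nat.card_prod, Nat.card_eq_fintype_card, Fintype.card_coe] at h1
  calc (S.card : ℝ) ≤ (Nat.card {J : Ideal (𝓞 F) // (Ideal.absNorm J : ℝ) ≤ p ^ p * Y} : ℝ)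
        * Nat.card κ := by exact_mod_cast h1
    _ ≤ (C * (p ^ p * Y)) * Nat.card κ := by gcongr
    _ = _ := by ring

lemma pairProd_zmod (f : ZMod p → ZMod p → ℝ) :
    pairProd f = ∏ l ∈ Finset.univ.erase 0, ∏ i, f i (i + l) := by
  rw [Finset.prod_comm, pairProd]
  refine Finset.prod_congr rfl fun i _ => ?_
  refine Finset.prod_nbij' (fun j => j - i) (fun l => i + l) ?_ ?_ ?_ ?_ ?_
  · intro j hj
    simpa [sub_eq_zero] using hj
  · intro l hl
    simpa using hl
  · simp
  · simp
  · simp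

/-- The real tuples that are images of cyclic tuples under a complex embedding. -/
noncomputable def realTuples (E : Ω →+* ℂ) (χ : (Ω ≃ₐ[ℚ] Ω) → ZMod p) :
    AddSubgroup (ZMod p → ℝ) where
  carrier := {x | ∃ γ, IsCyclicTuple χ γ ∧ ∀ i, E (γ i) = x i}
  zero_mem' := ⟨0, ⟨fun _ => isIntegral_zero, fun _ _ => map_zero _⟩, fun _ => by simp⟩
  add_mem' := by
    rintro x y ⟨γ, hγ, hx⟩ ⟨δ, hδ, hy⟩
    refine ⟨γ + δ, ⟨fun i => (hγ.integral i).add (hδ.integral i), fun g i => ?_⟩, fun i => ?_⟩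
    · simp [hγ.apply_eq, hδ.apply_eq]
    · simp [hx, hy]
  neg_mem' := by
    rintro x ⟨γ, hγ, hx⟩
    refine ⟨-γ, ⟨fun i => (hγ.integral i).neg, fun g i => ?_⟩, fun i => ?_⟩
    · simp [hγ.apply_eq]
    · simp [hx]

variable (F) in
lemma CyclicChar.cond_pow_le (E : Ω →+* ℂ) (χ : CyclicChar p Ω) {x : ZMod p → ℝ}
    (hx : x ∈ realTuples E χ.1) (hne : ∃ i j, x i ≠ x j) :
    χ.cond F ^ (Fintype.card (ZMod p) - 1) ≤ pairProd fun i j => |x i - x j| := by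
  obtain ⟨γ, hγ, hEx⟩ := hx
  have hproper : IsProperCyclicTuple χ.1 γ := by
    refine ⟨hγ, ?_⟩
    obtain ⟨i, j, hij⟩ := hne
    refine ⟨i, j, fun h => hij ?_⟩
    have := congrArg E h
    rw [hEx, hEx] at this
    exact_mod_cast this
  have hpp0 : (0 : ℝ) < (p : ℝ) ^ p := pow_pos (by exact_mod_cast (Fact.out : p.Prime).pos) _
  rw [pairProd_zmod, ← Finset.card_univ, ← Finset.card_erase_of_mem (Finset.mem_univ (0 : ZMod p)),
    ← Finset.prod_const]
  refine Finset.prod_le_prod (fun _ _ => le_max_of_le_left zero_le_one) fun l hl => ?_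
  obtain ⟨n, hn0, hn, hle⟩ := hproper.exists_prod_sub_eq (F := F) χ.2.2.1 (Finset.ne_of_mem_erase hl)
  have habs : ∏ i, |x i - x (i + l)| = |(n : ℝ)| := by
    rw [← Finset.abs_prod]
    congr 1
    have := congrArg E hn
    simp only [map_intCast, map_prod, map_sub, hEx] at this
    exact_mod_cast this.symm
  rw [habs, CyclicChar.cond, CyclicChar.condIdeal,
    unitOrdIdeal_kummerGen_eq χ.isProper hproper, max_le_iff]
  constructor
  · exact_mod_cast Int.one_le_abs hn0
  · rw [div_le_iff₀ hpp0, mul_comm]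
    have : (Ideal.absNorm (unitOrdIdeal p (kummerGen F γ 1)) : ℝ) ≤ (p ^ p * n.natAbs : ℕ) :=
      Nat.cast_le.mpr hle
    simpa [Nat.cast_natAbs] using this

lemma one_le_abs_of_mem_realTuples {Ω : Type*} [Field Ω] [CharZero Ω] [IsGalois ℚ Ω] (E : Ω →+* ℂ)
    {χ : (Ω ≃ₐ[ℚ] Ω) → ZMod p} {x : ZMod p → ℝ} (hx : x ∈ realTuples E χ)
    (hconst : ∀ i j, x i = x j) (h0 : x ≠ 0) (i : ZMod p) : 1 ≤ |x i| := by
  obtain ⟨γ, hγ, hEx⟩ := hx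
  have hγc : ∀ i j, γ i = γ j := fun i j => E.injective (by rw [hEx, hEx, hconst i j])
  obtain ⟨n, hn⟩ := exists_int_of_fixed (hγ.integral i) fun g =>
    (hγ.apply_eq g i).trans (hγc _ _)
  have hxn : (n : ℝ) = x i := by
    have := congrArg E hn
    rw [hEx, map_intCast] at this
    exact_mod_cast this
  have hn0 : n ≠ 0 := by
    rintro rfl
    refine h0 (funext fun j => ?_)
    rw [hconst j i, ← hxn]
    simp
  rw [← hxn]
  exact_mod_cast Int.one_le_abs hn0

/-- The number of nonconstant real cyclic tuples of height at most `H` is `O(H ^ 2)`. -/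
theorem exists_card_realTuples_le (p : ℕ) [Fact p.Prime] (F : Type*) {Ω : Type*} [Field F]
    [NumberField F] [IsCyclotomicExtension {p} ℚ F] [Field Ω] [CharZero Ω] [Algebra F Ω]
    [IsScalarTower ℚ F Ω] [IsGalois ℚ Ω] (E : Ω →+* ℂ) : ∃ C : ℝ, 0 ≤ C ∧ ∀ H : ℝ, 1 ≤ H →
    ∀ S : Finset (CyclicChar p Ω × (ZMod p → ℝ)),
      (∀ y ∈ S, y.2 ∈ realTuples E y.1.1 ∧ (∃ i j, y.2 i ≠ y.2 j) ∧
        ∏ i, max 1 |y.2 i| ≤ H) → (S.card : ℝ) ≤ C * H ^ 2 := by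
  obtain ⟨C₁, hC₁, hcount⟩ := CyclicChar.exists_card_le p F Ω
  refine card_height_le (by rw [ZMod.card]; exact (Fact.out : p.Prime).two_le)
    (CyclicChar.cond F) (fun _ => le_max_left _ _) C₁ hC₁ hcount
    (fun χ : CyclicChar p Ω => realTuples E χ.1) ?_ ?_
  · exact fun χ x hx hne => χ.cond_pow_le F E hx hne
  · exact fun χ x hx hconst h0 i => one_le_abs_of_mem_realTuples E hx hconst h0 i

end CountingCharacters

section CyclicRoots

/-- The powers of a full cycle, indexed by residues, are additive. -/
theorem pow_val_add {p : ℕ} [NeZero p] {G : Type*} [Monoid G] {g : G} (hg : orderOf g = p)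
    (i j : ZMod p) : g ^ (i + j).val = g ^ i.val * g ^ j.val := by
  rw [ZMod.val_add, ← pow_add, ← pow_mod_orderOf g (i.val + j.val), hg]

/-- The roots of a polynomial whose Galois group is generated by a full cycle can be indexed by
residues so that the Galois group acts by translations. -/
theorem HasGaloisGroup.exists_cyclic_roots {p : ℕ} [NeZero p] {g : Equiv.Perm (Fin p)}
    (hcyc : g.IsCycle) (hsupp : g.support.card = p) {f : ℚ[X]}
    (hf : HasGaloisGroup (Subgroup.zpowers g) f) :
    ∃ s : ZMod p → f.SplittingField, Function.Injective s ∧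
      (∀ i, s i ∈ f.rootSet f.SplittingField) ∧
      (∀ φ : f.Gal, ∃ m : ZMod p, ∀ i, φ (s i) = s (i + m)) ∧
      ∃ φ : f.Gal, ∀ i, φ (s i) = s (i + 1) := by
  have : Fact ((f.map (algebraMap ℚ ℂ)).Splits) := ⟨IsAlgClosed.splits _⟩
  obtain ⟨e, he⟩ := hf
  have hord : orderOf g = p := hcyc.orderOf.trans hsupp
  have hmod : ∀ k : ℕ, g ^ (k % p) = g ^ k := fun k => by
    conv_rhs => rw [← pow_mod_orderOf, hord]
  have hfull : g.support = Finset.univ := by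
    rw [← Finset.card_eq_iff_eq_univ, hsupp, Fintype.card_fin]
  have hne : g 0 ≠ 0 := by
    rw [← Equiv.Perm.mem_support, hfull]; exact Finset.mem_univ _
  let r : Fin p → f.rootSet f.SplittingField :=
    fun x => (Polynomial.Gal.rootsEquivRoots f ℂ).symm (e.symm x)
  have hr : Function.Injective r :=
    (Polynomial.Gal.rootsEquivRoots f ℂ).symm.injective.comp e.symm.injective
  have hact : ∀ (φ : f.Gal) (σ : Equiv.Perm (Fin p)),
      permCongrHom e (Polynomial.Gal.galActionHom f ℂ φ) = σ → ∀ x, φ (r x) = r (σ x) := by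
    rintro φ σ rfl x
    have h1 : ((φ • r x : f.rootSet f.SplittingField) : f.SplittingField) = φ (r x) := rfl
    rw [← h1]
    congr 1
    simp only [r, permCongrHom, MonoidHom.coe_mk, OneHom.coe_mk, Equiv.permCongr_apply,
      Equiv.symm_apply_apply]
    change _ = (Polynomial.Gal.rootsEquivRoots f ℂ).symm (φ • e.symm x)
    rw [Polynomial.Gal.smul_def, Equiv.symm_apply_apply]
    rfl
  have hpow : ∀ (φ : f.Gal) (m : ZMod p),
      permCongrHom e (Polynomial.Gal.galActionHom f ℂ φ) = g ^ m.val →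
      ∀ i : ZMod p, φ (r ((g ^ i.val) 0)) = r ((g ^ (i + m).val) 0) := by
    intro φ m h i
    rw [hact φ _ h, add_comm i m, pow_val_add hord, Equiv.Perm.mul_apply]
  refine ⟨fun i => r ((g ^ i.val) 0), ?_, fun i => (r _).2, ?_, ?_⟩
  · intro i j hij
    have h := hr (Subtype.ext hij)
    have h2 : g ^ i.val = g ^ j.val := hcyc.pow_eq_pow_iff.2 ⟨0, hne, h⟩
    apply ZMod.val_injective
    exact pow_injOn_Iio_orderOf (by simpa [hord] using ZMod.val_lt i)
      (by simpa [hord] using ZMod.val_lt j) h2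
  · intro φ
    have hmem : permCongrHom e (Polynomial.Gal.galActionHom f ℂ φ) ∈ Subgroup.zpowers g := by
      rw [← he]
      exact Subgroup.mem_map_of_mem _ ⟨φ, rfl⟩
    rw [← mem_powers_iff_mem_zpowers] at hmem
    obtain ⟨k, hk⟩ := hmem
    refine ⟨(k : ZMod p), hpow φ _ ?_⟩
    rw [← hk, ZMod.val_natCast, hmod]
  · have hmem : g ∈ Subgroup.map (permCongrHom e) (galPermGroup f) := by
      rw [he]; exact Subgroup.mem_zpowers g
    obtain ⟨_, ⟨φ, rfl⟩, hφ⟩ := hmem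
    refine ⟨φ, hpow φ 1 (hφ.trans ?_)⟩
    have : ((1 : ℕ) : ZMod p) = 1 := Nat.cast_one
    rw [← this, ZMod.val_natCast, hmod, pow_one]

end CyclicRoots

section TuplesOfRoots

variable {p : ℕ} [Fact p.Prime] {K Ω : Type*} [Field K] [Algebra ℚ K] [Normal ℚ K] [Field Ω]
  [CharZero Ω] [IsGalois ℚ Ω]

/-- Roots in a normal extension on which the Galois group acts by translations give a proper cyclic
tuple for a surjective character. -/
theorem exists_isProperCyclicTuple (j : K →+* Ω) {s : ZMod p → K} (hinj : Function.Injective s)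
    (hintegral : ∀ i, IsIntegral ℤ (s i))
    (hact : ∀ φ : K ≃ₐ[ℚ] K, ∃ m : ZMod p, ∀ i, φ (s i) = s (i + m))
    (hshift : ∃ φ : K ≃ₐ[ℚ] K, ∀ i, φ (s i) = s (i + 1)) :
    ∃ χ : CyclicChar p Ω, IsProperCyclicTuple χ.1 (fun i => j (s i)) := by
  let _ : Algebra K Ω := j.toAlgebra
  have : IsScalarTower ℚ K Ω := IsScalarTower.of_algebraMap_eq' (Subsingleton.elim _ _)
  have hex : ∀ h : Ω ≃ₐ[ℚ] Ω, ∃ m : ZMod p, ∀ i, h (j (s i)) = j (s (i + m)) := by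
    intro h
    obtain ⟨m, hm⟩ := hact (h.restrictNormal K)
    refine ⟨m, fun i => ?_⟩
    rw [← hm i]
    exact (h.restrictNormal_commutes K (s i)).symm
  choose χ hχ using hex
  have hjs : Function.Injective fun i => j (s i) := j.injective.comp hinj
  have hadd : ∀ g h, χ (g * h) = χ g + χ h := by
    intro g h
    have h1 := hχ (g * h) 0
    rw [AlgEquiv.mul_apply, hχ, hχ] at h1
    have := hjs h1
    simpa [add_comm] using this.symm
  have hproper : IsProperCyclicTuple χ (fun i => j (s i)) :=
    { integral := fun i => (hintegral i).map j.toIntAlgHom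
      apply_eq := hχ
      nonconst := ⟨0, 1, fun h => zero_ne_one (hjs h)⟩ }
  refine ⟨⟨χ, hadd, ?_, _, hproper⟩, hproper⟩
  obtain ⟨φ, hφ⟩ := hshift
  have hone : χ (φ.liftNormal Ω) = 1 := by
    have h1 := hχ (φ.liftNormal Ω) 0
    have h2 : (φ.liftNormal Ω) (j (s 0)) = j (φ (s 0)) := φ.liftNormal_commutes Ω (s 0)
    rw [h2, hφ] at h1
    simpa using (hjs h1).symm
  have hpow : ∀ k : ℕ, χ ((φ.liftNormal Ω) ^ k) = k := by
    intro k
    induction k with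
    | zero =>
      have := hadd 1 1
      simpa using this
    | succ k ih => rw [pow_succ, hadd, ih, hone, Nat.cast_succ]
  intro m
  exact ⟨_, (hpow m.val).trans (ZMod.natCast_zmod_val m)⟩

/-- For odd `p`, the members of a cyclic tuple are real in every complex embedding. -/
theorem IsCyclicTuple.conj_eq (hp : p ≠ 2) (E : Ω →+* ℂ) {χ : CyclicChar p Ω} {γ : ZMod p → Ω}
    (hγ : IsCyclicTuple χ.1 γ) (i : ZMod p) : (starRingEnd ℂ) (E (γ i)) = E (γ i) := by
  let _ : Algebra Ω ℂ := E.toAlgebra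
  have : IsScalarTower ℚ Ω ℂ := IsScalarTower.of_algebraMap_eq' (Subsingleton.elim _ _)
  set c : Ω ≃ₐ[ℚ] Ω := (Complex.conjAe.restrictScalars ℚ).restrictNormal Ω with hc
  have hcomm : ∀ x, E (c x) = (starRingEnd ℂ) (E x) := fun x =>
    (Complex.conjAe.restrictScalars ℚ).restrictNormal_commutes Ω x
  have hcc : c * c = 1 := by
    ext x
    apply E.injective
    rw [AlgEquiv.mul_apply, hcomm, hcomm, Complex.conj_conj, AlgEquiv.one_apply]
  have hone : χ.1 1 = 0 := by
    have := χ.2.1 1 1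
    simpa using this
  have htwo : (2 : ZMod p) * χ.1 c = 0 := by
    rw [two_mul, ← χ.2.1, hcc, hone]
  have h2 : (2 : ZMod p) ≠ 0 := by
    intro h
    have h' : ((2 : ℕ) : ZMod p) = 0 := by exact_mod_cast h
    rw [ZMod.natCast_eq_zero_iff] at h'
    exact hp ((Nat.prime_dvd_prime_iff_eq Fact.out Nat.prime_two).1 h')
  have hzero : χ.1 c = 0 := (mul_eq_zero.1 htwo).resolve_left h2
  rw [← hcomm, hγ.apply_eq, hzero, add_zero]

end TuplesOfRoots

section Polynomials

theorem polyOf_sum_degree_lt {n : ℕ} (a : Fin n → ℤ) :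
    (∑ i : Fin n, C ((a i : ℚ)) * X ^ (n - 1 - (i : ℕ)) : ℚ[X]).degree < n := by
  refine lt_of_le_of_lt (degree_sum_le _ _) ?_
  rw [Finset.sup_lt_iff (by exact_mod_cast WithBot.bot_lt_coe n)]
  intro i _
  refine lt_of_le_of_lt (degree_C_mul_X_pow_le _ _) ?_
  exact_mod_cast (by omega : n - 1 - (i : ℕ) < n)

theorem polyOf_monic {n : ℕ} (a : Fin n → ℤ) : (polyOf n a).Monic :=
  monic_X_pow_add (polyOf_sum_degree_lt a)

theorem polyOf_natDegree {n : ℕ} (a : Fin n → ℤ) : (polyOf n a).natDegree = n := by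
  rw [polyOf, natDegree_add_eq_left_of_degree_lt, natDegree_X_pow]
  rw [degree_X_pow]
  exact polyOf_sum_degree_lt a

theorem polyOf_coeff {n : ℕ} (a : Fin n → ℤ) (i : Fin n) :
    (polyOf n a).coeff (n - 1 - (i : ℕ)) = a i := by
  have hi := i.2
  rw [polyOf, coeff_add, coeff_X_pow, if_neg (by omega), zero_add, finsetSum_coeff,
    Finset.sum_eq_single i]
  · simp
  · intro j _ hj
    have hj2 := j.2
    rw [coeff_C_mul_X_pow, if_neg]
    intro h
    exact hj (Fin.ext (by omega))
  · simp

theorem polyOf_injective (n : ℕ) : Function.Injective (polyOf n) := by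
  intro a b h
  funext i
  have := polyOf_coeff a i
  rw [h, polyOf_coeff] at this
  exact_mod_cast this.symm

theorem polyOf_eq_map {n : ℕ} (a : Fin n → ℤ) :
    polyOf n a = (X ^ n + ∑ i : Fin n, C (a i) * X ^ (n - 1 - (i : ℕ)) : ℤ[X]).map
      (Int.castRingHom ℚ) := by
  simp [polyOf, Polynomial.map_sum]

theorem isIntegral_of_aeval_polyOf {n : ℕ} (a : Fin n → ℤ) {K : Type*} [Field K]
    [Algebra ℚ K] {x : K} (hx : aeval x (polyOf n a) = 0) : IsIntegral ℤ x := by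
  refine ⟨X ^ n + ∑ i : Fin n, C (a i) * X ^ (n - 1 - (i : ℕ)), ?_, ?_⟩
  · have h := polyOf_monic a
    rw [polyOf_eq_map] at h
    exact Polynomial.monic_of_injective (RingHom.injective_int (Int.castRingHom ℚ)) h
  · rw [polyOf_eq_map, aeval_def, eval₂_map] at hx
    rwa [Subsingleton.elim (algebraMap ℤ K) ((algebraMap ℚ K).comp (Int.castRingHom ℚ))]

theorem polyOf_norm_coeff_le {n : ℕ} (a : Fin n → ℤ) {H : ℝ} (hH : 1 ≤ H)
    (ha : ∀ i, |(a i : ℝ)| ≤ H) (k : ℕ) : ‖((polyOf n a).map (algebraMap ℚ ℂ)).coeff k‖ ≤ H := by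
  rcases lt_trichotomy k n with hk | rfl | hk
  · have h := polyOf_coeff a ⟨n - 1 - k, by omega⟩
    rw [show n - 1 - (n - 1 - k) = k by omega] at h
    rw [coeff_map, h]
    simpa using ha ⟨n - 1 - k, by omega⟩
  · have h : (polyOf k a).coeff k = 1 := by
      have := (polyOf_monic a).coeff_natDegree
      rwa [polyOf_natDegree] at this
    rw [coeff_map, h]
    simpa using hH
  · rw [coeff_map, coeff_eq_zero_of_natDegree_lt (by rwa [polyOf_natDegree]), map_zero, norm_zero]
    linarith

/-- The Mahler measure of a polynomial is at most linear in the size of its coefficients. -/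
theorem prod_max_one_le_of_polyOf {n : ℕ} (a : Fin n → ℤ) {H : ℝ} (hH : 1 ≤ H)
    (ha : ∀ i, |(a i : ℝ)| ≤ H) {ι : Type*} [Fintype ι] {x : ι → ℝ}
    (hx : (polyOf n a).map (algebraMap ℚ ℂ) = ∏ i, (X - C (x i : ℂ))) :
    ∏ i, max 1 |x i| ≤ (n + 1) * H := by
  set P := (polyOf n a).map (algebraMap ℚ ℂ) with hP
  have hmonic : P.Monic := (polyOf_monic a).map _
  have hdeg : P.natDegree = n := by rw [hP, natDegree_map, polyOf_natDegree]
  have hroots : P.roots = Finset.univ.val.map fun i => (x i : ℂ) := by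
    rw [hx]
    simpa using roots_multiset_prod_X_sub_C (Finset.univ.val.map fun i => (x i : ℂ))
  have h1 := P.prod_max_one_norm_roots_le_mahlerMeasure_of_one_le_leadingCoeff
    (by simp [hmonic.leadingCoeff])
  have h2 := P.mahlerMeasure_le_sum_norm_coeff
  have h3 : (P.sum fun _ c => ‖c‖) ≤ (n + 1) * H := by
    rw [sum_over_range _ (by simp), hdeg]
    refine (Finset.sum_le_card_nsmul _ _ H fun k _ => polyOf_norm_coeff_le a hH ha k).trans ?_
    simp
  refine le_trans (le_of_eq ?_) (h1.trans (h2.trans h3))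
  rw [hroots, Multiset.map_map]
  exact Finset.prod_congr rfl fun i _ => by simp

end Polynomials

section CountingPolynomials

/-- A degree `p` polynomial with cyclic Galois group of odd prime order `p` splits over the reals,
with root set given by a cyclic tuple. -/
theorem HasGaloisGroup.exists_realTuple {p : ℕ} [Fact p.Prime] (hp : p ≠ 2) {Ω : Type*} [Field Ω]
    [CharZero Ω] [IsGalois ℚ Ω] [IsAlgClosed Ω] (E : Ω →+* ℂ) {g : Equiv.Perm (Fin p)}
    (hcyc : g.IsCycle) (hsupp : g.support.card = p) {a : Fin p → ℤ}
    (ha : HasGaloisGroup (Subgroup.zpowers g) (polyOf p a)) :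
    ∃ y : CyclicChar p Ω × (ZMod p → ℝ), y.2 ∈ realTuples E y.1.1 ∧ (∃ i j, y.2 i ≠ y.2 j) ∧
      (polyOf p a).map (algebraMap ℚ ℂ) = ∏ i, (X - C (y.2 i : ℂ)) := by
  obtain ⟨s, hinj, hroot, hact, hshift⟩ := ha.exists_cyclic_roots hcyc hsupp
  have hzero : ∀ i, aeval (s i) (polyOf p a) = 0 := fun i => (mem_rootSet.1 (hroot i)).2
  let j : (polyOf p a).SplittingField →+* Ω :=
    (SplittingField.lift (polyOf p a)
      (IsAlgClosed.splits ((polyOf p a).map (algebraMap ℚ Ω)))).toRingHom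
  obtain ⟨χ, hχ⟩ := exists_isProperCyclicTuple (p := p) j hinj
    (fun i => isIntegral_of_aeval_polyOf a (hzero i)) hact hshift
  have hreal : ∀ i, ((E (j (s i))).re : ℂ) = E (j (s i)) := fun i =>
    Complex.conj_eq_iff_re.1 (hχ.toIsCyclicTuple.conj_eq hp E i)
  have hEinj : Function.Injective fun i => E (j (s i)) :=
    E.injective.comp (j.injective.comp hinj)
  refine ⟨⟨χ, fun i => (E (j (s i))).re⟩, ⟨_, hχ.toIsCyclicTuple, fun i => (hreal i).symm⟩,
    ⟨0, 1, fun h => ?_⟩, ?_⟩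
  · exact zero_ne_one (α := ZMod p)
      (hEinj ((hreal 0).symm.trans ((congrArg _ h).trans (hreal 1))))
  · simp only [hreal]
    set P := (polyOf p a).map (algebraMap ℚ ℂ) with hP
    have hmonic : P.Monic := (polyOf_monic a).map _
    have hdeg : P.natDegree = p := by rw [hP, natDegree_map, polyOf_natDegree]
    have hle : (Finset.univ.val.map fun i => E (j (s i))) ≤ P.roots := by
      refine (Multiset.le_iff_subset (Finset.univ.nodup.map hEinj)).2 fun z hz => ?_
      obtain ⟨i, _, rfl⟩ := Multiset.mem_map.1 hz
      rw [mem_roots hmonic.ne_zero, IsRoot.def, hP, eval_map]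
      have h := congrArg (E.comp j) (hzero i)
      rw [aeval_def, hom_eval₂, map_zero] at h
      rwa [Subsingleton.elim (algebraMap ℚ ℂ) ((E.comp j).comp (algebraMap ℚ _))]
    have heq := Multiset.eq_of_le_of_card_le hle (by
      refine (card_roots' P).trans ?_
      simp [hdeg])
    have hprod := prod_multiset_X_sub_C_of_monic_of_roots_card_eq hmonic (by
      rw [← heq, hdeg]; simp)
    rw [← hprod, ← heq, Multiset.map_map]
    rfl

/-- An integer vector with entries bounded by `H` lies in a fixed finite box. -/
theorem setOf_forall_abs_le_subset (n : ℕ) (H : ℝ) :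
    {a : Fin n → ℤ | ∀ i, |(a i : ℝ)| ≤ H} ⊆
      (Fintype.piFinset fun _ : Fin n => Finset.Icc (-⌊H⌋) ⌊H⌋ : Finset (Fin n → ℤ)) := by
  intro a ha
  simp only [Finset.mem_coe, Fintype.mem_piFinset, Finset.mem_Icc]
  intro i
  obtain ⟨h1, h2⟩ := abs_le.1 (ha i)
  refine ⟨?_, Int.le_floor.2 h2⟩
  rw [neg_le]
  refine Int.le_floor.2 ?_
  push_cast
  linarith

theorem Ncount_eq {α : Type*} [Fintype α] {n : ℕ} (hn : Fintype.card α = n)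
    (G : Subgroup (Equiv.Perm α)) (H : ℝ) :
    Ncount G H = Set.ncard {a : Fin n → ℤ | (∀ i, |(a i : ℝ)| ≤ H) ∧
      HasGaloisGroup G (polyOf n a)} := by
  subst hn
  rfl

theorem Ncount_two_le (G : Subgroup (Equiv.Perm (Fin 2))) {H : ℝ} (hH : 2 ≤ H) :
    (Ncount G H : ℝ) ≤ 9 * H ^ 2 := by
  rw [Ncount_eq (Fintype.card_fin 2)]
  have hsub : {a : Fin 2 → ℤ | (∀ i, |(a i : ℝ)| ≤ H) ∧ HasGaloisGroup G (polyOf 2 a)} ⊆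
      (Fintype.piFinset fun _ : Fin 2 => Finset.Icc (-⌊H⌋) ⌊H⌋ : Finset (Fin 2 → ℤ)) :=
    fun a ha => setOf_forall_abs_le_subset 2 H ha.1
  have hcard := Set.ncard_le_ncard hsub (Finset.finite_toSet _)
  rw [Set.ncard_coe_finset, Fintype.card_piFinset, Finset.prod_const, Finset.card_univ,
    Fintype.card_fin, Int.card_Icc] at hcard
  have hfl : (0 : ℤ) ≤ ⌊H⌋ := Int.floor_nonneg.2 (by linarith)
  have hcast : (((⌊H⌋ + 1 - -⌊H⌋).toNat : ℤ) : ℝ) ≤ 3 * H := by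
    rw [Int.toNat_of_nonneg (by omega)]
    push_cast
    linarith [Int.floor_le H]
  calc _ ≤ (((⌊H⌋ + 1 - -⌊H⌋).toNat ^ 2 : ℕ) : ℝ) := by exact_mod_cast hcard
    _ = (((⌊H⌋ + 1 - -⌊H⌋).toNat : ℤ) : ℝ) ^ 2 := by push_cast; rfl
    _ ≤ (3 * H) ^ 2 := by gcongr
    _ = 9 * H ^ 2 := by ring

/-- The count for odd `p`, in terms of auxiliary fields. -/
theorem exists_Ncount_le {p : ℕ} [Fact p.Prime] (hp : p ≠ 2) (F : Type*) {Ω : Type*} [Field F]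
    [NumberField F] [IsCyclotomicExtension {p} ℚ F] [Field Ω] [CharZero Ω] [Algebra F Ω]
    [IsScalarTower ℚ F Ω] [IsGalois ℚ Ω] [IsAlgClosed Ω] (E : Ω →+* ℂ) {g : Equiv.Perm (Fin p)}
    (hcyc : g.IsCycle) (hsupp : g.support.card = p) :
    ∃ C : ℝ, 0 < C ∧ ∀ H : ℝ, 2 ≤ H → (Ncount (Subgroup.zpowers g) H : ℝ) ≤ C * H ^ 2 := by
  obtain ⟨C, hC0, hC⟩ := exists_card_realTuples_le p F E
  refine ⟨C * (p + 1) ^ 2 + 1, by positivity, fun H hH => ?_⟩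
  rw [Ncount_eq (Fintype.card_fin p)]
  set A := {a : Fin p → ℤ | (∀ i, |(a i : ℝ)| ≤ H) ∧
    HasGaloisGroup (Subgroup.zpowers g) (polyOf p a)} with hA
  have hfin : A.Finite := (Finset.finite_toSet _).subset
    fun a ha => setOf_forall_abs_le_subset p H ha.1
  have hex : ∀ a : A, _ := fun a => a.2.2.exists_realTuple hp E hcyc hsupp
  choose y hmem hnc hprod using hex
  have hyinj : Function.Injective y := by
    intro a b hab
    have h := hprod a
    rw [hab, ← hprod b] at h
    exact Subtype.ext (polyOf_injective p (map_injective _ (algebraMap ℚ ℂ).injective h))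
  have := hfin.fintype
  have hcard : A.ncard = (Finset.univ.image y).card := by
    rw [Finset.card_image_of_injective _ hyinj, Finset.card_univ, ← Nat.card_eq_fintype_card]
    rfl
  have hbound := hC ((p + 1) * H) (by nlinarith [(Nat.cast_nonneg p : (0 : ℝ) ≤ p)])
    (Finset.univ.image y) (by
      intro z hz
      obtain ⟨a, _, rfl⟩ := Finset.mem_image.1 hz
      exact ⟨hmem a, hnc a,
        prod_max_one_le_of_polyOf a.1 (by linarith) a.2.1 (hprod a)⟩)
  rw [hcard]
  refine hbound.trans ?_
  nlinarith [sq_nonneg H]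

end CountingPolynomials

/-- Corollary 4 of Bhargava's paper. Let `p` be a prime and `C_p ≤ S_p` the cyclic group
of order `p` generated by a `p`-cycle. Then `N_p(C_p,H) = O(H^2)`. -/
theorem cyclic_prime_count_bound (p : ℕ) (hp : p.Prime) (g : Equiv.Perm (Fin p))
    (hcyc : g.IsCycle) (hsupp : g.support.card = p) :
    ∃ C : ℝ, 0 < C ∧ ∀ H : ℝ, 2 ≤ H →
      (Ncount (Subgroup.zpowers g) H : ℝ) ≤ C * H ^ 2 := by
  have : Fact p.Prime := ⟨hp⟩
  rcases eq_or_ne p 2 with rfl | h2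
  · exact ⟨9, by norm_num, fun H hH => Ncount_two_le _ hH⟩
  have hcyclo : IsCyclotomicExtension {p} ℚ (CyclotomicField p ℚ) := by
    convert CyclotomicField.isCyclotomicExtension p ℚ
    · rfl
    · exact Subsingleton.elim _ _
  have hscalar : IsScalarTower ℚ (CyclotomicField p ℚ) (AlgebraicClosure (CyclotomicField p ℚ)) :=
    IsScalarTower.of_algebraMap_eq' (Subsingleton.elim _ _)
  have halg : Algebra.IsAlgebraic ℚ (AlgebraicClosure (CyclotomicField p ℚ)) :=
    Algebra.IsAlgebraic.trans ℚ (CyclotomicField p ℚ) _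
  have hnormal : Normal ℚ (AlgebraicClosure (CyclotomicField p ℚ)) :=
    normal_iff.2 fun x => ⟨Algebra.IsIntegral.isIntegral x, IsAlgClosed.splits _⟩
  have hgal : IsGalois ℚ (AlgebraicClosure (CyclotomicField p ℚ)) := ⟨⟩
  exact exists_Ncount_le h2 (CyclotomicField p ℚ)
    (IsAlgClosed.lift (M := ℂ) : AlgebraicClosure (CyclotomicField p ℚ) →ₐ[ℚ] ℂ).toRingHom
    hcyc hsupp
end

section
/- Let k ≥ 2, let G_i ⊆ S_{n_i} be transitive permutation groups for i = 1,...,k, set n = n_1 + ... + n_k, and let G = G_1 × ... × G_k ⊆ S_n act on the disjoint union of the corresponding sets of letters. Suppose that for each i there are constants A_i > 0, α_i > 0, β_i ≥ 0 with N_{n_i}(G_i,H) ≤ A_i · H^{α_i} (log H)^{β_i} for all H ≥ 2. Let α = max{α_1,...,α_k} and s = Σ_{i : α_i = α} (1 + β_i). Then N_n(G_1 × ... × G_k, H) = O(H^α (log H)^{s-1}) for all H ≥ 2, with implied constant depending on n, the groups, and the A_i, α_i, β_i. -/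
open scoped Classical
open Polynomial

namespace Polynomial

variable {F E : Type*} [Field F] [Field E] [Algebra F E]

variable (F E) in
/-- The group of automorphisms over `F` of the algebraic closure of `F` in `E`. -/
abbrev closureGal : Type _ := Gal(algebraicClosure F E/F)

/-- A root in `E` of a polynomial over `F`, as an element of the algebraic closure of `F` in `E`. -/
noncomputable def rootToClosure {f : F[X]} (x : f.rootSet E) : algebraicClosure F E :=
  ⟨x, mem_algebraicClosure_iff.2 ⟨f, (mem_rootSet.1 x.2).1, (mem_rootSet.1 x.2).2⟩⟩

theorem rootToClosure_injective {f : F[X]} :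
    Function.Injective (rootToClosure : f.rootSet E → algebraicClosure F E) :=
  fun _ _ h => Subtype.ext (congrArg (Subtype.val : algebraicClosure F E → E) h)

theorem aeval_coe_algebraicClosure_eq_zero_iff {f : F[X]} (x : algebraicClosure F E) :
    aeval (x : E) f = 0 ↔ aeval x f = 0 := by
  rw [← (algebraMap (algebraicClosure F E) E).injective.eq_iff, map_zero,
    ← aeval_algebraMap_apply]
  rfl

/-- Every automorphism of the algebraic closure permutes the roots of `f`. -/
theorem exists_perm_rootSet (f : F[X]) (φ : closureGal F E) :
    ∃ π : Equiv.Perm (f.rootSet E), ∀ x, rootToClosure (π x) = φ (rootToClosure x) := by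
  have hmem : ∀ (ψ : closureGal F E) (x : f.rootSet E),
      ((ψ (rootToClosure x) : algebraicClosure F E) : E) ∈ f.rootSet E := by
    intro ψ x
    have h := mem_rootSet.1 x.2
    have h2 : aeval (rootToClosure x) f = 0 :=
      (aeval_coe_algebraicClosure_eq_zero_iff (rootToClosure x)).1 h.2
    refine mem_rootSet.2 ⟨h.1, (aeval_coe_algebraicClosure_eq_zero_iff _).2 ?_⟩
    exact (aeval_algHom_apply ψ.toAlgHom (rootToClosure x) f).trans (by rw [h2, map_zero])
  exact ⟨{  toFun := fun x => ⟨_, hmem φ x⟩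
            invFun := fun x => ⟨_, hmem φ.symm x⟩
            left_inv := fun x => rootToClosure_injective (φ.symm_apply_apply (rootToClosure x))
            right_inv := fun x => rootToClosure_injective (φ.apply_symm_apply (rootToClosure x)) },
    fun x => rfl⟩

variable [IsAlgClosed E]

/-- The permutations of the roots of `f` in its Galois group are those induced by
automorphisms of the algebraic closure. -/
theorem mem_range_galActionHom_iff {f : F[X]} [Fact ((f.map (algebraMap F E)).Splits)]
    {π : Equiv.Perm (f.rootSet E)} :
    π ∈ (Gal.galActionHom f E).range ↔ ∃ φ : closureGal F E,
      ∀ x, rootToClosure (π x) = φ (rootToClosure x) := by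
  have : Normal F (algebraicClosure F E) := IsAlgClosure.normal F _
  let ι : f.SplittingField →ₐ[F] algebraicClosure F E :=
    (IsScalarTower.toAlgHom F f.SplittingField E).codRestrict
      (algebraicClosure F E).toSubalgebra fun x =>
        (Algebra.IsIntegral.isIntegral (R := F) x).map _
  let : Algebra f.SplittingField (algebraicClosure F E) := ι.toRingHom.toAlgebra
  have : IsScalarTower F f.SplittingField (algebraicClosure F E) :=
    IsScalarTower.of_algebraMap_eq fun x => (ι.commutes x).symm
  have key : ∀ y : f.rootSet f.SplittingField,
      rootToClosure (Gal.rootsEquivRoots f E y) =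
        algebraMap f.SplittingField (algebraicClosure F E) y := fun y => rfl
  have hact : ∀ (σ : Gal(f.SplittingField/F)) (y : f.rootSet f.SplittingField),
      rootToClosure (Gal.galActionHom f E σ (Gal.rootsEquivRoots f E y)) =
        algebraMap f.SplittingField (algebraicClosure F E) (σ (y : f.SplittingField)) := by
    intro σ y
    change rootToClosure (Gal.rootsEquivRoots f E (Gal.galActionAux f |>.smul σ
      ((Gal.rootsEquivRoots f E).symm (Gal.rootsEquivRoots f E y)))) = _
    rw [Equiv.symm_apply_apply, key]
    rfl
  constructor
  · rintro ⟨σ, rfl⟩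
    refine ⟨AlgEquiv.liftNormal (show Gal(f.SplittingField/F) from σ) (algebraicClosure F E),
      fun x => ?_⟩
    obtain ⟨y, rfl⟩ := (Gal.rootsEquivRoots f E).surjective x
    rw [key, AlgEquiv.liftNormal_commutes]
    exact hact σ y
  · rintro ⟨φ, hφ⟩
    refine ⟨φ.restrictNormal f.SplittingField, Equiv.ext fun x => rootToClosure_injective ?_⟩
    obtain ⟨y, rfl⟩ := (Gal.rootsEquivRoots f E).surjective x
    rw [hφ, key]
    exact (hact _ y).trans (AlgEquiv.restrictNormal_commutes φ f.SplittingField y)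

/-- Two roots have the same minimal polynomial exactly when they are conjugate. -/
theorem aeval_minpoly_eq_zero_iff_exists_algEquiv {x y : algebraicClosure F E} :
    aeval (y : E) (minpoly F (x : E)) = 0 ↔ ∃ φ : closureGal F E, φ x = y := by
  have : Normal F (algebraicClosure F E) := IsAlgClosure.normal F _
  have hm : minpoly F (x : E) = minpoly F x :=
    minpoly.algebraMap_eq (algebraMap (algebraicClosure F E) E).injective x
  rw [aeval_coe_algebraicClosure_eq_zero_iff, hm]
  constructor
  · exact fun h => minpoly.exists_algEquiv_of_root' (Algebra.IsAlgebraic.isAlgebraic x) h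
  · rintro ⟨φ, rfl⟩
    exact (aeval_algHom_apply φ.toAlgHom x _).trans (by rw [minpoly.aeval, map_zero])

end Polynomial

theorem mem_galPermGroup_iff {f : ℚ[X]} {π : Equiv.Perm (f.rootSet ℂ)} :
    π ∈ galPermGroup f ↔ ∃ φ : closureGal ℚ ℂ,
      ∀ x, rootToClosure (π x) = φ (rootToClosure x) :=
  have : Fact ((f.map (algebraMap ℚ ℂ)).Splits) := ⟨IsAlgClosed.splits _⟩
  mem_range_galActionHom_iff

section Factorization

variable {ι : Type*} {Ω : ι → Type*} {G : ∀ i, Subgroup (Equiv.Perm (Ω i))}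

theorem HasGaloisGroup.exists_roots {f : ℚ[X]}
    (h : HasGaloisGroup (Subgroup.map (Equiv.Perm.sigmaCongrRightHom Ω)
      (Subgroup.pi Set.univ G)) f) :
    ∃ r : (Σ i, Ω i) → algebraicClosure ℚ ℂ, Function.Injective r ∧
      (∀ p, aeval (r p : ℂ) f = 0) ∧
      (∀ φ : closureGal ℚ ℂ, ∃ τ : ∀ i, Equiv.Perm (Ω i),
        (∀ i, τ i ∈ G i) ∧ ∀ i w, φ (r ⟨i, w⟩) = r ⟨i, τ i w⟩) ∧
      (∀ τ : ∀ i, Equiv.Perm (Ω i), (∀ i, τ i ∈ G i) →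
        ∃ φ : closureGal ℚ ℂ, ∀ i w, φ (r ⟨i, w⟩) = r ⟨i, τ i w⟩) := by
  obtain ⟨e, he⟩ := h
  refine ⟨fun p => rootToClosure (e.symm p), rootToClosure_injective.comp e.symm.injective,
    fun p => (mem_rootSet.1 (e.symm p).2).2, fun φ => ?_, fun τ hτ => ?_⟩
  · obtain ⟨π, hπ⟩ := exists_perm_rootSet f φ
    have hmem : permCongrHom e π ∈ Subgroup.map (Equiv.Perm.sigmaCongrRightHom Ω)
        (Subgroup.pi Set.univ G) :=
      he ▸ Subgroup.mem_map_of_mem _ (mem_galPermGroup_iff.2 ⟨φ, hπ⟩)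
    obtain ⟨τ, hτ, hτπ⟩ := hmem
    refine ⟨τ, fun i => hτ i (Set.mem_univ i), fun i w => ?_⟩
    have h1 : (⟨i, τ i w⟩ : Σ i, Ω i) = e (π (e.symm ⟨i, w⟩)) :=
      DFunLike.congr_fun hτπ ⟨i, w⟩
    simp only [h1, Equiv.symm_apply_apply]
    exact (hπ _).symm
  · have hmem : Equiv.Perm.sigmaCongrRightHom Ω τ ∈
        Subgroup.map (permCongrHom e) (galPermGroup f) :=
      he ▸ Subgroup.mem_map_of_mem _ fun i _ => hτ i
    obtain ⟨π, hπ, hτπ⟩ := hmem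
    obtain ⟨φ, hφ⟩ := mem_galPermGroup_iff.1 hπ
    refine ⟨φ, fun i w => ?_⟩
    have h1 : e (π (e.symm ⟨i, w⟩)) = (⟨i, τ i w⟩ : Σ i, Ω i) :=
      DFunLike.congr_fun hτπ ⟨i, w⟩
    simp only [← h1, Equiv.symm_apply_apply]
    exact (hφ _).symm

theorem mem_rootSet_minpoly_iff {Γ : Type*} {G : Subgroup (Equiv.Perm Γ)}
    [MulAction.IsPretransitive G Γ] {r : Γ → algebraicClosure ℚ ℂ}
    (h₁ : ∀ φ : closureGal ℚ ℂ, ∃ τ ∈ G, ∀ w, φ (r w) = r (τ w))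
    (h₂ : ∀ τ ∈ G, ∃ φ : closureGal ℚ ℂ, ∀ w, φ (r w) = r (τ w))
    (w : Γ) (z : ℂ) :
    z ∈ (minpoly ℚ (r w : ℂ)).rootSet ℂ ↔ ∃ v, (r v : ℂ) = z := by
  have hint : IsIntegral ℚ (r w : ℂ) := mem_algebraicClosure_iff'.1 (r w).2
  rw [mem_rootSet, and_iff_right (minpoly.ne_zero hint)]
  constructor
  · intro hz
    have hz' : IsAlgebraic ℚ z := ⟨_, minpoly.ne_zero hint, hz⟩
    obtain ⟨φ, hφ⟩ := (aeval_minpoly_eq_zero_iff_exists_algEquiv (x := r w)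
      (y := ⟨z, mem_algebraicClosure_iff.2 hz'⟩)).1 hz
    obtain ⟨τ, -, hτ⟩ := h₁ φ
    exact ⟨τ w, by rw [← hτ, hφ]⟩
  · rintro ⟨v, rfl⟩
    obtain ⟨τ, rfl⟩ := MulAction.exists_smul_eq G w v
    obtain ⟨φ, hφ⟩ := h₂ τ τ.2
    exact aeval_minpoly_eq_zero_iff_exists_algEquiv.2 ⟨φ, hφ w⟩

/-- A family of algebraic numbers on which the absolute Galois group acts through the transitive
group `G` consists of the roots of a polynomial with Galois group `G`. -/
theorem hasGaloisGroup_minpoly {Γ : Type*} {G : Subgroup (Equiv.Perm Γ)}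
    [MulAction.IsPretransitive G Γ] {r : Γ → algebraicClosure ℚ ℂ} (hr : Function.Injective r)
    (h₁ : ∀ φ : closureGal ℚ ℂ, ∃ τ ∈ G, ∀ w, φ (r w) = r (τ w))
    (h₂ : ∀ τ ∈ G, ∃ φ : closureGal ℚ ℂ, ∀ w, φ (r w) = r (τ w)) (w : Γ) :
    HasGaloisGroup G (minpoly ℚ (r w : ℂ)) := by
  have hroot := mem_rootSet_minpoly_iff h₁ h₂ w
  let e : Γ ≃ (minpoly ℚ (r w : ℂ)).rootSet ℂ := Equiv.ofBijective
    (fun v => ⟨r v, (hroot _).2 ⟨v, rfl⟩⟩)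
    ⟨fun u v huv => hr (Subtype.ext (congrArg
      (Subtype.val : (minpoly ℚ (r w : ℂ)).rootSet ℂ → ℂ) huv)),
      fun z => ((hroot z).1 z.2).imp fun v hv => Subtype.ext hv⟩
  have he : ∀ v, rootToClosure (e v) = r v := fun v => rfl
  refine ⟨e.symm, Subgroup.ext fun τ => ⟨?_, fun hτ => ?_⟩⟩
  · rintro ⟨π, hπ, rfl⟩
    obtain ⟨φ, hφ⟩ := mem_galPermGroup_iff.1 hπ
    obtain ⟨τ, hτ, hτφ⟩ := h₁ φ
    convert hτ
    refine Equiv.ext fun v => hr ?_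
    change r (e.symm (π (e v))) = _
    rw [← he, Equiv.apply_symm_apply, hφ, he, hτφ]
  · obtain ⟨φ, hφ⟩ := h₂ τ hτ
    refine ⟨e.permCongr τ, mem_galPermGroup_iff.2 ⟨φ, fun x => ?_⟩, ?_⟩
    · obtain ⟨v, rfl⟩ := e.surjective x
      simp [he, hφ]
    · exact Equiv.ext fun v => by simp [permCongrHom]

theorem card_eq_natDegree_of_hasGaloisGroup {Γ : Type*} [Fintype Γ] {G : Subgroup (Equiv.Perm Γ)}
    {f : ℚ[X]} (hf : Irreducible f) (h : HasGaloisGroup G f) : Fintype.card Γ = f.natDegree := by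
  obtain ⟨e, -⟩ := h
  rw [← Fintype.card_congr e]
  exact card_rootSet_eq_natDegree hf.separable (IsAlgClosed.splits _)

/-- A monic integral polynomial whose Galois group is a product of transitive groups, acting on the
disjoint union, is the product of monic integral polynomials with these Galois groups. -/
theorem HasGaloisGroup.exists_factorization [Fintype ι] [∀ i, Fintype (Ω i)]
    [∀ i, Nonempty (Ω i)] (hG : ∀ i, MulAction.IsPretransitive (G i) (Ω i))
    {f : ℤ[X]} (hf : f.Monic) (hdeg : f.natDegree = Fintype.card (Σ i, Ω i))
    (h : HasGaloisGroup (Subgroup.map (Equiv.Perm.sigmaCongrRightHom Ω)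
      (Subgroup.pi Set.univ G)) (f.map (Int.castRingHom ℚ))) :
    ∃ g : ι → ℤ[X], (∀ i, (g i).Monic) ∧ (∀ i, (g i).natDegree = Fintype.card (Ω i)) ∧
      (∀ i, HasGaloisGroup (G i) ((g i).map (Int.castRingHom ℚ))) ∧ ∏ i, g i = f := by
  obtain ⟨r, hr, hroot, h₁, h₂⟩ := h.exists_roots
  let w : ∀ i, Ω i := fun i => Classical.arbitrary _
  have hinj : ∀ i, Function.Injective fun v => r ⟨i, v⟩ :=
    fun i u v huv => by simpa using hr huv
  have h₁' : ∀ i, ∀ φ : closureGal ℚ ℂ, ∃ τ ∈ G i,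
      ∀ v, φ (r ⟨i, v⟩) = r ⟨i, τ v⟩ := fun i φ => by
    obtain ⟨τ, hτ, hφ⟩ := h₁ φ
    exact ⟨τ i, hτ i, hφ i⟩
  have h₂' : ∀ i, ∀ τ ∈ G i, ∃ φ : closureGal ℚ ℂ,
      ∀ v, φ (r ⟨i, v⟩) = r ⟨i, τ v⟩ := fun i τ hτ => by
    obtain ⟨φ, hφ⟩ := h₂ (Function.update 1 i τ) (by
      intro j
      rcases eq_or_ne j i with rfl | hj
      · simpa using hτ
      · simp [hj, one_mem])
    exact ⟨φ, fun v => by simpa using hφ i v⟩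
  have hrootZ : ∀ p, aeval (r p : ℂ) f = 0 := fun p => by
    have := hroot p
    rwa [← algebraMap_int_eq, aeval_map_algebraMap] at this
  have hintZ : ∀ p, IsIntegral ℤ (r p : ℂ) := fun p => ⟨f, hf, hrootZ p⟩
  have hintQ : ∀ p, IsIntegral ℚ (r p : ℂ) := fun p => mem_algebraicClosure_iff'.1 (r p).2
  have hmin : ∀ p, (minpoly ℤ (r p : ℂ)).map (Int.castRingHom ℚ) = minpoly ℚ (r p : ℂ) :=
    fun p => (minpoly.isIntegrallyClosed_eq_field_fractions' ℚ (hintZ p)).symm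
  have hgal : ∀ i, HasGaloisGroup (G i) (minpoly ℚ (r ⟨i, w i⟩ : ℂ)) := fun i =>
    hasGaloisGroup_minpoly (r := fun v => r ⟨i, v⟩) (hinj i) (h₁' i) (h₂' i) (w i)
  have hcard : ∀ i, (minpoly ℤ (r ⟨i, w i⟩ : ℂ)).natDegree = Fintype.card (Ω i) := fun i => by
    rw [card_eq_natDegree_of_hasGaloisGroup (minpoly.irreducible (hintQ _)) (hgal i), ← hmin,
      natDegree_map_eq_of_injective (Int.castRingHom ℚ).injective_int]
  have hmonic : ∀ i, (minpoly ℤ (r ⟨i, w i⟩ : ℂ)).Monic := fun i => minpoly.monic (hintZ _)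
  refine ⟨fun i => minpoly ℤ (r ⟨i, w i⟩ : ℂ), hmonic, hcard, fun i => ?_, ?_⟩
  · rw [hmin]
    exact hgal i
  · refine map_injective _ (Int.castRingHom ℚ).injective_int ?_
    rw [Polynomial.map_prod]
    simp only [hmin]
    have hdvd : ∏ i, minpoly ℚ (r ⟨i, w i⟩ : ℂ) ∣ f.map (Int.castRingHom ℚ) := by
      refine Finset.prod_dvd_of_coprime (fun i _ j _ hij => ?_) fun i _ => minpoly.dvd ℚ _ (hroot _)
      refine (minpoly.irreducible (hintQ _)).isCoprime_or_dvd _ |>.resolve_right fun hdvd => hij ?_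
      have hz : aeval (r ⟨j, w j⟩ : ℂ) (minpoly ℚ (r ⟨i, w i⟩ : ℂ)) = 0 := by
        have heq := eq_of_monic_of_associated (minpoly.monic (hintQ _)) (minpoly.monic (hintQ _))
          ((minpoly.irreducible (hintQ _)).associated_of_dvd (minpoly.irreducible (hintQ _)) hdvd)
        rw [heq, minpoly.aeval]
      obtain ⟨φ, hφ⟩ := aeval_minpoly_eq_zero_iff_exists_algEquiv.1 hz
      obtain ⟨τ, -, hτ⟩ := h₁' i φ
      exact congrArg Sigma.fst (hr ((hτ _).symm.trans hφ))
    have hle : (f.map (Int.castRingHom ℚ)).natDegree ≤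
        (∏ i, minpoly ℚ (r ⟨i, w i⟩ : ℂ)).natDegree := by
      rw [natDegree_prod_of_monic _ _ fun i _ => minpoly.monic (hintQ _),
        natDegree_map_eq_of_injective (Int.castRingHom ℚ).injective_int, hdeg, Fintype.card_sigma]
      refine (Finset.sum_congr rfl fun i _ => ?_).le
      rw [← hcard i, ← hmin, natDegree_map_eq_of_injective (Int.castRingHom ℚ).injective_int]
    exact (eq_of_monic_of_dvd_of_natDegree_le
      (monic_prod_of_monic _ _ fun i _ => minpoly.monic (hintQ _)) (hf.map _) hdvd hle).symm

end Factorization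

section Height

/-- The monic integer polynomial with prescribed lower coefficients. -/
noncomputable def intPolyOf (m : ℕ) (a : Fin m → ℤ) : ℤ[X] :=
  X ^ m + ∑ i : Fin m, C (a i) * X ^ (m - 1 - (i : ℕ))

theorem map_intPolyOf (m : ℕ) (a : Fin m → ℤ) :
    (intPolyOf m a).map (Int.castRingHom ℚ) = polyOf m a := by
  simp [intPolyOf, polyOf, Polynomial.map_sum]

theorem degree_sum_intPolyOf_lt (m : ℕ) (a : Fin m → ℤ) :
    (∑ i : Fin m, C (a i) * X ^ (m - 1 - (i : ℕ))).degree < (m : WithBot ℕ) := by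
  refine (degree_sum_le _ _).trans_lt ((Finset.sup_lt_iff (WithBot.bot_lt_coe m)).2 fun i _ => ?_)
  refine (degree_C_mul_X_pow_le _ _).trans_lt ?_
  have := i.2
  exact WithBot.coe_lt_coe.2 (by omega : m - 1 - (i : ℕ) < m)

theorem monic_intPolyOf (m : ℕ) (a : Fin m → ℤ) : (intPolyOf m a).Monic :=
  monic_X_pow_add (degree_sum_intPolyOf_lt m a)

theorem natDegree_intPolyOf (m : ℕ) (a : Fin m → ℤ) : (intPolyOf m a).natDegree = m :=
  natDegree_eq_of_degree_eq_some ((degree_add_eq_left_of_degree_lt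
    ((degree_sum_intPolyOf_lt m a).trans_eq (degree_X_pow m).symm)).trans (degree_X_pow m))

theorem coeff_intPolyOf {m : ℕ} (a : Fin m → ℤ) (i : Fin m) :
    (intPolyOf m a).coeff (m - 1 - i) = a i := by
  have hi := i.2
  have h : ∀ j : Fin m, m - 1 - (i : ℕ) = m - 1 - (j : ℕ) ↔ i = j := fun j => by
    have := j.2
    rw [Fin.ext_iff]
    omega
  simp [intPolyOf, coeff_X_pow, h, show m - 1 - (i : ℕ) ≠ m by omega]

theorem intPolyOf_coeff {m : ℕ} {g : ℤ[X]} (hg : g.Monic) (hm : g.natDegree = m) :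
    intPolyOf m (fun i => g.coeff (m - 1 - i)) = g := by
  refine Polynomial.ext fun j => ?_
  rcases lt_trichotomy j m with hj | rfl | hj
  · have := coeff_intPolyOf (fun i : Fin m => g.coeff (m - 1 - i)) ⟨m - 1 - j, by omega⟩
    simpa only [show m - 1 - (m - 1 - j) = j by omega] using this
  · have h := (monic_intPolyOf j fun i => g.coeff (j - 1 - i)).coeff_natDegree
    rw [natDegree_intPolyOf] at h
    rw [h, ← hm, hg.coeff_natDegree]
  · rw [coeff_eq_zero_of_natDegree_lt (by rwa [natDegree_intPolyOf]),
      coeff_eq_zero_of_natDegree_lt (by rwa [hm])]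

theorem intPolyOf_injective (m : ℕ) : Function.Injective (intPolyOf m) := fun a b h =>
  funext fun i => by rw [← coeff_intPolyOf a i, h, coeff_intPolyOf]

/-- The Mahler measure of an integer polynomial. -/
noncomputable def intMahler (g : ℤ[X]) : ℝ := (g.map (Int.castRingHom ℂ)).mahlerMeasure

theorem one_le_intMahler {g : ℤ[X]} (hg : g.Monic) : 1 ≤ intMahler g :=
  one_le_mahlerMeasure_of_one_le_norm_leadingCoeff (by simp [(hg.map _).leadingCoeff])

theorem intMahler_prod {ι : Type*} (s : Finset ι) (g : ι → ℤ[X]) :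
    intMahler (∏ i ∈ s, g i) = ∏ i ∈ s, intMahler (g i) := by
  rw [intMahler, Polynomial.map_prod, Finset.prod, prod_mahlerMeasure_eq_mahlerMeasure_prod,
    Multiset.map_map]
  rfl

theorem abs_coeff_le_two_pow_mul_intMahler (g : ℤ[X]) (j : ℕ) :
    |((g.coeff j : ℤ) : ℝ)| ≤ 2 ^ g.natDegree * intMahler g := by
  have h := norm_coeff_le_choose_mul_mahlerMeasure j (g.map (Int.castRingHom ℂ))
  rw [natDegree_map_eq_of_injective (Int.castRingHom ℂ).injective_int, coeff_map, eq_intCast,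
    Complex.norm_intCast] at h
  refine h.trans (mul_le_mul_of_nonneg_right ?_ (mahlerMeasure_nonneg _))
  exact_mod_cast Nat.choose_le_two_pow _ _

theorem intMahler_intPolyOf_le {m : ℕ} {a : Fin m → ℤ} {H : ℝ} (hH : 1 ≤ H)
    (ha : ∀ i, |(a i : ℝ)| ≤ H) : intMahler (intPolyOf m a) ≤ (m + 1) * H := by
  refine (mahlerMeasure_le_sum_norm_coeff _).trans ?_
  rw [sum_over_range _ fun _ => norm_zero,
    natDegree_map_eq_of_injective (Int.castRingHom ℂ).injective_int, natDegree_intPolyOf]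
  refine (Finset.sum_le_card_nsmul _ _ H fun j hj => ?_).trans (by simp)
  rw [coeff_map, eq_intCast, Complex.norm_intCast]
  rcases (Nat.lt_succ_iff.1 (Finset.mem_range.1 hj)).lt_or_eq with hj | rfl
  · have := coeff_intPolyOf a ⟨m - 1 - j, by omega⟩
    simp only [show m - 1 - (m - 1 - j) = j by omega] at this
    rw [this]
    exact ha _
  · have h := (monic_intPolyOf j a).coeff_natDegree
    rw [natDegree_intPolyOf] at h
    simpa [h] using hH

end Height

section Counting

theorem finite_galoisCoeffs {Ω : Type*} [Fintype Ω] (G : Subgroup (Equiv.Perm Ω)) (H : ℝ) :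
    {a : Fin (Fintype.card Ω) → ℤ |
      (∀ i, |(a i : ℝ)| ≤ H) ∧ HasGaloisGroup G (polyOf (Fintype.card Ω) a)}.Finite := by
  refine (Set.Finite.pi' fun _ => Set.finite_Icc (-⌊H⌋) ⌊H⌋).subset fun a ha i => ?_
  have := abs_le.1 (ha.1 i)
  refine ⟨?_, Int.le_floor.2 this.2⟩
  rw [neg_le]
  exact Int.le_floor.2 (by push_cast; linarith)

variable {ι : Type*} [Fintype ι] {Ω : ι → Type*} [∀ i, Fintype (Ω i)] [∀ i, Nonempty (Ω i)]
  {G : ∀ i, Subgroup (Equiv.Perm (Ω i))}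

/-- The factors of a polynomial counted for the product group lie in dyadic boxes for the Mahler
measure, whose sizes multiply to at most a constant times the height. -/
theorem exists_dyadic_factors (hG : ∀ i, MulAction.IsPretransitive (G i) (Ω i)) {H : ℝ}
    (hH : 1 ≤ H) {a : Fin (Fintype.card (Σ i, Ω i)) → ℤ} (ha : ∀ i, |(a i : ℝ)| ≤ H)
    (h : HasGaloisGroup (Subgroup.map (Equiv.Perm.sigmaCongrRightHom Ω)
      (Subgroup.pi Set.univ G)) (polyOf _ a)) :
    ∃ b : ∀ i, Fin (Fintype.card (Ω i)) → ℤ, ∃ t : ι → ℕ,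
      ∏ i, intPolyOf _ (b i) = intPolyOf _ a ∧
      ∑ i, t i ≤ Nat.log 2 ⌊((Fintype.card (Σ i, Ω i) : ℝ) + 1) * H⌋₊ ∧
      ∀ i, (∀ j, |(b i j : ℝ)| ≤ 2 ^ (Fintype.card (Σ i, Ω i) + 1 + t i)) ∧
        HasGaloisGroup (G i) (polyOf _ (b i)) := by
  rw [← map_intPolyOf] at h
  obtain ⟨g, hmonic, hdeg, hgal, hprod⟩ :=
    h.exists_factorization hG (monic_intPolyOf _ a) (natDegree_intPolyOf _ a)
  have hg : ∀ i, intPolyOf (Fintype.card (Ω i)) (fun j => (g i).coeff (Fintype.card (Ω i) - 1 - j))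
      = g i := fun i => intPolyOf_coeff (hmonic i) (hdeg i)
  have hfloor : ∀ i, ⌊intMahler (g i)⌋₊ ≠ 0 := fun i =>
    (Nat.floor_pos.2 (one_le_intMahler (hmonic i))).ne'
  refine ⟨fun i j => (g i).coeff (Fintype.card (Ω i) - 1 - j),
    fun i => Nat.log 2 ⌊intMahler (g i)⌋₊, ?_, ?_, fun i => ⟨fun j => ?_, ?_⟩⟩
  · simp only [hg, hprod]
  · refine Nat.le_log_of_pow_le one_lt_two (Nat.le_floor ?_)
    rw [← Finset.prod_pow_eq_pow_sum]
    push_cast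
    refine le_trans ?_ (intMahler_intPolyOf_le hH ha)
    rw [← hprod, intMahler_prod]
    refine Finset.prod_le_prod (fun i _ => by positivity) fun i _ => ?_
    refine le_trans ?_ (Nat.floor_le (zero_le_one.trans (one_le_intMahler (hmonic i))))
    exact_mod_cast Nat.pow_log_le_self 2 (hfloor i)
  · refine (abs_coeff_le_two_pow_mul_intMahler _ _).trans ?_
    rw [add_assoc, pow_add]
    refine mul_le_mul ?_ ?_ (zero_le_one.trans (one_le_intMahler (hmonic i))) (by positivity)
    · refine pow_le_pow_right₀ one_le_two ?_
      rw [hdeg, Fintype.card_sigma]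
      exact Finset.single_le_sum (f := fun i => Fintype.card (Ω i)) (fun _ _ => Nat.zero_le _)
        (Finset.mem_univ i)
    · have h1 := Nat.lt_pow_succ_log_self one_lt_two ⌊intMahler (g i)⌋₊
      have h2 := (Nat.lt_floor_add_one (intMahler (g i))).le
      refine h2.trans ?_
      rw [add_comm 1]
      exact_mod_cast h1
  · rw [← map_intPolyOf, hg]
    exact hgal i

theorem Ncount_sigma_le_sum [DecidableEq ι]
    (hG : ∀ i, MulAction.IsPretransitive (G i) (Ω i)) {H : ℝ} (hH : 1 ≤ H)
    {T : ℕ} (hT : T = Nat.log 2 ⌊((Fintype.card (Σ i, Ω i) : ℝ) + 1) * H⌋₊) :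
    Ncount (Subgroup.map (Equiv.Perm.sigmaCongrRightHom Ω) (Subgroup.pi Set.univ G)) H ≤
      ∑ t ∈ Fintype.piFinset (fun _ : ι => Finset.range (T + 1)) with ∑ i, t i ≤ T,
        ∏ i, Ncount (G i) (2 ^ (Fintype.card (Σ i, Ω i) + 1 + t i)) := by
  subst hT
  set T := Nat.log 2 ⌊((Fintype.card (Σ i, Ω i) : ℝ) + 1) * H⌋₊
  let B : (ι → ℕ) → Finset (∀ i, Fin (Fintype.card (Ω i)) → ℤ) := fun t =>
    Fintype.piFinset fun i =>
      (finite_galoisCoeffs (G i) (2 ^ (Fintype.card (Σ i, Ω i) + 1 + t i))).toFinset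
  have hB : ∀ t, (B t).card =
      ∏ i, Ncount (G i) (2 ^ (Fintype.card (Σ i, Ω i) + 1 + t i)) := fun t => by
    rw [Fintype.card_piFinset]
    exact Finset.prod_congr rfl fun i _ => (Set.ncard_eq_toFinset_card _ _).symm
  simp only [← hB]
  refine le_trans ?_ Finset.card_biUnion_le
  rw [Ncount, Set.ncard_eq_toFinset_card _ (finite_galoisCoeffs _ H)]
  have key := fun (a : Fin (Fintype.card (Σ i, Ω i)) → ℤ) (ha : a ∈ (finite_galoisCoeffs
    (Subgroup.map (Equiv.Perm.sigmaCongrRightHom Ω) (Subgroup.pi Set.univ G)) H).toFinset) =>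
      exists_dyadic_factors hG hH ((Set.Finite.mem_toFinset _).1 ha).1
        ((Set.Finite.mem_toFinset _).1 ha).2
  choose! b t hprod hsum hmem using key
  refine Finset.card_le_card_of_injOn b (fun a ha => ?_) fun a ha a' ha' haa' => ?_
  · simp only [Finset.coe_biUnion, Set.mem_iUnion]
    refine ⟨t a, ?_, ?_⟩
    · simp only [Finset.coe_filter, Fintype.mem_piFinset, Finset.mem_range, Set.mem_ofPred_eq]
      exact ⟨fun i => Nat.lt_succ_of_le ((Finset.single_le_sum (fun _ _ => Nat.zero_le _)
        (Finset.mem_univ i)).trans (hsum a ha)), hsum a ha⟩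
    · exact Fintype.mem_piFinset.2 fun i => (Set.Finite.mem_toFinset _).2 (hmem a ha i)
  · refine intPolyOf_injective _ ?_
    rw [← hprod a ha, ← hprod a' ha', haa']

end Counting

section DyadicSum

theorem sum_two_rpow_le {α : ℝ} (hα : 0 < α) :
    ∃ K : ℝ, 0 < K ∧ ∀ T : ℕ,
      ∑ u ∈ Finset.range (T + 1), (2 : ℝ) ^ (α * u) ≤ K * 2 ^ (α * T) := by
  have hx : 1 < (2 : ℝ) ^ α := Real.one_lt_rpow one_lt_two hα
  refine ⟨2 ^ α / (2 ^ α - 1), div_pos (by positivity) (sub_pos.2 hx), fun T => ?_⟩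
  simp only [Real.rpow_mul zero_le_two, Real.rpow_natCast]
  rw [geom_sum_eq hx.ne', pow_succ, div_mul_eq_mul_div]
  refine div_le_div_of_nonneg_right ?_ (sub_pos.2 hx).le
  linarith [mul_comm (((2 : ℝ) ^ α) ^ T) (2 ^ α)]

theorem summable_two_rpow_mul_rpow {δ : ℝ} (hδ : δ < 0) (β : ℝ) :
    Summable fun t : ℕ => (2 : ℝ) ^ (δ * t) * ((t : ℝ) + 1) ^ β := by
  have hx : (2 : ℝ) ^ δ < 1 := Real.rpow_lt_one_of_one_lt_of_neg one_lt_two hδ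
  have hx0 : 0 < (2 : ℝ) ^ δ := by positivity
  have h := (summable_nat_add_iff 1).2 (summable_pow_mul_geometric_of_norm_lt_one
    ⌈β⌉₊ (r := (2 : ℝ) ^ δ) (by rwa [Real.norm_of_nonneg hx0.le]))
  refine Summable.of_nonneg_of_le (fun t => by positivity) (fun t => ?_)
    (h.mul_left ((2 : ℝ) ^ δ)⁻¹)
  rw [Real.rpow_mul zero_le_two, Real.rpow_natCast, pow_succ]
  push_cast
  have h1 : ((t : ℝ) + 1) ^ β ≤ ((t : ℝ) + 1) ^ ⌈β⌉₊ := by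
    rw [← Real.rpow_natCast]
    exact Real.rpow_le_rpow_of_exponent_le (by linarith [t.cast_nonneg (α := ℝ)]) (Nat.le_ceil β)
  calc ((2 : ℝ) ^ δ) ^ t * ((t : ℝ) + 1) ^ β ≤ ((2 : ℝ) ^ δ) ^ t * ((t : ℝ) + 1) ^ ⌈β⌉₊ := by gcongr
    _ = _ := by field_simp

theorem sum_two_rpow_mul_rpow_le {δ β : ℝ} (hδ : δ ≤ 0) (hβ : 0 ≤ β) :
    ∃ K : ℝ, 0 < K ∧ ∀ T : ℕ,
      ∑ t ∈ Finset.range (T + 1), (2 : ℝ) ^ (δ * t) * ((t : ℝ) + 1) ^ β ≤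
        K * ((T : ℝ) + 1) ^ (if δ = 0 then 1 + β else 0) := by
  rcases hδ.lt_or_eq with hδ | rfl
  · have hs := summable_two_rpow_mul_rpow hδ β
    refine ⟨_, hs.tsum_pos (fun t => by positivity) 0 (by positivity), fun T => ?_⟩
    rw [if_neg hδ.ne, Real.rpow_zero, mul_one]
    exact hs.sum_le_tsum _ fun t _ => by positivity
  · refine ⟨1, one_pos, fun T => ?_⟩
    rw [if_pos rfl, one_mul, Real.rpow_add (by positivity), Real.rpow_one]
    refine (Finset.sum_le_card_nsmul _ _ (((T : ℝ) + 1) ^ β) fun t ht => ?_).trans (by simp)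
    have : (t : ℝ) ≤ T := by exact_mod_cast Nat.lt_succ_iff.1 (Finset.mem_range.1 ht)
    rw [zero_mul, Real.rpow_zero, one_mul]
    gcongr

variable {ι : Type*} [Fintype ι] [DecidableEq ι]

theorem sum_eq_add_sum_update (t : ι → ℕ) (i₀ : ι) :
    ∑ i, t i = t i₀ + ∑ i, Function.update t i₀ 0 i := by
  rw [Finset.sum_update_of_mem (Finset.mem_univ i₀), zero_add,
    ← Finset.sum_sdiff (Finset.subset_univ {i₀}), Finset.sum_singleton, add_comm]

/-- Summing a weight over the tuples with total at most `T` is dominated by letting the total and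
all coordinates but the one at `i₀` vary independently. -/
theorem sum_simplex_le (i₀ : ι) (T : ℕ) {F : ℕ → (ι → ℕ) → ℝ} (hF : ∀ u r, 0 ≤ F u r) :
    ∑ t ∈ Fintype.piFinset (fun _ : ι => Finset.range (T + 1)) with ∑ i, t i ≤ T,
        F (∑ i, t i) (Function.update t i₀ 0) ≤
      ∑ u ∈ Finset.range (T + 1), ∑ r ∈ Fintype.piFinset
        (fun i : ι => if i = i₀ then {0} else Finset.range (T + 1)), F u r := by
  rw [← Finset.sum_product']
  let e : (ι → ℕ) → ℕ × (ι → ℕ) := fun t => (∑ i, t i, Function.update t i₀ 0)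
  have he : Function.Injective e := fun t t' h => by
    have h1 : ∑ i, t i = ∑ i, t' i := congrArg Prod.fst h
    have h2 : Function.update t i₀ 0 = Function.update t' i₀ 0 := congrArg Prod.snd h
    rw [sum_eq_add_sum_update t i₀, sum_eq_add_sum_update t' i₀, h2, Nat.add_right_cancel_iff] at h1
    funext i
    rcases eq_or_ne i i₀ with rfl | hi
    · exact h1
    · simpa [hi] using congrFun h2 i
  refine le_of_eq_of_le (Finset.sum_image (f := fun p : ℕ × (ι → ℕ) => F p.1 p.2)
    he.injOn).symm (Finset.sum_le_sum_of_subset_of_nonneg ?_ fun _ _ _ => hF _ _)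
  rintro _ hp
  obtain ⟨t, ht, rfl⟩ := Finset.mem_image.1 hp
  rw [Finset.mem_filter, Fintype.mem_piFinset] at ht
  refine Finset.mem_product.2 ⟨Finset.mem_range.2 (Nat.lt_succ_of_le ht.2),
    Fintype.mem_piFinset.2 fun i => ?_⟩
  rcases eq_or_ne i i₀ with rfl | hi
  · simp [e]
  · simpa [e, hi] using ht.1 i

theorem dyadic_sum_le {α β : ι → ℝ} (hα : ∀ i, 0 < α i) (hβ : ∀ i, 0 ≤ β i) {αmax : ℝ}
    (hmax : ∀ i, α i ≤ αmax) {i₀ : ι} (hi₀ : α i₀ = αmax) :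
    ∃ K : ℝ, 0 < K ∧ ∀ T : ℕ,
      ∑ t ∈ Fintype.piFinset (fun _ : ι => Finset.range (T + 1)) with ∑ i, t i ≤ T,
        ∏ i, ((2 : ℝ) ^ (α i * t i) * ((t i : ℝ) + 1) ^ β i) ≤
      K * 2 ^ (αmax * T) * ((T : ℝ) + 1) ^ (∑ i with α i = αmax, (1 + β i) - 1) := by
  obtain ⟨K₀, hK₀, hK₀'⟩ := sum_two_rpow_le (hi₀ ▸ hα i₀)
  choose K hK hK' using fun i => sum_two_rpow_mul_rpow_le (sub_nonpos.2 (hmax i)) (hβ i)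
  let v : ι → ℕ → ℝ := fun i t => (2 : ℝ) ^ ((α i - αmax) * t) * ((t : ℝ) + 1) ^ β i
  have hv : ∀ i t, 0 < v i t := fun i t => by positivity
  let c : ι → ℝ := fun i => if i = i₀ then 0 else if α i = αmax then 1 + β i else 0
  let K' : ι → ℝ := fun i => if i = i₀ then 1 else K i
  have hK'pos : ∀ i, 0 < K' i := fun i => by
    simp only [K']
    split_ifs
    exacts [one_pos, hK i]
  have hc : β i₀ + ∑ i, c i = ∑ i with α i = αmax, (1 + β i) - 1 := by
    have h1 : ∑ i ∈ Finset.univ.erase i₀, c i =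
        ∑ i ∈ Finset.univ.erase i₀, if α i = αmax then 1 + β i else 0 :=
      Finset.sum_congr rfl fun i hi => if_neg (Finset.ne_of_mem_erase hi)
    have h2 : c i₀ = 0 := if_pos rfl
    rw [Finset.sum_filter, ← Finset.add_sum_erase Finset.univ c (Finset.mem_univ i₀), h1, h2,
      ← Finset.add_sum_erase Finset.univ (fun i => if α i = αmax then 1 + β i else 0)
        (Finset.mem_univ i₀), if_pos hi₀]
    ring
  refine ⟨K₀ * ∏ i, K' i, mul_pos hK₀ (Finset.prod_pos fun i _ => hK'pos i), fun T => ?_⟩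
  have hcoord : ∀ i, ∑ r ∈ (if i = i₀ then {0} else Finset.range (T + 1)), v i r ≤
      K' i * ((T : ℝ) + 1) ^ c i := fun i => by
    rcases eq_or_ne i i₀ with rfl | hi
    · simp [v, K', c]
    · simpa [v, K', c, hi, sub_eq_zero] using hK' i T
  let F : ℕ → (ι → ℕ) → ℝ := fun u r => ((T : ℝ) + 1) ^ β i₀ * (2 ^ (αmax * u) * ∏ i, v i (r i))
  have hterm : ∀ t ∈ {t ∈ Fintype.piFinset (fun _ : ι => Finset.range (T + 1)) | ∑ i, t i ≤ T},
      ∏ i, ((2 : ℝ) ^ (α i * t i) * ((t i : ℝ) + 1) ^ β i) ≤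
        F (∑ i, t i) (Function.update t i₀ 0) := by
    intro t ht
    have hle : (t i₀ : ℝ) ≤ T := by
      have := Fintype.mem_piFinset.1 (Finset.mem_filter.1 ht).1 i₀
      exact_mod_cast Nat.lt_succ_iff.1 (Finset.mem_range.1 this)
    have h1 : ∏ i, ((2 : ℝ) ^ (α i * t i) * ((t i : ℝ) + 1) ^ β i) =
        2 ^ (αmax * (∑ i, t i : ℕ)) * ∏ i, v i (t i) := by
      rw [Nat.cast_sum, Finset.mul_sum, Real.rpow_sum_of_pos two_pos, ← Finset.prod_mul_distrib]
      refine Finset.prod_congr rfl fun i _ => ?_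
      rw [← mul_assoc, ← Real.rpow_add two_pos]
      ring_nf
    have h2 : ∏ i, v i (t i) ≤ ((T : ℝ) + 1) ^ β i₀ * ∏ i, v i (Function.update t i₀ 0 i) := by
      rw [← Finset.mul_prod_erase _ _ (Finset.mem_univ i₀),
        ← Finset.mul_prod_erase _ (fun i => v i (Function.update t i₀ 0 i)) (Finset.mem_univ i₀),
        Finset.prod_congr (f := fun i => v i (Function.update t i₀ 0 i)) (g := fun i => v i (t i)) rfl
          fun i hi => by rw [Function.update_of_ne (Finset.ne_of_mem_erase hi)]]
      have h0 : v i₀ (Function.update t i₀ 0 i₀) = 1 := by simp [v]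
      rw [h0, one_mul]
      refine mul_le_mul_of_nonneg_right ?_ (Finset.prod_nonneg fun i _ => (hv _ _).le)
      simp only [v, hi₀, sub_self, zero_mul, Real.rpow_zero, one_mul]
      have := hβ i₀
      gcongr
    rw [h1]
    refine (mul_le_mul_of_nonneg_left h2 (by positivity)).trans_eq ?_
    simp only [F]
    ring
  refine (Finset.sum_le_sum hterm).trans ((sum_simplex_le i₀ T fun u r => ?_).trans ?_)
  · exact mul_nonneg (by positivity)
      (mul_nonneg (by positivity) (Finset.prod_nonneg fun i _ => (hv _ _).le))
  simp only [F, ← Finset.mul_sum, ← Finset.prod_univ_sum, ← Finset.sum_mul]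
  rw [← hc, Real.rpow_add (by positivity), Real.rpow_sum_of_pos (by positivity)]
  have h3 : ∏ i, ∑ r ∈ (if i = i₀ then {0} else Finset.range (T + 1)), v i r ≤
      (∏ i, K' i) * ∏ i, ((T : ℝ) + 1) ^ c i := by
    rw [← Finset.prod_mul_distrib]
    exact Finset.prod_le_prod (fun i _ => Finset.sum_nonneg fun r _ => (hv _ _).le)
      fun i _ => hcoord i
  calc _ ≤ ((T : ℝ) + 1) ^ β i₀ * ((K₀ * 2 ^ (αmax * T)) *
        ((∏ i, K' i) * ∏ i, ((T : ℝ) + 1) ^ c i)) := by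
        refine mul_le_mul_of_nonneg_left (mul_le_mul (hK₀' T) h3 ?_ ?_) (by positivity)
        · exact Finset.prod_nonneg fun i _ => Finset.sum_nonneg fun r _ => (hv _ _).le
        · positivity
    _ = _ := by ring

end DyadicSum

theorem rpow_mul_log_rpow_two_pow_le {α β : ℝ} (hβ : 0 ≤ β) {d : ℕ} (hd : 1 ≤ d) (t : ℕ) :
    ((2 : ℝ) ^ (d + t)) ^ α * Real.log (2 ^ (d + t)) ^ β ≤
      (2 ^ (α * d) * (d : ℝ) ^ β) * (2 ^ (α * t) * ((t : ℝ) + 1) ^ β) := by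
  have h1 : ((2 : ℝ) ^ (d + t)) ^ α = 2 ^ (α * d) * 2 ^ (α * t) := by
    rw [← Real.rpow_natCast, ← Real.rpow_mul zero_le_two, ← Real.rpow_add two_pos]
    push_cast
    ring_nf
  have h2 : Real.log (2 ^ (d + t)) ≤ d * ((t : ℝ) + 1) := by
    rw [Real.log_pow]
    push_cast
    have h3 : (1 : ℝ) ≤ d := by exact_mod_cast hd
    have h4 : Real.log 2 ≤ 1 := Real.log_two_lt_d9.le.trans (by norm_num)
    nlinarith [t.cast_nonneg (α := ℝ),
      mul_le_mul_of_nonneg_left h4 (by positivity : (0 : ℝ) ≤ (d : ℝ) + t),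
      mul_nonneg (sub_nonneg.2 h3) (t.cast_nonneg (α := ℝ))]
  have h5 : Real.log (2 ^ (d + t)) ^ β ≤ (d : ℝ) ^ β * ((t : ℝ) + 1) ^ β := by
    rw [← Real.mul_rpow (by positivity) (by positivity)]
    exact Real.rpow_le_rpow (Real.log_nonneg (one_le_pow₀ one_le_two)) h2 hβ
  rw [h1]
  refine (mul_le_mul_of_nonneg_left h5 (by positivity)).trans_eq (by ring)

theorem natLog_add_one_le_mul_log {M : ℝ} (hM : 1 ≤ M) {H : ℝ} (hH : 2 ≤ H) :
    ((Nat.log 2 ⌊M * H⌋₊ : ℕ) : ℝ) + 1 ≤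
      (Real.log M / Real.log 2 + 2) / Real.log 2 * Real.log H := by
  have hMH : 1 ≤ M * H := by nlinarith
  have hpow : (2 : ℝ) ^ Nat.log 2 ⌊M * H⌋₊ ≤ M * H := by
    refine le_trans ?_ (Nat.floor_le (zero_le_one.trans hMH))
    exact_mod_cast Nat.pow_log_le_self 2 (Nat.floor_pos.2 hMH).ne'
  have h2 : 0 < Real.log 2 := Real.log_pos one_lt_two
  have hlog := Real.log_le_log (by positivity) hpow
  rw [Real.log_pow, Real.log_mul (by positivity) (by positivity)] at hlog
  have hH' : Real.log 2 ≤ Real.log H := Real.log_le_log two_pos hH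
  have hM' : Real.log M ≤ Real.log M / Real.log 2 * Real.log H := by
    rw [div_mul_eq_mul_div, le_div_iff₀ h2]
    exact mul_le_mul_of_nonneg_left hH' (Real.log_nonneg hM)
  rw [div_mul_eq_mul_div, le_div_iff₀ h2]
  linarith

/-- Theorem 6 of Bhargava's paper (intransitive groups). Let `G_i ≤ S_{n_i}` be
transitive permutation groups (`i = 1,...,k`, `k ≥ 2`), `n = n_1 + ... + n_k`, and let
`G = G_1 × ... × G_k ≤ S_n` act on the disjoint union of the letters. If
`N_{n_i}(G_i,H) ≤ A_i · H^{α_i} (log H)^{β_i}` for all `H ≥ 2`, then with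
`α = max α_i` and `s = Σ_{i : α_i = α} (1 + β_i)` one has
`N_n(G,H) = O(H^α (log H)^{s-1})`. -/
theorem subdirect_product_count_bound (k : ℕ) (hk : 2 ≤ k) (n : Fin k → ℕ)
    (hn : ∀ i, 1 ≤ n i) (G : ∀ i, Subgroup (Equiv.Perm (Fin (n i))))
    (htrans : ∀ i, MulAction.IsPretransitive (G i) (Fin (n i)))
    (A α β : Fin k → ℝ) (hA : ∀ i, 0 < A i) (hα : ∀ i, 0 < α i) (hβ : ∀ i, 0 ≤ β i)
    (hN : ∀ i, ∀ H : ℝ, 2 ≤ H →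
      (Ncount (G i) H : ℝ) ≤ A i * H ^ (α i) * Real.log H ^ (β i))
    (αmax : ℝ) (hmax1 : ∀ i, α i ≤ αmax) (hmax2 : ∃ i, α i = αmax)
    (s : ℝ) (hs : s = ∑ i ∈ Finset.univ.filter (fun i => α i = αmax), (1 + β i)) :
    ∃ C : ℝ, 0 < C ∧ ∀ H : ℝ, 2 ≤ H →
      (Ncount (Subgroup.map (Equiv.Perm.sigmaCongrRightHom (fun i => Fin (n i)))
          (Subgroup.pi Set.univ G)) H : ℝ)
        ≤ C * H ^ αmax * Real.log H ^ (s - 1) := by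
  obtain ⟨i₀, hi₀⟩ := hmax2
  obtain ⟨K, hK, hsum⟩ := dyadic_sum_le hα hβ hmax1 hi₀
  have hne : ∀ i, Nonempty (Fin (n i)) := fun i => ⟨⟨0, hn i⟩⟩
  have hs1 : 0 ≤ s - 1 := by
    have hmem : i₀ ∈ Finset.univ.filter (fun i => α i = αmax) := by simp [hi₀]
    have h1 := Finset.single_le_sum (f := fun i => 1 + β i)
      (fun i _ => add_nonneg zero_le_one (hβ i)) hmem
    rw [← hs] at h1
    linarith [hβ i₀]
  have hα0 : 0 < αmax := hi₀ ▸ hα i₀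
  set m := Fintype.card (Σ i, Fin (n i))
  have hM : (1 : ℝ) ≤ (m : ℝ) + 1 := by linarith [m.cast_nonneg (α := ℝ)]
  let B : Fin k → ℝ := fun i => A i * (2 ^ (α i * (m + 1 : ℕ)) * ((m + 1 : ℕ) : ℝ) ^ β i)
  have hB : ∀ i, 0 < B i := fun i => by
    have := hA i
    positivity
  let c : ℝ := (Real.log ((m : ℝ) + 1) / Real.log 2 + 2) / Real.log 2
  have h2 : 0 < Real.log 2 := Real.log_pos one_lt_two
  have hc : 0 < c := by
    have := Real.log_nonneg hM
    positivity
  have hPB : 0 < ∏ i, B i := Finset.prod_pos fun i _ => hB i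
  refine ⟨(∏ i, B i) * K * ((m : ℝ) + 1) ^ αmax * c ^ (s - 1), by positivity, fun H hH => ?_⟩
  have hlogH : 0 ≤ Real.log H := Real.log_nonneg (by linarith)
  have hMH : 1 ≤ ((m : ℝ) + 1) * H := by nlinarith
  set T := Nat.log 2 ⌊((m : ℝ) + 1) * H⌋₊ with hT
  have hcount := Ncount_sigma_le_sum htrans (by linarith : (1 : ℝ) ≤ H) hT
  have hT1 : (2 : ℝ) ^ (αmax * T) ≤ ((m : ℝ) + 1) ^ αmax * H ^ αmax := by
    rw [← Real.mul_rpow (by positivity) (by linarith), mul_comm αmax, Real.rpow_mul zero_le_two,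
      Real.rpow_natCast]
    refine Real.rpow_le_rpow (by positivity) ?_ hα0.le
    refine le_trans ?_ (Nat.floor_le (zero_le_one.trans hMH))
    have hpow : 2 ^ T ≤ ⌊((m : ℝ) + 1) * H⌋₊ := Nat.pow_log_le_self 2 (Nat.floor_pos.2 hMH).ne'
    simpa using (Nat.cast_le (α := ℝ)).2 hpow
  have hT2 : ((T : ℝ) + 1) ^ (s - 1) ≤ c ^ (s - 1) * Real.log H ^ (s - 1) := by
    rw [← Real.mul_rpow hc.le hlogH]
    exact Real.rpow_le_rpow (by positivity) (natLog_add_one_le_mul_log hM hH) hs1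
  have hfactor : ∀ (t : Fin k → ℕ) (i : Fin k), (Ncount (G i) (2 ^ (m + 1 + t i)) : ℝ) ≤
      B i * ((2 : ℝ) ^ (α i * t i) * ((t i : ℝ) + 1) ^ β i) := fun t i => by
    refine (hN i _ (le_self_pow₀ one_le_two (by omega))).trans ?_
    rw [mul_assoc]
    exact (mul_le_mul_of_nonneg_left (rpow_mul_log_rpow_two_pow_le (hβ i) (by omega) (t i))
      (hA i).le).trans_eq (mul_assoc _ _ _).symm
  calc (Ncount (Subgroup.map (Equiv.Perm.sigmaCongrRightHom (fun i => Fin (n i)))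
          (Subgroup.pi Set.univ G)) H : ℝ)
      ≤ ∑ t ∈ Fintype.piFinset (fun _ : Fin k => Finset.range (T + 1)) with ∑ i, t i ≤ T,
          ∏ i, (Ncount (G i) (2 ^ (m + 1 + t i)) : ℝ) := by exact_mod_cast hcount
    _ ≤ ∑ t ∈ Fintype.piFinset (fun _ : Fin k => Finset.range (T + 1)) with ∑ i, t i ≤ T,
          (∏ i, B i) * ∏ i, ((2 : ℝ) ^ (α i * t i) * ((t i : ℝ) + 1) ^ β i) := by
        refine Finset.sum_le_sum fun t _ => ?_
        rw [← Finset.prod_mul_distrib]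
        exact Finset.prod_le_prod (fun i _ => Nat.cast_nonneg _) fun i _ => hfactor t i
    _ ≤ (∏ i, B i) * (K * 2 ^ (αmax * T) * ((T : ℝ) + 1) ^ (s - 1)) := by
        rw [← Finset.mul_sum, hs]
        exact mul_le_mul_of_nonneg_left (hsum T) hPB.le
    _ ≤ (∏ i, B i) * (K * (((m : ℝ) + 1) ^ αmax * H ^ αmax) *
          (c ^ (s - 1) * Real.log H ^ (s - 1))) := by
        gcongr
    _ = _ := by ring
end

section
/- Let f be a monic irreducible integer polynomial of degree n, let K_f = ℚ[x]/(f(x)) be the corresponding number field, and let k = ind(G_f) be the index of the Galois group of f. Then the discriminant of the number field K_f is k-powerful: for every prime p dividing disc(K_f), p^k divides disc(K_f). -/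
open scoped Classical
open Polynomial

/-- The index `ind(g)` of a permutation `g` of a finite set `Ω`: `|Ω|` minus the number
of orbits of the cyclic group generated by `g` on `Ω`. -/
noncomputable def permIndex {Ω : Type*} [Fintype Ω] (g : Equiv.Perm Ω) : ℕ :=
  Fintype.card Ω - Nat.card (MulAction.orbitRel.Quotient (Subgroup.zpowers g) Ω)

/-- The index `ind(G)` of a permutation group `G ≤ Perm Ω`: the minimum of `ind(g)` over
non-identity `g ∈ G`. -/
noncomputable def groupIndex {Ω : Type*} [Fintype Ω] (G : Subgroup (Equiv.Perm Ω)) : ℕ :=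
  sInf {k | ∃ g ∈ G, g ≠ 1 ∧ permIndex g = k}

/-- An integer matrix whose reduction modulo `p` has corank at least `d` has determinant divisible
by `p ^ d`. -/
theorem Matrix.prime_pow_dvd_det_of_rank_map_le {ι F : Type*} [Fintype ι] [Field F]
    {p : ℕ} (hp : p.Prime) [CharP F p] (A : Matrix ι ι ℤ) {r : ℕ}
    (hr : (A.map (Int.cast : ℤ → F)).rank ≤ r) :
    (p : ℤ) ^ (Fintype.card ι - r) ∣ A.det := by
  have := Fact.mk hp
  let φ : ZMod p →+* F := ZMod.castHom dvd_rfl F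
  let ψ : ℤ →+* ZMod p := Int.castRingHom (ZMod p)
  obtain ⟨L, L', D, h⟩ :=
    Matrix.Pivot.exists_list_transvec_mul_mul_list_transvec_eq_diagonal (ψ.mapMatrix A)
  set U := (L.map Matrix.TransvectionStruct.toMatrix).prod
  set V := (L'.map Matrix.TransvectionStruct.toMatrix).prod
  have hUdet : U.det = 1 := Matrix.TransvectionStruct.det_toMatrix_prod L
  have hVdet : V.det = 1 := Matrix.TransvectionStruct.det_toMatrix_prod L'
  have hlift : ∀ M : Matrix ι ι (ZMod p), ∃ M' : Matrix ι ι ℤ, ψ.mapMatrix M' = M := fun M ↦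
    ⟨M.map (fun x ↦ ((x.val : ℕ) : ℤ)), by ext i j; simp [ψ]⟩
  obtain ⟨U', hU'⟩ := hlift U
  obtain ⟨V', hV'⟩ := hlift V
  have hrank : Fintype.card {i // D i ≠ 0} ≤ r := by
    have hdiag : φ.mapMatrix U * A.map (Int.cast : ℤ → F) * φ.mapMatrix V =
        Matrix.diagonal (fun i ↦ φ (D i)) := by
      have hA : A.map (Int.cast : ℤ → F) = φ.mapMatrix (ψ.mapMatrix A) := by
        ext i j; simp [ψ]
      rw [hA, ← map_mul, ← map_mul, h]
      simp [Matrix.diagonal_map]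
    have hrk := Matrix.rank_diagonal (fun i ↦ φ (D i))
    rw [← hdiag] at hrk
    have hcard : Fintype.card {i // φ (D i) ≠ 0} = Fintype.card {i // D i ≠ 0} :=
      Fintype.card_congr (Equiv.subtypeEquivRight fun i ↦ by simp)
    rw [← hcard, ← hrk]
    exact ((Matrix.rank_mul_le_left _ _).trans (Matrix.rank_mul_le_right _ _)).trans hr
  have hB : ψ.mapMatrix (U' * A * V') = Matrix.diagonal D := by
    rw [map_mul, map_mul, hU', hV', h]
  have hdvd : (p : ℤ) ^ (Finset.univ.filter (fun i ↦ D i = 0)).card ∣ (U' * A * V').det := by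
    have hrow : ∀ i, D i = 0 → ∀ j, (p : ℤ) ∣ (U' * A * V') i j := by
      intro i hi j
      rw [← ZMod.intCast_zmod_eq_zero_iff_dvd]
      have := congr_fun (congr_fun hB i) j
      rw [Matrix.diagonal_apply] at this
      simpa [hi, ψ] using this
    rw [Matrix.det_apply]
    refine Finset.dvd_sum fun σ _ ↦ ?_
    rw [Units.smul_def, smul_eq_mul]
    refine Dvd.dvd.mul_left ?_ _
    rw [← Equiv.prod_comp σ⁻¹]
    rw [← Finset.prod_const]
    refine (Finset.prod_dvd_prod_of_dvd _ (fun i ↦ (U' * A * V') (σ (σ⁻¹ i)) (σ⁻¹ i)) ?_).trans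
      (Finset.prod_dvd_prod_of_subset _ _ _ (Finset.filter_subset _ _))
    intro i hi
    simpa using hrow i (by simpa using hi) _
  have hcop : ∀ M : Matrix ι ι ℤ, (ψ.mapMatrix M).det = 1 → IsCoprime (p : ℤ) M.det := by
    intro M hM
    rw [(Nat.prime_iff_prime_int.mp hp).coprime_iff_not_dvd, ← ZMod.intCast_zmod_eq_zero_iff_dvd]
    rw [← RingHom.map_det] at hM
    change ψ M.det ≠ 0
    simp [hM]
  rw [Matrix.det_mul, Matrix.det_mul] at hdvd
  have h1 := (hcop V' (by rw [hV', hVdet])).pow_left.dvd_of_dvd_mul_right hdvd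
  have h2 := (hcop U' (by rw [hU', hUdet])).pow_left.dvd_of_dvd_mul_left h1
  refine (pow_dvd_pow _ ?_).trans h2
  have := Finset.card_filter_add_card_filter_not (s := (Finset.univ : Finset ι)) (fun i ↦ D i = 0)
  rw [Fintype.card_subtype] at hrank
  simp only [Finset.card_univ] at this
  simp only [ne_eq] at hrank
  omega

/-- A matrix whose rows are invariant under a permutation `π` of the row indices has rank at most
the number of orbits of `π`. -/
theorem Matrix.rank_le_card_orbits {ι κ F : Type*} [Finite ι] [Fintype κ] [Field F]
    (π : Equiv.Perm ι) (M : Matrix ι κ F) (hM : ∀ i j, M (π i) j = M i j) :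
    M.rank ≤ Nat.card (MulAction.orbitRel.Quotient (Subgroup.zpowers π) ι) := by
  let H : Subgroup (Equiv.Perm ι) :=
    { carrier := {g | ∀ i, M.row (g i) = M.row i}
      mul_mem' := fun ha hb i ↦ (ha _).trans (hb i)
      one_mem' := fun _ ↦ rfl
      inv_mem' := fun {g} hg i ↦ by simpa using (hg (g⁻¹ i)).symm }
  have hconst : Subgroup.zpowers π ≤ H :=
    Subgroup.zpowers_le.mpr fun i ↦ funext (hM i)
  let r : MulAction.orbitRel.Quotient (Subgroup.zpowers π) ι → κ → F :=
    Quotient.lift M.row (by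
      rintro a b ⟨g, rfl⟩
      exact hconst g.2 b)
  have hr : Set.range M.row = Set.range r := by
    ext v
    constructor
    · rintro ⟨i, rfl⟩
      exact ⟨Quotient.mk _ i, rfl⟩
    · rintro ⟨q, rfl⟩
      induction q using Quotient.inductionOn with
      | _ i => exact ⟨i, rfl⟩
  have := Fintype.ofFinite (MulAction.orbitRel.Quotient (Subgroup.zpowers π) ι)
  rw [Matrix.rank_eq_finrank_span_row, hr, Nat.card_eq_fintype_card]
  exact finrank_range_le_card r

open scoped NumberField in
/-- A prime dividing the discriminant of a Galois number field has a nontrivial inertia group. -/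
theorem NumberField.exists_mem_inertia_ne_one (L : Type*) [Field L] [NumberField L]
    [IsGalois ℚ L] {p : ℕ} (hp : p.Prime) (hdvd : (p : ℤ) ∣ NumberField.discr L) :
    ∃ Q : Ideal (𝓞 L), Q.IsMaximal ∧ (p : 𝓞 L) ∈ Q ∧ ∃ g ∈ Q.inertia Gal(L/ℚ), g ≠ 1 := by
  have hp' := Nat.prime_iff_prime_int.mp hp
  have h := mt (NumberField.not_dvd_discr_iff_forall_liesOver L (𝓞 L) hp').mpr (not_not.mpr hdvd)
  push Not at h
  obtain ⟨Q, hQ, hover, hram⟩ := h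
  refine ⟨Q, hQ, ?_, ?_⟩
  · have := (Ideal.mem_of_liesOver Q (Ideal.span {(p : ℤ)}) p).mp (Ideal.mem_span_singleton_self _)
    simpa using this
  · by_contra! hne
    have hbot : Q.inertia Gal(L/ℚ) = ⊥ := (Subgroup.eq_bot_iff_forall _).mpr hne
    have : (Ideal.span {(p : ℤ)}).IsMaximal :=
      PrincipalIdealRing.isMaximal_of_irreducible hp'.irreducible
    have : Finite (ℤ ⧸ Ideal.span {(p : ℤ)}) :=
      Ideal.finiteQuotientOfFreeOfNeBot _ (by simpa using hp.ne_zero)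
    have : Finite (Ideal.span {(p : ℤ)}).ResidueField :=
      Finite.of_surjective _ (Ideal.bijective_algebraMap_quotient_residueField _).2
    have hcard := Ideal.card_inertia_eq_ramificationIdxIn (G := Gal(L/ℚ)) (Ideal.span {(p : ℤ)}) Q
    rw [hbot, Subgroup.card_bot, Ideal.ramificationIdxIn_eq_ramificationIdx _ Q Gal(L/ℚ)] at hcard
    exact hram (Ideal.ramificationIdx_eq_one_iff.mp hcard.symm)

/-- If `L / F` is normal and `K` embeds into `L`, then minimal polynomials of elements of `K`
split in `L`. -/
theorem minpoly_splits_of_algHom {F K L : Type*} [Field F] [Field K] [Field L] [Algebra F K]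
    [Algebra F L] [Normal F L] (φ : K →ₐ[F] L) (x : K) :
    ((minpoly F x).map (algebraMap F L)).Splits := by
  rw [← minpoly.algHom_eq φ φ.injective]
  exact Normal.splits inferInstance _

theorem trace_eq_sum_algHom_of_normal {F K L : Type*} [Field F] [Field K] [Field L] [Algebra F K]
    [Algebra F L] [FiniteDimensional F K] [Algebra.IsSeparable F K] [Normal F L]
    (φ : K →ₐ[F] L) (x : K) :
    algebraMap F L (Algebra.trace F K x) = ∑ σ : K →ₐ[F] L, σ x := by
  apply FaithfulSMul.algebraMap_injective L (AlgebraicClosure L)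
  rw [← IsScalarTower.algebraMap_apply, trace_eq_sum_embeddings, map_sum]
  exact (Fintype.sum_equiv (Algebra.IsAlgebraic.algHomEquivAlgHomOfSplits (AlgebraicClosure L) L
    (minpoly_splits_of_algHom φ)) _ _ fun σ ↦ rfl).symm

theorem card_algHom_of_normal {F K L : Type*} [Field F] [Field K] [Field L] [Algebra F K]
    [Algebra F L] [FiniteDimensional F K] [Algebra.IsSeparable F K] [Normal F L]
    (φ : K →ₐ[F] L) : Fintype.card (K →ₐ[F] L) = Module.finrank F K := by
  rw [← AlgHom.card F K (AlgebraicClosure L)]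
  exact Fintype.card_congr (Algebra.IsAlgebraic.algHomEquivAlgHomOfSplits (AlgebraicClosure L) L
    (minpoly_splits_of_algHom φ))

open scoped NumberField in
/-- If `g` is in the inertia group of a prime of `L` over `p`, then the discriminant of a subfield `K`
is divisible by `p` to the power of the index of `g` acting on the embeddings of `K` into `L`. -/
theorem NumberField.prime_pow_dvd_discr_of_mem_inertia {ι K L : Type*} [Fintype ι] [Field K]
    [NumberField K] [Field L] [NumberField L] [Normal ℚ L] {p : ℕ} (hp : p.Prime)
    (Q : Ideal (𝓞 L)) [Q.IsMaximal] (hpQ : (p : 𝓞 L) ∈ Q) {g : Gal(L/ℚ)}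
    (hg : g ∈ Q.inertia Gal(L/ℚ)) (φ : K →ₐ[ℚ] L) (τ : ι ≃ (K →ₐ[ℚ] L)) (π : Equiv.Perm ι)
    (hπ : ∀ i x, τ (π i) x = g (τ i x)) :
    (p : ℤ) ^ (Fintype.card ι -
      Nat.card (MulAction.orbitRel.Quotient (Subgroup.zpowers π) ι)) ∣ NumberField.discr K := by
  let _ : Field (𝓞 L ⧸ Q) := Ideal.Quotient.field Q
  have : CharP (𝓞 L ⧸ Q) p := (CharP.charP_iff_prime_eq_zero hp).mpr <| by
    simpa using Ideal.Quotient.eq_zero_iff_mem.mpr hpQ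
  let b := NumberField.RingOfIntegers.basis K
  have hcard : Fintype.card ι = Fintype.card (Module.Free.ChooseBasisIndex ℤ (𝓞 K)) := by
    rw [Fintype.card_congr τ, card_algHom_of_normal φ, ← NumberField.RingOfIntegers.rank K,
      Module.finrank_eq_card_chooseBasisIndex]
  let E : ι → 𝓞 K →+* 𝓞 L := fun i ↦ NumberField.RingOfIntegers.mapRingHom (τ i)
  let N : Matrix ι (Module.Free.ChooseBasisIndex ℤ (𝓞 K)) (𝓞 L ⧸ Q) :=
    Matrix.of fun i j ↦ Ideal.Quotient.mk Q (E i (b j))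
  have htrace : ∀ x : 𝓞 K, ((Algebra.trace ℤ (𝓞 K) x : ℤ) : 𝓞 L) = ∑ i, E i x := by
    intro x
    apply NumberField.RingOfIntegers.coe_injective
    have h := trace_eq_sum_algHom_of_normal φ (x : K)
    rw [← Algebra.coe_trace_int, ← Equiv.sum_comp τ] at h
    simpa [E] using h
  have hmul : (Algebra.traceMatrix ℤ b).map (Int.cast : ℤ → 𝓞 L ⧸ Q) = N.transpose * N := by
    ext i j
    have h := congr_arg (Ideal.Quotient.mk Q) (htrace (b i * b j))
    simpa [Matrix.mul_apply, N, Algebra.traceMatrix_apply, Algebra.traceForm_apply] using h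
  have hrow : ∀ i j, N (π i) j = N i j := by
    intro i j
    have h := hg (E i (b j))
    have hE : E (π i) (b j) = g • E i (b j) :=
      NumberField.RingOfIntegers.coe_injective (hπ i (b j))
    simpa [N, hE, Ideal.Quotient.eq] using h
  rw [← NumberField.discr_eq_discr K b, Algebra.discr_def, hcard]
  refine Matrix.prime_pow_dvd_det_of_rank_map_le (F := 𝓞 L ⧸ Q) hp _ ?_
  rw [hmul]
  exact (Matrix.rank_mul_le_right _ _).trans (Matrix.rank_le_card_orbits π N hrow)

/-- The roots in `B` of an irreducible polynomial `P` with root `α` correspond to the embeddings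
into `B` of the field generated by `α`, compatibly with the action of the automorphisms of `B`. -/
theorem exists_rootSet_equiv_algHom {F K B : Type*} [Field F] [Field K] [Field B] [Algebra F K]
    [Algebra F B] {P : F[X]} (hmonic : P.Monic) (hirr : Irreducible P) {α : K}
    (hgen : IntermediateField.adjoin F {α} = ⊤) (hroot : aeval α P = 0) :
    ∃ τ : P.rootSet B ≃ (K →ₐ[F] B), ∀ (g : Gal(B/F)) (r s : P.rootSet B),
      (s : B) = g r → ∀ x, τ s x = g (τ r x) := by
  have hmin : P = minpoly F α := minpoly.eq_of_irreducible_of_monic hirr hroot hmonic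
  have hint : IsIntegral F α := ⟨P, hmonic, hroot⟩
  let pb := PowerBasis.ofAdjoinEqTop hint
    ((IntermediateField.adjoin_simple_eq_top_iff_of_isAlgebraic hint.isAlgebraic).mp hgen)
  have hpb : pb.gen = α := PowerBasis.ofAdjoinEqTop_gen _ _
  have hmem : ∀ y : B, y ∈ P.rootSet B ↔ aeval y (minpoly F pb.gen) = 0 := by
    intro y
    rw [hpb, ← hmin, mem_rootSet_of_ne hirr.ne_zero]
  let τ : P.rootSet B ≃ (K →ₐ[F] B) := (Equiv.subtypeEquivRight hmem).trans pb.liftEquiv.symm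
  have hτ : ∀ r, τ r pb.gen = r := fun r ↦ pb.lift_gen (r : B) ((hmem r).mp r.2)
  refine ⟨τ, fun g r s hrs x ↦ ?_⟩
  have hext : τ s = (g : B →ₐ[F] B).comp (τ r) := pb.algHom_ext <| by
    rw [hτ, AlgHom.comp_apply, hτ, hrs]
    rfl
  rw [hext]
  rfl

/-- Proposition 2.3 of Bhargava's paper. Let `f` be a monic irreducible integer
polynomial of degree `n`, let `K_f = ℚ[x]/(f)` be the corresponding number field
(realized as a number field `K` generated over `ℚ` by a root `α` of `f`), and let
`k = ind(G_f)`. Then `disc(K_f)` is `k`-powerful: every prime `p` dividing `disc(K_f)`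
satisfies `p^k ∣ disc(K_f)`. -/
theorem discriminant_powerful_of_index (n : ℕ) (f : Polynomial ℤ)
    (hmonic : f.Monic) (hdeg : f.natDegree = n)
    (hirr : Irreducible (f.map (Int.castRingHom ℚ)))
    (K : Type*) [Field K] [NumberField K] (α : K)
    (hgen : IntermediateField.adjoin ℚ {α} = ⊤)
    (hroot : Polynomial.aeval α (f.map (Int.castRingHom ℚ)) = 0)
    (k : ℕ) (hk : k = groupIndex (galPermGroup (f.map (Int.castRingHom ℚ)))) :
    ∀ p : ℕ, p.Prime → (p : ℤ) ∣ NumberField.discr K →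
      (p : ℤ) ^ k ∣ NumberField.discr K := by
  intro p hp hdvd
  set P : ℚ[X] := f.map (Int.castRingHom ℚ)
  have : Fact ((P.map (algebraMap ℚ ℂ)).Splits) := ⟨IsAlgClosed.splits _⟩
  have : NumberField P.SplittingField := ⟨⟩
  have : Normal ℚ P.SplittingField := SplittingField.instNormal P
  have : IsGalois ℚ P.SplittingField := ⟨⟩
  obtain ⟨τ, hτ⟩ := exists_rootSet_equiv_algHom (P := P) (B := P.SplittingField) (hmonic.map _)
    hirr hgen hroot
  obtain ⟨r, hr⟩ := (SplittingField.splits P).exists_eval_eq_zero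
    (by simpa using (degree_pos_of_irreducible hirr).ne')
  let φ : K →ₐ[ℚ] P.SplittingField :=
    τ ⟨r, (mem_rootSet_of_ne hirr.ne_zero).mpr (by rwa [eval_map_algebraMap] at hr)⟩
  have hdvdL : (p : ℤ) ∣ NumberField.discr P.SplittingField := by
    let _ : Algebra K P.SplittingField := φ.toRingHom.toAlgebra
    exact hdvd.trans (NumberField.discr_dvd_discr K P.SplittingField)
  obtain ⟨Q, hQ, hpQ, g, hg, hne⟩ :=
    NumberField.exists_mem_inertia_ne_one P.SplittingField hp hdvdL
  let π : Equiv.Perm (P.rootSet ℂ) := Gal.galActionHom P ℂ g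
  have hequiv : ∀ i x, τ ((Gal.rootsEquivRoots P ℂ).symm (π i)) x =
      g (τ ((Gal.rootsEquivRoots P ℂ).symm i) x) := by
    intro i
    exact hτ g _ _ (congr_arg Subtype.val ((Gal.rootsEquivRoots P ℂ).symm_apply_apply _))
  have hdiv := NumberField.prime_pow_dvd_discr_of_mem_inertia hp Q hpQ hg φ
    ((Gal.rootsEquivRoots P ℂ).symm.trans τ) π hequiv
  refine (pow_dvd_pow _ ?_).trans hdiv
  rw [hk]
  refine Nat.sInf_le ⟨π, ⟨g, rfl⟩, ?_, ?_⟩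
  · exact fun h ↦ hne (Gal.galActionHom_injective P ℂ (h.trans (map_one _).symm))
  · unfold permIndex
    congr!
end
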